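/- Assume the AG₂ setup and the definition of the operator D₁ below, with κ_τ = 3 for τ ∈ {±2βⱼ} and κ_τ = 1 for τ ∈ {±2αⱼ}, and μ(x) = ∑_{τ : τ/2 ∈ G₂} κ_τ(exp⟨x,τ⟩ − 1). Let x ∈ ℂ² satisfy sinh⟨γ,x⟩ ≠ 0 for every γ ∈ AG₂₊, and let ψ be a Baker–Akhiezer function for AG₂ at x. Then ψ is an eigenfunction of D₁ with eigenvalue μ(x): for every D₁-regular z ∈ ℂ², ∑_{τ : τ/2 ∈ G₂} a_τ(z)·(ψ(z+τ) − ψ(z)) = μ(x)·ψ(z). This establishes the bispectral duality for the AG₂ generalised Calogero–Moser–Sutherland system. -/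

import Mathlib

noncomputable section

open Complex

/-- The bilinear extension of the Euclidean inner product on `ℂ²`. -/
def bil (z w : Fin 2 → ℂ) : ℂ := z 0 * w 0 + z 1 * w 1

/-- `√3` as a complex number. -/
def rt3 : ℂ := (Real.sqrt 3 : ℝ)

def vα₁ : Fin 2 → ℂ := ![0, rt3]
def vα₂ : Fin 2 → ℂ := ![-(3/2), rt3 / 2]
def vα₃ : Fin 2 → ℂ := ![3/2, rt3 / 2]
def vβ₁ : Fin 2 → ℂ := ![1, 0]
def vβ₂ : Fin 2 → ℂ := ![1/2, rt3 / 2]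
def vβ₃ : Fin 2 → ℂ := ![-(1/2), rt3 / 2]

/-- Positive roots of `G₂`: `α₁, α₂, α₃, β₁, β₂, β₃`. -/
def G2plus : List (Fin 2 → ℂ) := [vα₁, vα₂, vα₃, vβ₁, vβ₂, vβ₃]
/-- The six short roots `±βᵢ` of `G₂`. -/
def shortRoots : List (Fin 2 → ℂ) := [vβ₁, vβ₂, vβ₃, -vβ₁, -vβ₂, -vβ₃]
/-- The six long roots `±αᵢ` of `G₂`. -/
def longRoots : List (Fin 2 → ℂ) := [vα₁, vα₂, vα₃, -vα₁, -vα₂, -vα₃]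
/-- All twelve roots of `G₂`. -/
def G2all : List (Fin 2 → ℂ) := longRoots ++ shortRoots
/-- The twelve vectors `2γ`, `γ ∈ G₂`. -/
def twoG2 : List (Fin 2 → ℂ) := G2all.map (fun γ => (2 : ℂ) • γ)
/-- The six vectors `±2βⱼ`. -/
def twoShort : List (Fin 2 → ℂ) := shortRoots.map (fun γ => (2 : ℂ) • γ)
/-- The six vectors `±2αⱼ`. -/
def twoLong : List (Fin 2 → ℂ) := longRoots.map (fun γ => (2 : ℂ) • γ)
/-- The six vectors `±4βⱼ`. -/
def fourShort : List (Fin 2 → ℂ) := shortRoots.map (fun γ => (4 : ℂ) • γ)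
/-- The eighteen vectors `2γ`, `γ ∈ AG₂`. -/
def twoAG2 : List (Fin 2 → ℂ) := twoG2 ++ fourShort

/-- The quasi-invariance conditions for the configuration `AG₂` with
multiplicities `m_{αᵢ} = m`, `m_{βᵢ} = 3m`, `m_{2βᵢ} = 1`. -/
def QuasiInvAG2 (m : ℕ) (ψ : (Fin 2 → ℂ) → ℂ) : Prop :=
  (∀ α ∈ [vα₁, vα₂, vα₃], ∀ s : ℕ, 1 ≤ s → s ≤ m →
    ∀ z : Fin 2 → ℂ, bil α z = 0 →
      ψ (z + (s : ℂ) • α) = ψ (z - (s : ℂ) • α)) ∧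
  (∀ β ∈ [vβ₁, vβ₂, vβ₃], ∀ s : ℕ, ((1 ≤ s ∧ s ≤ 3 * m) ∨ s = 3 * m + 2) →
    ∀ z : Fin 2 → ℂ, bil β z = 0 →
      ψ (z + (s : ℂ) • β) = ψ (z - (s : ℂ) • β))

/-- The linear form `z ↦ ⟨γ, z⟩` as a polynomial in `z₁, z₂`. -/
def linForm (γ : Fin 2 → ℂ) : MvPolynomial (Fin 2) ℂ :=
  MvPolynomial.C (γ 0) * MvPolynomial.X 0 + MvPolynomial.C (γ 1) * MvPolynomial.X 1

/-- The highest-order term `∏ᵢ ⟨αᵢ,z⟩^m ⟨βᵢ,z⟩^{3m} ⟨2βᵢ,z⟩` of the polynomial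
part of the Baker–Akhiezer function for `AG₂`. -/
def topTerm (m : ℕ) : MvPolynomial (Fin 2) ℂ :=
  (linForm vα₁ * linForm vα₂ * linForm vα₃) ^ m *
    (linForm vβ₁ * linForm vβ₂ * linForm vβ₃) ^ (3 * m) *
    (linForm ((2 : ℂ) • vβ₁) * linForm ((2 : ℂ) • vβ₂) * linForm ((2 : ℂ) • vβ₃))

/-- A Baker–Akhiezer function for `AG₂` at `x`. -/
def IsBAFunction (m : ℕ) (x : Fin 2 → ℂ) (ψ : (Fin 2 → ℂ) → ℂ) : Prop :=
  ∃ P : MvPolynomial (Fin 2) ℂ,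
    P.totalDegree = 12 * m + 3 ∧
    MvPolynomial.homogeneousComponent (12 * m + 3) P = topTerm m ∧
    (∀ z, ψ z = MvPolynomial.eval z P * Complex.exp (bil z x)) ∧
    QuasiInvAG2 m ψ

/-- `z` is `D₁`-regular: `⟨γ,z⟩ ∉ {0, ±γ², ±2γ²}` for every `γ ∈ G₂₊`. -/
def D1Reg (z : Fin 2 → ℂ) : Prop :=
  ∀ γ ∈ G2plus, bil γ z ≠ 0 ∧ bil γ z ≠ bil γ γ ∧ bil γ z ≠ -bil γ γ ∧
    bil γ z ≠ 2 * bil γ γ ∧ bil γ z ≠ -(2 * bil γ γ)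

open scoped Classical in
/-- The coefficient functions `a_τ` (for `τ/2 ∈ G₂`) of the dual
Macdonald–Ruijsenaars operator `D₁` for `AG₂`. -/
noncomputable def aD1 (m : ℕ) (τ z : Fin 2 → ℂ) : ℂ :=
  let h : Fin 2 → ℂ := (2⁻¹ : ℂ) • τ
  if τ ∈ twoShort then
    3 *
      ((shortRoots.filter (fun γ => bil τ γ = bil γ γ)).map (fun γ =>
        (1 - (3 * (m : ℂ) + 2) * bil γ γ / bil γ z) *
        (1 + 3 * (m : ℂ) * bil γ γ / (bil γ z + 2 * bil γ γ)) *
        (1 - (3 * (m : ℂ) - 1) * bil γ γ / (bil γ z - bil γ γ)))).prod *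
      ((longRoots.filter (fun γ => bil τ γ = bil γ γ)).map (fun γ =>
        1 - (m : ℂ) * bil γ γ / bil γ z)).prod *
      ((1 - (3 * (m : ℂ) + 2) * bil h h / bil h z) *
        (1 - 3 * (m : ℂ) * bil h h / (bil h z + bil h h)))
  else
    ((shortRoots.filter (fun γ => bil τ γ = 3 * bil γ γ)).map (fun γ =>
        (1 - (3 * (m : ℂ) + 2) * bil γ γ / bil γ z) *
        (1 - (3 * (m : ℂ) + 1) * bil γ γ / (bil γ z + bil γ γ)) *
        (1 - 3 * (m : ℂ) * bil γ γ / (bil γ z + 2 * bil γ γ)))).prod *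
      ((longRoots.filter (fun γ => bil τ γ = bil γ γ)).map (fun γ =>
        1 - (m : ℂ) * bil γ γ / bil γ z)).prod *
      ((1 - (m : ℂ) * bil h h / bil h z) *
        (1 - (m : ℂ) * bil h h / (bil h z + bil h h)))

/-- The value `D₁p(z) = ∑_{τ : τ/2 ∈ G₂} a_τ(z)(p(z+τ) − p(z))`. -/
noncomputable def applyD1 (m : ℕ) (p : (Fin 2 → ℂ) → ℂ) (z : Fin 2 → ℂ) : ℂ :=
  (twoG2.map (fun τ => aD1 m τ z * (p (z + τ) - p z))).sum

/-- The ring `R^a_{AG₂}` of analytic quasi-invariants for `AG₂`. -/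
def RaAG2 (m : ℕ) (p : (Fin 2 → ℂ) → ℂ) : Prop :=
  (∀ z, AnalyticAt ℂ p z) ∧ QuasiInvAG2 m p

open scoped Classical in
/-- The constant `κ_τ`: `3` for `τ = ±2βⱼ` and `1` for `τ = ±2αⱼ`. -/
noncomputable def kap (τ : Fin 2 → ℂ) : ℂ := if τ ∈ twoShort then 3 else 1

/-- The eigenvalue `μ(x) = ∑_{τ : τ/2 ∈ G₂} κ_τ (exp⟨x,τ⟩ − 1)` of `D₁`. -/
noncomputable def muD1 (x : Fin 2 → ℂ) : ℂ :=
  (twoG2.map (fun τ => kap τ * (Complex.exp (bil x τ) - 1))).sum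

/-- The positive half `AG₂₊` of the configuration `AG₂`. -/
noncomputable def AG2plus : List (Fin 2 → ℂ) :=
  G2plus ++ [(2 : ℂ) • vβ₁, (2 : ℂ) • vβ₂, (2 : ℂ) • vβ₃]

noncomputable section
open Complex

/-! ### Polynomials in two variables -/

abbrev MP := MvPolynomial (Fin 2) ℂ

/-- the linear form `a p + b q` -/
def lin (a b : ℂ) : MP := MvPolynomial.C a * MvPolynomial.X 0 + MvPolynomial.C b * MvPolynomial.X 1

lemma eval_lin (a b : ℂ) (v : Fin 2 → ℂ) : MvPolynomial.eval v (lin a b) = a * v 0 + b * v 1 := by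
  simp [lin]

/-- all monomials have degree `< k` -/
def Lt (f : MP) (k : ℕ) : Prop := ∀ d, MvPolynomial.coeff d f ≠ 0 → d.degree < k

lemma Lt.add {f g : MP} {k : ℕ} (hf : Lt f k) (hg : Lt g k) : Lt (f + g) k := by
  intro d hd
  by_cases h : MvPolynomial.coeff d f = 0
  · refine hg d ?_
    intro h2; apply hd; simp [h, h2]
  · exact hf d h

lemma Lt.zero (k : ℕ) : Lt 0 k := by
  intro d hd; simp at hd

lemma Lt.mono {f : MP} {k l : ℕ} (hf : Lt f k) (h : k ≤ l) : Lt f l :=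
  fun d hd => lt_of_lt_of_le (hf d hd) h

lemma Lt.mul {f g : MP} {k l : ℕ} (hf : Lt f (k + 1)) (hg : Lt g l) : Lt (f * g) (k + l) := by
  intro d hd
  rw [MvPolynomial.coeff_mul] at hd
  obtain ⟨x, hx, hne⟩ := Finset.exists_ne_zero_of_sum_ne_zero hd
  have h1 := hf x.1 (left_ne_zero_of_mul hne)
  have h2 := hg x.2 (right_ne_zero_of_mul hne)
  rw [Finset.HasAntidiagonal.mem_antidiagonal] at hx
  rw [← hx, map_add]
  omega

lemma Lt.mul' {f g : MP} {k l : ℕ} (hf : Lt f k) (hg : Lt g (l + 1)) : Lt (f * g) (k + l) := by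
  rw [mul_comm, add_comm]; exact hg.mul hf

lemma Lt.C (c : ℂ) : Lt (MvPolynomial.C c) 1 := by
  intro d hd
  rw [MvPolynomial.coeff_C] at hd
  have : d = 0 := by
    by_contra h; exact hd (if_neg (fun h' => h h'.symm))
  simp [this]

lemma Lt.X (i : Fin 2) : Lt (MvPolynomial.X i) 2 := by
  intro d hd
  rw [MvPolynomial.coeff_X] at hd
  have : d = Finsupp.single i 1 := by
    by_contra h; exact hd (if_neg (fun h' => h h'.symm))
  simp [this]

lemma Lt.Cmul {f : MP} {k : ℕ} (c : ℂ) (hf : Lt f k) : Lt (MvPolynomial.C c * f) k := by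
  simpa using (Lt.C c).mul (k := 0) hf

lemma Lt.neg {f : MP} {k : ℕ} (hf : Lt f k) : Lt (-f) k := by
  simpa using hf.Cmul (-1)

lemma Lt.sub {f g : MP} {k : ℕ} (hf : Lt f k) (hg : Lt g k) : Lt (f - g) k := by
  rw [sub_eq_add_neg]; exact hf.add hg.neg

lemma Lt.lin (a b : ℂ) : Lt (lin a b) 2 :=
  ((Lt.X 0).Cmul a).add ((Lt.X 1).Cmul b)

lemma Lt.iff {f : MP} (hf : f ≠ 0) (k : ℕ) : Lt f k ↔ f.totalDegree < k := by
  constructor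
  · intro h
    obtain ⟨d, hd, he⟩ : ∃ d ∈ f.support, f.totalDegree = d.degree := by
      have := Finset.exists_mem_eq_sup f.support (by simpa using hf) (fun d => d.degree)
      simpa [MvPolynomial.totalDegree, Finsupp.degree_apply, Finsupp.sum] using this
    rw [he]; exact h d (by simpa using hd)
  · intro h d hd
    have := MvPolynomial.le_totalDegree (p := f) (s := d) (by simpa using hd)
    refine lt_of_le_of_lt ?_ h
    simpa [Finsupp.degree_apply, Finsupp.sum] using this

lemma Lt.of_mul {f g : MP} {k l : ℕ} (hf : f ≠ 0) (hd : f.totalDegree = k) (h : Lt (f * g) (k + l)) :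
    Lt g l := by
  by_cases hg : g = 0
  · rw [hg]; exact Lt.zero _
  · rw [Lt.iff hg]
    rw [Lt.iff (mul_ne_zero hf hg), MvPolynomial.totalDegree_mul_of_isDomain hf hg] at h
    omega

/-- `f` and `g` have degree `≤ k` and the same degree-`k` part -/
def Eq' (f g : MP) (k : ℕ) : Prop := Lt f (k + 1) ∧ Lt g (k + 1) ∧ Lt (f - g) k

lemma Eq'.mul {f g f' g' : MP} {k l : ℕ} (h : Eq' f g k) (h' : Eq' f' g' l) :
    Eq' (f * f') (g * g') (k + l) := by
  refine ⟨h.1.mul h'.1, h.2.1.mul h'.2.1, ?_⟩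
  have : f * f' - g * g' = f * (f' - g') + (f - g) * g' := by ring
  rw [this]
  exact (h.1.mul h'.2.2).add (h.2.2.mul' h'.2.1)

lemma Eq'.pow {f g : MP} {k : ℕ} (h : Eq' f g k) (n : ℕ) : Eq' (f ^ n) (g ^ n) (n * k) := by
  induction n with
  | zero => simpa [Eq'] using And.intro (Lt.C 1) (Lt.zero 0)
  | succ n ih => rw [pow_succ, pow_succ, add_mul, one_mul]; exact ih.mul h

lemma Eq'.trans_symm {f g h : MP} {k : ℕ} (h1 : Eq' f h k) (h2 : Eq' g h k) : Eq' f g k := by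
  refine ⟨h1.1, h2.1, ?_⟩
  have : f - g = (f - h) - (g - h) := by ring
  rw [this]; exact h1.2.2.sub h2.2.2

lemma Eq'.linC (a b c : ℂ) : Eq' (lin a b + MvPolynomial.C c) (lin a b) 1 :=
  ⟨(Lt.lin a b).add ((Lt.C c).mono (by norm_num)), Lt.lin a b, by simpa using Lt.C c⟩

lemma Eq'.XC (i : Fin 2) (c : ℂ) : Eq' (MvPolynomial.X i + MvPolynomial.C c) (MvPolynomial.X i) 1 :=
  ⟨(Lt.X i).add ((Lt.C c).mono (by norm_num)), Lt.X i, by simpa using Lt.C c⟩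

/-- translation of a polynomial -/
def shf (a b : ℂ) (P : MP) : MP :=
  MvPolynomial.bind₁ ![MvPolynomial.X 0 + MvPolynomial.C a, MvPolynomial.X 1 + MvPolynomial.C b] P

lemma eval_shf (a b : ℂ) (P : MP) (p q : ℂ) :
    MvPolynomial.eval ![p, q] (shf a b P) = MvPolynomial.eval ![p + a, q + b] P := by
  rw [shf, ← MvPolynomial.coe_aeval_eq_eval, RingHom.coe_coe,
    MvPolynomial.aeval_bind₁, ← MvPolynomial.coe_aeval_eq_eval, RingHom.coe_coe]
  congr 2
  ext i; fin_cases i <;> simp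

lemma Eq'.shf {P : MP} {d : ℕ} (hP : Lt P (d + 1)) (a b : ℂ) : Eq' (shf a b P) P d := by
  have key : ∀ Q : MP, (∀ e, MvPolynomial.coeff e Q ≠ 0 → MvPolynomial.coeff e P ≠ 0) →
      Eq' (_root_.shf a b Q) Q d := by
    intro Q
    induction Q using MvPolynomial.monomial_add_induction_on with
    | C c =>
      intro h
      refine ⟨?_, ?_, ?_⟩
      · simpa [_root_.shf] using (Lt.C c).mono (by omega)
      · exact (Lt.C c).mono (by omega)
      · simpa [_root_.shf] using Lt.zero d
    | monomial_add e c f he hc ih =>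
      intro h
      have hf : Eq' (_root_.shf a b f) f d := by
        apply ih
        intro e' he'
        apply h
        rw [MvPolynomial.coeff_add, MvPolynomial.coeff_monomial]
        split_ifs with h1
        · subst h1; exact absurd (MvPolynomial.notMem_support_iff.1 he) he'
        · simpa using he'
      have he2 : e.degree < d + 1 := by
        apply hP; apply h
        rw [MvPolynomial.coeff_add, MvPolynomial.coeff_monomial]
        have he := MvPolynomial.notMem_support_iff.1 he
        simp [he, hc]
      have hm : Eq' (_root_.shf a b (MvPolynomial.monomial e c)) (MvPolynomial.monomial e c) e.degree := by
        have e1 : (MvPolynomial.monomial e c : MP) =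
            MvPolynomial.C c * (MvPolynomial.X 0 ^ e 0 * MvPolynomial.X 1 ^ e 1) := by
          rw [MvPolynomial.monomial_eq, Finsupp.prod_fintype _ _ (by simp)]; simp
        have e2 : e.degree = 0 + (e 0 * 1 + e 1 * 1) := by
          simp [Finsupp.degree_eq_sum]
        rw [e2, e1]
        have : _root_.shf a b (MvPolynomial.C c * (MvPolynomial.X 0 ^ e 0 * MvPolynomial.X 1 ^ e 1)) =
          MvPolynomial.C c * ((MvPolynomial.X 0 + MvPolynomial.C a) ^ e 0 *
            (MvPolynomial.X 1 + MvPolynomial.C b) ^ e 1) := by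
          simp [_root_.shf]
        rw [this]
        refine Eq'.mul ⟨Lt.C c, Lt.C c, by simpa using Lt.zero 0⟩ (((Eq'.XC 0 a).pow _).mul ((Eq'.XC 1 b).pow _))
      have hs : _root_.shf a b (MvPolynomial.monomial e c + f) =
        _root_.shf a b (MvPolynomial.monomial e c) + _root_.shf a b f := by simp [_root_.shf]
      rw [hs]
      refine ⟨(hm.1.mono (by omega)).add hf.1, (hm.2.1.mono (by omega)).add hf.2.1, ?_⟩
      rw [add_sub_add_comm]
      exact (hm.2.2.mono (by omega)).add hf.2.2
  exact key P (fun e h => h)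

/-! ### lines -/

lemma line_dvd (a b c : ℂ) (hab : a ≠ 0 ∨ b ≠ 0) (N : MP)
    (h : ∀ p q, a * p + b * q = c → MvPolynomial.eval ![p, q] N = 0) :
    lin a b - MvPolynomial.C c ∣ N := by
  have gen : ∀ σ : Fin 2 → MP, (∀ i, lin a b - MvPolynomial.C c ∣ MvPolynomial.X i - σ i) →
      lin a b - MvPolynomial.C c ∣ N - MvPolynomial.bind₁ σ N := by
    intro σ hσ
    set I : Ideal MP := Ideal.span {lin a b - MvPolynomial.C c}
    have h1 : (Ideal.Quotient.mkₐ ℂ I) = (Ideal.Quotient.mkₐ ℂ I).comp (MvPolynomial.bind₁ σ) := by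
      apply MvPolynomial.algHom_ext
      intro i
      simp only [AlgHom.comp_apply, MvPolynomial.bind₁_X_right]
      rw [Ideal.Quotient.mkₐ_eq_mk, Ideal.Quotient.eq]
      exact Ideal.mem_span_singleton.2 (hσ i)
    have h2 := DFunLike.congr_fun h1 N
    rw [AlgHom.comp_apply, Ideal.Quotient.mkₐ_eq_mk, Ideal.Quotient.eq] at h2
    exact Ideal.mem_span_singleton.1 h2
  have fin : ∀ σ : Fin 2 → MP, (∀ i, lin a b - MvPolynomial.C c ∣ MvPolynomial.X i - σ i) →
      (∀ v, a * MvPolynomial.eval v (σ 0) + b * MvPolynomial.eval v (σ 1) = c) →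
      lin a b - MvPolynomial.C c ∣ N := by
    intro σ hσ hv
    have h0 : MvPolynomial.bind₁ σ N = 0 := by
      apply MvPolynomial.funext
      intro v
      rw [map_zero, ← MvPolynomial.coe_aeval_eq_eval, RingHom.coe_coe,
        MvPolynomial.aeval_bind₁]
      have := h _ _ (hv v)
      rw [← MvPolynomial.coe_aeval_eq_eval, RingHom.coe_coe] at this
      rw [← this]
      congr 2
      ext i; fin_cases i <;> simp
    have := gen σ hσ
    rwa [h0, sub_zero] at this
  by_cases ha : a = 0
  · have hb : b ≠ 0 := by tauto
    refine fin ![MvPolynomial.X 0, MvPolynomial.C (c / b)] ?_ ?_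
    · intro i; fin_cases i
      · simp
      · refine ⟨MvPolynomial.C b⁻¹, ?_⟩
        have e : (MvPolynomial.C b * MvPolynomial.C b⁻¹ : MP) = 1 := by
          rw [← MvPolynomial.C_mul, mul_inv_cancel₀ hb, MvPolynomial.C_1]
        simp only [lin, ha, Matrix.cons_val_one, Matrix.cons_val_zero, div_eq_mul_inv, map_mul, map_zero, Fin.mk_one]
        linear_combination (-MvPolynomial.X 1) * e
    · intro v; simp [ha]; field_simp
  · refine fin ![MvPolynomial.C (c / a) - MvPolynomial.C (b / a) * MvPolynomial.X 1, MvPolynomial.X 1] ?_ ?_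
    · intro i; fin_cases i
      · refine ⟨MvPolynomial.C a⁻¹, ?_⟩
        have e : (MvPolynomial.C a * MvPolynomial.C a⁻¹ : MP) = 1 := by
          rw [← MvPolynomial.C_mul, mul_inv_cancel₀ ha, MvPolynomial.C_1]
        simp only [lin, Matrix.cons_val_zero, div_eq_mul_inv, map_mul, Fin.zero_eta]
        linear_combination (-MvPolynomial.X 0) * e
      · simp
    · intro v; simp; field_simp; ring

lemma line_prime (a b c : ℂ) (hab : a ≠ 0 ∨ b ≠ 0) : Prime (lin a b - MvPolynomial.C c) := by
  obtain ⟨p0, q0, h0⟩ : ∃ p q, a * p + b * q = c := by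
    rcases hab with h | h
    · exact ⟨c / a, 0, by field_simp; ring⟩
    · exact ⟨0, c / b, by field_simp; ring⟩
  refine ⟨?_, ?_, ?_⟩
  · intro h
    have h1 := congrArg (MvPolynomial.eval ![1, 0]) h
    have h2 := congrArg (MvPolynomial.eval ![0, 1]) h
    have h3 := congrArg (MvPolynomial.eval ![0, 0]) h
    simp [eval_lin] at h1 h2 h3
    subst h3
    simp at h1 h2
    tauto
  · intro h
    have := h.map (MvPolynomial.eval ![p0, q0])
    simp [eval_lin, h0] at this
  · intro f g hfg
    -- parametrize the line
    let φ : MP →ₐ[ℂ] Polynomial ℂ := MvPolynomial.aeval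
      ![Polynomial.C p0 + Polynomial.C b * Polynomial.X, Polynomial.C q0 - Polynomial.C a * Polynomial.X]
    have hφ : ∀ (u : ℂ) (f : MP), Polynomial.eval u (φ f) =
        MvPolynomial.eval ![p0 + b * u, q0 - a * u] f := by
      intro u f
      have : (Polynomial.aeval u).comp φ = MvPolynomial.aeval ![p0 + b * u, q0 - a * u] := by
        apply MvPolynomial.algHom_ext
        intro i; fin_cases i <;> simp [φ]
      have := DFunLike.congr_fun this f
      simpa [MvPolynomial.coe_aeval_eq_eval, Polynomial.coe_aeval_eq_eval] using this
    have h1 : φ (lin a b - MvPolynomial.C c) = 0 := by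
      apply Polynomial.funext
      intro u
      rw [hφ]; simp [eval_lin]; linear_combination h0
    have h2 : φ f * φ g = 0 := by
      obtain ⟨k, hk⟩ := hfg
      rw [← map_mul, hk, map_mul, h1, zero_mul]
    have h3 : ∀ f : MP, φ f = 0 → lin a b - MvPolynomial.C c ∣ f := by
      intro f hf
      apply line_dvd a b c hab
      intro p q hpq
      obtain ⟨u, hu1, hu2⟩ : ∃ u, p = p0 + b * u ∧ q = q0 - a * u := by
        rcases hab with h | h
        · refine ⟨(q0 - q) / a, ?_, by field_simp; ring⟩
          field_simp
          linear_combination hpq - h0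
        · refine ⟨(p - p0) / b, by field_simp; ring, ?_⟩
          field_simp
          linear_combination hpq - h0
      rw [hu1, hu2, ← hφ, hf]; simp
    rcases mul_eq_zero.1 h2 with h | h
    · exact Or.inl (h3 f h)
    · exact Or.inr (h3 g h)

lemma line_not_dvd (a b c a' b' c' : ℂ) (h : a * b' - a' * b ≠ 0) :
    ¬ lin a b - MvPolynomial.C c ∣ lin a' b' - MvPolynomial.C c' := by
  rintro ⟨k, hk⟩
  have h1 := congrArg (MvPolynomial.eval
    ![(c * b' - b * (c' + 1)) / (a * b' - a' * b), (a * (c' + 1) - a' * c) / (a * b' - a' * b)]) hk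
  have e1 : a * ((c * b' - b * (c' + 1)) / (a * b' - a' * b)) +
    b * ((a * (c' + 1) - a' * c) / (a * b' - a' * b)) = c := by
    rw [mul_div_assoc', mul_div_assoc', ← add_div, div_eq_iff h]; ring
  have e2 : a' * ((c * b' - b * (c' + 1)) / (a * b' - a' * b)) +
    b' * ((a * (c' + 1) - a' * c) / (a * b' - a' * b)) = c' + 1 := by
    rw [mul_div_assoc', mul_div_assoc', ← add_div, div_eq_iff h]; ring
  simp [eval_lin, e1, e2] at h1

lemma line_not_dvd' (a b c c' : ℂ) (hab : a ≠ 0 ∨ b ≠ 0) (h : c ≠ c') :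
    ¬ lin a b - MvPolynomial.C c ∣ lin a b - MvPolynomial.C c' := by
  obtain ⟨p0, q0, h0⟩ : ∃ p q, a * p + b * q = c := by
    rcases hab with h | h
    · exact ⟨c / a, 0, by field_simp; ring⟩
    · exact ⟨0, c / b, by field_simp; ring⟩
  rintro ⟨k, hk⟩
  have h1 := congrArg (MvPolynomial.eval ![p0, q0]) hk
  simp [eval_lin, h0] at h1
  exact h (sub_eq_zero.1 h1)
end

noncomputable section
open Complex

/-! ### One-variable uniqueness -/

/-- one-variable quasi-invariance of `r(t) exp(c t)` -/
def QI1 (S : ℕ → Prop) (c : ℂ) (r : Polynomial ℂ) : Prop :=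
  ∀ s : ℕ, S s → r.eval (s : ℂ) * exp (s * c) = r.eval (-(s : ℂ)) * exp (-(s * c))

lemma coeff_shift_top (r : Polynomial ℂ) (d : ℕ) (h : r.natDegree ≤ d) (s : ℂ) :
    (r.comp (Polynomial.X + Polynomial.C s)).coeff d = r.coeff d := by
  rw [Polynomial.comp, Polynomial.eval₂_eq_sum_range' _ (Nat.lt_succ_of_le h), Polynomial.finsetSum_coeff,
    Finset.sum_range_succ, Finset.sum_eq_zero]
  · simp [Polynomial.coeff_X_add_C_pow]
  · intro i hi
    rw [Finset.mem_range] at hi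
    rw [Polynomial.coeff_C_mul, Polynomial.coeff_X_add_C_pow, Nat.choose_eq_zero_of_lt hi]
    simp

lemma coeff_shift_sub (r : Polynomial ℂ) (d : ℕ) (h : r.natDegree ≤ d + 1) (s : ℂ) :
    (r.comp (Polynomial.X + Polynomial.C s)).coeff d = r.coeff d + s * (d + 1) * r.coeff (d + 1) := by
  rw [Polynomial.comp, Polynomial.eval₂_eq_sum_range' _ (Nat.lt_succ_of_le h), Polynomial.finsetSum_coeff,
    Finset.sum_range_succ, Finset.sum_range_succ, Finset.sum_eq_zero]
  · simp [Polynomial.coeff_X_add_C_pow]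
    ring
  · intro i hi
    rw [Finset.mem_range] at hi
    rw [Polynomial.coeff_C_mul, Polynomial.coeff_X_add_C_pow, Nat.choose_eq_zero_of_lt hi]
    simp

/-- the numerator of the one-variable operator -/
def opN (m : ℕ) (c : ℂ) (r : Polynomial ℂ) : Polynomial ℂ :=
  Polynomial.C (exp c) * (Polynomial.X * r.comp (Polynomial.X + Polynomial.C 1)
      - Polynomial.C (m : ℂ) * r.comp (Polynomial.X + Polynomial.C 1))
  + Polynomial.C (exp (-c)) * (Polynomial.X * r.comp (Polynomial.X + Polynomial.C (-1))
      + Polynomial.C (m : ℂ) * r.comp (Polynomial.X + Polynomial.C (-1)))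
  - Polynomial.C (exp c + exp (-c)) * (Polynomial.X * r)

lemma opN_eval (m : ℕ) (c : ℂ) (r : Polynomial ℂ) (t : ℂ) :
    (opN m c r).eval t = exp c * ((t - m) * r.eval (t + 1)) + exp (-c) * ((t + m) * r.eval (t - 1))
      - (exp c + exp (-c)) * (t * r.eval t) := by
  simp [opN]
  rw [← sub_eq_add_neg]; ring

lemma opN_coeff (m : ℕ) (c : ℂ) (r : Polynomial ℂ) (d : ℕ) (h : r.natDegree ≤ d + 1) :
    (opN m c r).coeff (d + 1) = (d + 1 - m) * r.coeff (d + 1) * (exp c - exp (-c)) := by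
  simp only [opN, Polynomial.coeff_sub, Polynomial.coeff_add, Polynomial.coeff_C_mul, Polynomial.coeff_X_mul,
    coeff_shift_top r (d + 1) h, coeff_shift_sub r d h]
  ring

lemma opN_dvd (m : ℕ) (hm : 1 ≤ m) (c : ℂ) (r : Polynomial ℂ) (h : QI1 (fun s => 1 ≤ s ∧ s ≤ m) c r) :
    ∃ r', opN m c r = Polynomial.X * r' ∧ QI1 (fun s => 1 ≤ s ∧ s ≤ m) c r' := by
  have h0 : (opN m c r).eval 0 = 0 := by
    have := h 1 ⟨le_refl _, hm⟩
    rw [opN_eval]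
    simp at this ⊢
    linear_combination (-m : ℂ) * this
  have : Polynomial.X ∣ opN m c r := by
    rw [Polynomial.X_dvd_iff, Polynomial.coeff_zero_eq_eval_zero, h0]
  obtain ⟨r', hr'⟩ := this
  refine ⟨r', hr', ?_⟩
  intro s hs
  have hs0 : (s : ℂ) ≠ 0 := by
    have : s ≠ 0 := by omega
    exact_mod_cast this
  have e1 := opN_eval m c r s
  have e2 := opN_eval m c r (-s)
  rw [hr'] at e1 e2
  simp only [Polynomial.eval_mul, Polynomial.eval_X] at e1 e2
  have k1 : r.eval (s : ℂ) * exp (s * c) = r.eval (-(s : ℂ)) * exp (-(s * c)) := h s hs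
  have k2 : ((s : ℂ) - m) * (r.eval ((s : ℂ) + 1) * exp ((s + 1) * c)
      - r.eval (-(s : ℂ) - 1) * exp (-((s + 1) * c))) = 0 := by
    by_cases hsm : s = m
    · simp [hsm]
    · have := h (s + 1) ⟨by omega, by omega⟩
      push_cast at this
      rw [this, show -((s : ℂ) + 1) = -(s : ℂ) - 1 by ring]; ring
  have k3 : r.eval ((s : ℂ) - 1) * exp ((s - 1) * c) = r.eval (-(s : ℂ) + 1) * exp (-((s - 1) * c)) := by
    by_cases hs1 : s = 1
    · subst hs1; simp
    · have := h (s - 1) ⟨by omega, by omega⟩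
      rw [Nat.cast_sub hs.1] at this
      push_cast at this
      rw [this, show -((s : ℂ) - 1) = -(s : ℂ) + 1 by ring]
  have x1 : exp ((s + 1) * c) = exp c * exp (s * c) := by rw [← exp_add]; ring_nf
  have x2 : exp (-((s + 1) * c)) = exp (-c) * exp (-(s * c)) := by rw [← exp_add]; ring_nf
  have x3 : exp ((s - 1) * c) = exp (-c) * exp (s * c) := by rw [← exp_add]; ring_nf
  have x4 : exp (-((s - 1) * c)) = exp c * exp (-(s * c)) := by rw [← exp_add]; ring_nf
  rw [x1, x2] at k2
  rw [x3, x4] at k3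
  apply mul_left_cancel₀ hs0
  linear_combination exp (s * c) * e1 + exp (-(s * c)) * e2 + k2 + (s + m) * k3
    - (exp c + exp (-c)) * s * k1

lemma opN_natDegree (m : ℕ) (c : ℂ) (r r' : Polynomial ℂ) (d : ℕ) (h : r.natDegree ≤ d + 1)
    (hr : opN m c r = Polynomial.X * r') : r'.natDegree ≤ d := by
  rw [Polynomial.natDegree_le_iff_coeff_eq_zero]
  intro N hN
  have := opN_coeff m c r N (by omega)
  rw [hr, Polynomial.coeff_X_mul, Polynomial.coeff_eq_zero_of_natDegree_lt (show r.natDegree < N + 1 by omega)] at this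
  simpa using this

lemma uniq1D (m : ℕ) (c : ℂ) (hc : sinh c ≠ 0) :
    ∀ d : ℕ, d < m → ∀ r : Polynomial ℂ, r.natDegree ≤ d → QI1 (fun s => 1 ≤ s ∧ s ≤ m) c r → r = 0 := by
  have hc' : exp c - exp (-c) ≠ 0 := by
    intro h; apply hc; rw [Complex.sinh, h, zero_div]
  intro d
  induction d with
  | zero =>
    intro hd r hr h
    have h1 := h 1 ⟨le_refl _, hd⟩
    rw [Polynomial.eq_C_of_natDegree_le_zero hr] at h1 ⊢
    simp at h1
    have : r.coeff 0 * (exp c - exp (-c)) = 0 := by rw [mul_sub, sub_eq_zero]; simpa using h1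
    rcases mul_eq_zero.1 this with h2 | h2
    · rw [h2]; simp
    · exact absurd h2 hc'
  | succ d ih =>
    intro hd r hr h
    obtain ⟨r', h1, h2⟩ := opN_dvd m (by omega) c r h
    have h3 := ih (by omega) r' (opN_natDegree m c r r' d hr h1) h2
    have h4 := opN_coeff m c r d hr
    rw [h1, h3] at h4
    simp at h4
    have h5 : r.coeff (d + 1) = 0 := by
      rcases h4 with (h4 | h4) | h4
      · exfalso
        have : ((d + 1 : ℕ) : ℂ) = m := by push_cast; linear_combination h4
        have := Nat.cast_injective this
        omega
      · exact h4
      · exact absurd h4 hc'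
    refine ih (by omega) r ?_ h
    rw [Polynomial.natDegree_le_iff_coeff_eq_zero]
    intro N hN
    by_cases hN' : N = d + 1
    · rw [hN', h5]
    · exact Polynomial.coeff_eq_zero_of_natDegree_lt (by omega)

lemma uniq1Dtwo (n : ℕ) (hn : 1 ≤ n) (c : ℂ) (hc : sinh (2 * c) ≠ 0) (r : Polynomial ℂ)
    (hr : r.natDegree ≤ n) (h : QI1 (fun s => (1 ≤ s ∧ s ≤ n) ∨ s = n + 2) c r) : r = 0 := by
  rw [Complex.sinh_two_mul] at hc
  have hs : sinh c ≠ 0 := fun h => hc (by rw [h]; ring)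
  have hch : cosh c ≠ 0 := fun h => hc (by rw [h]; ring)
  have hch' : exp c + exp (-c) ≠ 0 := by
    intro h; apply hch; rw [Complex.cosh, h, zero_div]
  have hq : QI1 (fun s => 1 ≤ s ∧ s ≤ n) c r := fun s hs => h s (Or.inl hs)
  obtain ⟨d, rfl⟩ : ∃ d, n = d + 1 := ⟨n - 1, by omega⟩
  obtain ⟨r', h1, h2⟩ := opN_dvd (d + 1) hn c r hq
  have h3 := uniq1D (d + 1) c hs d (by omega) r' (opN_natDegree _ c r r' d hr h1) h2
  have e1 := opN_eval (d + 1) c r ((d + 2 : ℕ) : ℂ)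
  have e2 := opN_eval (d + 1) c r (-((d + 2 : ℕ) : ℂ))
  rw [h1, h3] at e1 e2
  have k1 := h (d + 3) (Or.inr rfl)
  have k2 := h (d + 1) (Or.inl ⟨by omega, le_refl _⟩)
  refine uniq1D (d + 2) c hs (d + 1) (by omega) r hr ?_
  rintro s ⟨hs1, hs2⟩
  rcases Nat.lt_or_ge s (d + 2) with hlt | hge
  · exact hq s ⟨hs1, by omega⟩
  obtain rfl : s = d + 2 := by omega
  have x1 : exp ((d + 3 : ℕ) * c) = exp c * exp ((d + 2 : ℕ) * c) := by
    rw [← exp_add]; push_cast; ring_nf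
  have x2 : exp (-((d + 3 : ℕ) * c)) = exp (-c) * exp (-((d + 2 : ℕ) * c)) := by
    rw [← exp_add]; push_cast; ring_nf
  have x3 : exp ((d + 1 : ℕ) * c) = exp (-c) * exp ((d + 2 : ℕ) * c) := by
    rw [← exp_add]; push_cast; ring_nf
  have x4 : exp (-((d + 1 : ℕ) * c)) = exp c * exp (-((d + 2 : ℕ) * c)) := by
    rw [← exp_add]; push_cast; ring_nf
  rw [x1, x2] at k1
  rw [x3, x4] at k2
  have hd2 : ((d : ℂ) + 2) ≠ 0 := by exact_mod_cast (show d + 2 ≠ 0 by omega)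
  apply mul_left_cancel₀ (mul_ne_zero hd2 hch')
  have y1 : ((d + 2 : ℕ) : ℂ) + 1 = ((d + 3 : ℕ) : ℂ) := by push_cast; ring
  have y2 : ((d + 2 : ℕ) : ℂ) - 1 = ((d + 1 : ℕ) : ℂ) := by push_cast; ring
  have y3 : -((d + 2 : ℕ) : ℂ) + 1 = -((d + 1 : ℕ) : ℂ) := by push_cast; ring
  have y4 : -((d + 2 : ℕ) : ℂ) - 1 = -((d + 3 : ℕ) : ℂ) := by push_cast; ring
  rw [y1, y2] at e1
  rw [y3, y4] at e2
  simp only [mul_zero, Polynomial.eval_zero] at e1 e2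
  generalize exp ((d + 2 : ℕ) * c) = E1 at *
  generalize exp (-((d + 2 : ℕ) * c)) = E2 at *
  generalize Polynomial.eval ((d + 2 : ℕ) : ℂ) r = R1 at *
  generalize Polynomial.eval (-((d + 2 : ℕ) : ℂ)) r = R2 at *
  push_cast at *
  linear_combination E1 * e1 + E2 * e2 + k1 + (2 * d + 3) * k2
end

noncomputable section
open Complex

/-! ### Two-variable uniqueness -/

/-- view a two-variable polynomial as a polynomial in the second variable -/
def toPP : MP →ₐ[ℂ] Polynomial (Polynomial ℂ) :=
  MvPolynomial.aeval ![Polynomial.C Polynomial.X, Polynomial.X]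

lemma toPP_coeff (R : MP) (e k : ℕ) :
    ((toPP R).coeff e).coeff k = MvPolynomial.coeff (Finsupp.single 0 k + Finsupp.single 1 e) R := by
  induction R using MvPolynomial.induction_on' with
  | monomial s a =>
    have e1 : toPP (MvPolynomial.monomial s a) =
        Polynomial.C (Polynomial.C a * Polynomial.X ^ s 0) * Polynomial.X ^ s 1 := by
      rw [toPP, MvPolynomial.aeval_monomial, Finsupp.prod_fintype _ _ (by simp)]
      simp [mul_assoc]
    rw [e1, Polynomial.coeff_C_mul_X_pow, MvPolynomial.coeff_monomial]
    by_cases h1 : e = s 1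
    · by_cases h2 : k = s 0
      · have : s = Finsupp.single 0 k + Finsupp.single 1 e := by
          ext i; fin_cases i <;> simp [h1, h2]
        rw [if_pos h1, if_pos this, Polynomial.coeff_C_mul_X_pow, if_pos h2]
      · have : s ≠ Finsupp.single 0 k + Finsupp.single 1 e := by
          intro h; apply h2; rw [h]; simp
        rw [if_pos h1, if_neg this, Polynomial.coeff_C_mul_X_pow, if_neg h2]
    · have : s ≠ Finsupp.single 0 k + Finsupp.single 1 e := by
        intro h; apply h1; rw [h]; simp
      rw [if_neg h1, if_neg this]; simp
  | add p q hp hq => simp [hp, hq]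

lemma toPP_eval (R : MP) (t w : ℂ) :
    ((toPP R).map (Polynomial.evalRingHom t)).eval w = MvPolynomial.eval ![t, w] R := by
  induction R using MvPolynomial.induction_on with
  | C a => simp [toPP, Polynomial.algebraMap_apply]
  | add p q hp hq => simp [hp, hq]
  | mul_X p i hp =>
    rw [map_mul, Polynomial.map_mul, Polynomial.eval_mul, hp, map_mul]
    congr 1
    fin_cases i <;> simp [toPP]

lemma hom_bind (L : Fin 2 → MP) (hL : ∀ i, (L i).IsHomogeneous 1) (R : MP) (d : ℕ) :
    MvPolynomial.homogeneousComponent d (MvPolynomial.bind₁ L R) =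
      MvPolynomial.bind₁ L (MvPolynomial.homogeneousComponent d R) := by
  have hh : ∀ i, (MvPolynomial.bind₁ L (MvPolynomial.homogeneousComponent i R)).IsHomogeneous i := by
    intro i
    have := (MvPolynomial.homogeneousComponent_isHomogeneous i R).aeval L hL
    rw [one_mul] at this; exact this
  conv_lhs => rw [← MvPolynomial.sum_homogeneousComponent R]
  rw [map_sum, map_sum]
  have : ∀ i ∈ Finset.range (R.totalDegree + 1),
      MvPolynomial.homogeneousComponent d (MvPolynomial.bind₁ L (MvPolynomial.homogeneousComponent i R)) =
        if i = d then MvPolynomial.bind₁ L (MvPolynomial.homogeneousComponent d R) else 0 := by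
    intro i _
    rw [MvPolynomial.homogeneousComponent_of_mem (hh i)]
    split_ifs with h1 h2 h2
    · rw [h2]
    · exact absurd h1.symm h2
    · exact absurd h2.symm h1
    · rfl
  rw [Finset.sum_congr rfl this, Finset.sum_ite_eq']
  split_ifs with h
  · rfl
  · rw [Finset.mem_range, not_lt] at h
    rw [MvPolynomial.homogeneousComponent_eq_zero _ _ (by omega), map_zero]

lemma lin_hom (a b : ℂ) : (lin a b).IsHomogeneous 1 := by
  unfold lin
  refine MvPolynomial.IsHomogeneous.add ?_ ?_
  · simpa using (MvPolynomial.isHomogeneous_C (Fin 2) a).mul (MvPolynomial.isHomogeneous_X ℂ 0)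
  · simpa using (MvPolynomial.isHomogeneous_C (Fin 2) b).mul (MvPolynomial.isHomogeneous_X ℂ 1)

lemma eval_bind_lin (a b a' b' : ℂ) (R : MP) (v : Fin 2 → ℂ) :
    MvPolynomial.eval v (MvPolynomial.bind₁ ![lin a b, lin a' b'] R) =
      MvPolynomial.eval ![a * v 0 + b * v 1, a' * v 0 + b' * v 1] R := by
  rw [← MvPolynomial.coe_aeval_eq_eval, RingHom.coe_coe,
    MvPolynomial.aeval_bind₁, ← MvPolynomial.coe_aeval_eq_eval, RingHom.coe_coe]
  congr 2
  ext i; fin_cases i <;> simp [lin]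

lemma Lt.bind {R : MP} {d : ℕ} (hR : Lt R (d + 1)) (L : Fin 2 → MP) (hL : ∀ i, (L i).IsHomogeneous 1) :
    Lt (MvPolynomial.bind₁ L R) (d + 1) := by
  intro e he
  by_contra hlt
  have h1 : MvPolynomial.coeff e (MvPolynomial.homogeneousComponent e.degree (MvPolynomial.bind₁ L R)) ≠ 0 := by
    rw [MvPolynomial.coeff_homogeneousComponent, if_pos rfl]; exact he
  rw [hom_bind L hL] at h1
  have : MvPolynomial.homogeneousComponent e.degree R = 0 := by
    ext f
    rw [MvPolynomial.coeff_homogeneousComponent]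
    split_ifs with h
    · by_contra hne
      have := hR f hne
      omega
    · simp
  rw [this] at h1
  simp at h1

lemma dir_dvd (R : MP) (d K : ℕ) (hK : 1 ≤ K) (hR : Lt R (d + 1)) (x1 x2 a b a' b' e f e' f' : ℂ)
    (i1 : a * e + b * e' = 1) (i2 : a * f + b * f' = 0) (i3 : a' * e + b' * e' = 0)
    (i4 : a' * f + b' * f' = 1) (S : ℕ → Prop) (c : ℂ) (hc : c = x1 * a + x2 * a')
    (h1 : ∀ r : Polynomial ℂ, r.natDegree < K → QI1 S c r → r = 0)
    (hq : ∀ s : ℕ, S s → ∀ w : ℂ,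
      MvPolynomial.eval ![a * s + b * w, a' * s + b' * w] R *
        exp (x1 * (a * s + b * w) + x2 * (a' * s + b' * w)) =
      MvPolynomial.eval ![-a * s + b * w, -a' * s + b' * w] R *
        exp (x1 * (-a * s + b * w) + x2 * (-a' * s + b' * w))) :
    lin e f ^ K ∣ MvPolynomial.homogeneousComponent d R := by
  have hL : ∀ i, ((![lin a b, lin a' b'] : Fin 2 → MP) i).IsHomogeneous 1 := by
    intro i; fin_cases i
    · exact lin_hom a b
    · exact lin_hom a' b'
  set R' := MvPolynomial.bind₁ ![lin a b, lin a' b'] R with hR'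
  have hLt : Lt R' (d + 1) := hR.bind _ hL
  have hq' : ∀ s : ℕ, S s → ∀ w : ℂ, MvPolynomial.eval ![(s : ℂ), w] R' * exp (s * c) =
      MvPolynomial.eval ![-(s : ℂ), w] R' * exp (-(s * c)) := by
    intro s hs w
    have := hq s hs w
    rw [hR', eval_bind_lin, eval_bind_lin]
    simp only [Matrix.cons_val_zero, Matrix.cons_val_one]
    have y1 : exp (x1 * (a * s + b * w) + x2 * (a' * s + b' * w)) =
      exp (s * c) * exp (x1 * (b * w) + x2 * (b' * w)) := by
      rw [← exp_add, hc]; ring_nf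
    have y2 : exp (x1 * (-a * s + b * w) + x2 * (-a' * s + b' * w)) =
      exp (-(s * c)) * exp (x1 * (b * w) + x2 * (b' * w)) := by
      rw [← exp_add, hc]; ring_nf
    rw [y1, y2] at this
    refine mul_right_cancel₀ (exp_ne_zero (x1 * (b * w) + x2 * (b' * w))) ?_
    rw [mul_assoc, mul_assoc, this]
    simp
  have hz : ∀ k l : ℕ, d < l + K → MvPolynomial.coeff (Finsupp.single 0 k + Finsupp.single 1 l) R' = 0 := by
    intro k l hl
    have : (toPP R').coeff l = 0 := by
      apply h1
      · rw [Nat.lt_iff_le_pred hK, Polynomial.natDegree_le_iff_coeff_eq_zero]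
        intro N hN
        rw [toPP_coeff]
        by_contra hne
        have := hLt _ hne
        simp at this
        omega
      · intro s hs
        have e1 : (toPP R').map (Polynomial.evalRingHom (s : ℂ)) * Polynomial.C (exp (s * c)) =
            (toPP R').map (Polynomial.evalRingHom (-(s : ℂ))) * Polynomial.C (exp (-(s * c))) := by
          apply Polynomial.funext
          intro w
          rw [Polynomial.eval_mul, Polynomial.eval_mul, toPP_eval, toPP_eval, Polynomial.eval_C,
            Polynomial.eval_C]
          exact hq' s hs w
        have := congrArg (fun p => Polynomial.coeff p l) e1
        simpa [Polynomial.coeff_mul_C, Polynomial.coeff_map] using this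
    rw [← toPP_coeff, this, Polynomial.coeff_zero]
  have hX : (MvPolynomial.X 0 ^ K : MP) ∣ MvPolynomial.homogeneousComponent d R' := by
    rw [MvPolynomial.X_pow_eq_monomial, MvPolynomial.monomial_one_dvd_iff_modMonomial_eq_zero]
    ext v
    by_cases hv : Finsupp.single 0 K ≤ v
    · rw [MvPolynomial.coeff_modMonomial_of_le _ hv]; simp
    · rw [MvPolynomial.coeff_modMonomial_of_not_le _ hv, MvPolynomial.coeff_homogeneousComponent]
      split_ifs with hd
      · have hvK : v 0 < K := by
          by_contra h
          apply hv
          rw [Finsupp.single_le_iff]; omega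
        have hve : v = Finsupp.single 0 (v 0) + Finsupp.single 1 (v 1) := by
          ext i; fin_cases i <;> simp
        have hdeg : v 0 + v 1 = d := by
          rw [← hd]; simp [Finsupp.degree_eq_sum]
        rw [hve, hz _ _ (by omega)]; simp
      · simp
  have h5 := map_dvd (MvPolynomial.bind₁ ![lin e f, lin e' f']) hX
  rw [hR', hom_bind _ hL, MvPolynomial.bind₁_bind₁] at h5
  have h6 : (fun i => MvPolynomial.bind₁ ![lin e f, lin e' f'] ((![lin a b, lin a' b'] : Fin 2 → MP) i)) =
      MvPolynomial.X := by
    funext i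
    have j1 := congrArg (MvPolynomial.C (σ := Fin 2)) i1
    have j2 := congrArg (MvPolynomial.C (σ := Fin 2)) i2
    have j3 := congrArg (MvPolynomial.C (σ := Fin 2)) i3
    have j4 := congrArg (MvPolynomial.C (σ := Fin 2)) i4
    simp only [map_add, map_mul, map_one, map_zero] at j1 j2 j3 j4
    fin_cases i
    · simp [lin]
      linear_combination MvPolynomial.X 0 * j1 + MvPolynomial.X 1 * j2
    · simp [lin]
      linear_combination MvPolynomial.X 0 * j3 + MvPolynomial.X 1 * j4
  rw [h6] at h5
  simpa using h5

/-- the coefficients of the six linear forms -/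
def la : Fin 6 → ℂ := ![1, 1, 0, -1/3, 1/3, 2/3]
def lb : Fin 6 → ℂ := ![0, -1, -1, 2/3, 1/3, -1/3]

lemma la_det (i j : Fin 6) (h : i ≠ j) : la i * lb j - la j * lb i ≠ 0 := by
  fin_cases i <;> fin_cases j <;> first | exact absurd rfl h | (simp [la, lb]; try norm_num)

lemma la_ne (i : Fin 6) : la i ≠ 0 ∨ lb i ≠ 0 := by
  fin_cases i <;> simp [la, lb]

lemma lin_prime (i : Fin 6) : Prime (lin (la i) (lb i)) := by
  simpa using line_prime (la i) (lb i) 0 (la_ne i)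

lemma lin_totalDegree (i : Fin 6) : (lin (la i) (lb i)).totalDegree = 1 :=
  (lin_hom _ _).totalDegree (lin_prime i).ne_zero

lemma hom_zero (R : MP) (d : ℕ) (K : Fin 6 → ℕ) (hK : d < ∑ i, K i)
    (h : ∀ i, lin (la i) (lb i) ^ K i ∣ MvPolynomial.homogeneousComponent d R) :
    MvPolynomial.homogeneousComponent d R = 0 := by
  have h1 : ∏ i, lin (la i) (lb i) ^ K i ∣ MvPolynomial.homogeneousComponent d R := by
    apply Finset.prod_dvd_of_isRelPrime
    · intro i _ j _ hij
      apply IsRelPrime.pow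
      rw [(lin_prime i).irreducible.isRelPrime_iff_not_dvd]
      simpa using line_not_dvd (la i) (lb i) 0 (la j) (lb j) 0 (la_det i j hij)
    · intro i _; exact h i
  by_contra hne
  obtain ⟨Q, hQ⟩ := h1
  have hp : ∏ i, lin (la i) (lb i) ^ K i ≠ 0 :=
    Finset.prod_ne_zero_iff.2 (fun i _ => pow_ne_zero _ (lin_prime i).ne_zero)
  have hhom : (∏ i, lin (la i) (lb i) ^ K i).IsHomogeneous (∑ i, K i) := by
    apply MvPolynomial.IsHomogeneous.prod
    intro i _
    simpa using (lin_hom (la i) (lb i)).pow (K i)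
  have hQ0 : Q ≠ 0 := by rintro rfl; simp at hQ; exact hne hQ
  have h2 := (MvPolynomial.homogeneousComponent_isHomogeneous d R).totalDegree hne
  rw [hQ, MvPolynomial.totalDegree_mul_of_isDomain hp hQ0, hhom.totalDegree hp] at h2
  omega

/-! quasi-invariance in the coordinates `p = ⟨β₁,z⟩`, `q = ⟨β₂,z⟩` -/

def SB (m : ℕ) (s : ℕ) : Prop := (1 ≤ s ∧ s ≤ 3 * m) ∨ s = 3 * m + 2
def SA (m : ℕ) (s : ℕ) : Prop := 1 ≤ s ∧ s ≤ m

def QB (m : ℕ) (Φ : ℂ → ℂ → ℂ) : Prop :=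
  ∀ s : ℕ, SB m s → ∀ y : ℂ, Φ s (y + s / 2) = Φ (-s) (y - s / 2)
def QA (m : ℕ) (Φ : ℂ → ℂ → ℂ) : Prop :=
  ∀ s : ℕ, SA m s → ∀ y : ℂ, Φ y (y / 2 + 3 * s / 2) = Φ y (y / 2 - 3 * s / 2)

/-- composition with the rotation by 60 degrees -/
def Rot (Φ : ℂ → ℂ → ℂ) : ℂ → ℂ → ℂ := fun p q => Φ q (q - p)

def QQ (m : ℕ) (Φ : ℂ → ℂ → ℂ) : Prop := ∀ k : ℕ, QB m (Rot^[k] Φ) ∧ QA m (Rot^[k] Φ)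

/-- polynomial times exponential -/
def pexp (R : MP) (x1 x2 : ℂ) : ℂ → ℂ → ℂ :=
  fun p q => MvPolynomial.eval ![p, q] R * exp (x1 * p + x2 * q)

lemma uniq2D (m : ℕ) (hm : 1 ≤ m) (x1 x2 : ℂ)
    (hB : ∀ c ∈ [x1 + x2 / 2, (x1 - x2) / 2, -x1 / 2 - x2], sinh (2 * c) ≠ 0)
    (hA : ∀ c ∈ [3 * x2 / 2, 3 * (x1 + x2) / 2, 3 * x1 / 2], sinh c ≠ 0)
    (R : MP) (hR : Lt R (12 * m + 3)) (hq : QQ m (pexp R x1 x2)) : R = 0 := by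
  have key : ∀ d, d < 12 * m + 3 → Lt R (d + 1) → Lt R d := by
    intro d hd hLt
    have hz : MvPolynomial.homogeneousComponent d R = 0 := by
      apply hom_zero R d ![3 * m + 1, 3 * m + 1, 3 * m + 1, m, m, m]
      · simp [Fin.sum_univ_six]; omega
      · have uB : ∀ c, sinh (2 * c) ≠ 0 → ∀ r : Polynomial ℂ, r.natDegree < 3 * m + 1 → QI1 (SB m) c r → r = 0 :=
          fun c hc r hr h => uniq1Dtwo (3 * m) (by omega) c hc r (by omega) h
        have uA : ∀ c, sinh c ≠ 0 → ∀ r : Polynomial ℂ, r.natDegree < m → QI1 (SA m) c r → r = 0 :=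
          fun c hc r hr h => uniq1D m c hc r.natDegree hr r le_rfl h
        intro i
        fin_cases i
        · refine dir_dvd R d _ (by simp; try omega) hLt x1 x2 1 0 (1/2) 1 1 0 (-1/2) 1 (by norm_num) (by norm_num) (by norm_num)
            (by norm_num) (SB m) (x1 + x2 / 2) (by ring) (uB _ (hB _ (by simp))) ?_
          intro s hs w
          have := (hq 0).1 s hs w
          simp only [Function.iterate_zero, id, pexp] at this
          convert this using 4 <;> ring_nf
        · refine dir_dvd R d _ (by simp; try omega) hLt x1 x2 (1/2) 1 (-1/2) 1 1 (-1) (1/2) (1/2) (by norm_num) (by norm_num) (by norm_num)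
            (by norm_num) (SB m) ((x1 - x2) / 2) (by ring) (uB _ (hB _ (by simp))) ?_
          intro s hs w
          have := (hq 1).1 s hs w
          simp only [Function.iterate_one, Rot, pexp] at this
          convert this using 4 <;> ring_nf
        · refine dir_dvd R d _ (by simp; try omega) hLt x1 x2 (-1/2) 1 (-1) 0 0 (-1) 1 (-1/2) (by norm_num) (by norm_num) (by norm_num)
            (by norm_num) (SB m) (-x1 / 2 - x2) (by ring) (uB _ (hB _ (by simp))) ?_
          intro s hs w
          have := (hq 2).1 s hs w
          simp only [Function.iterate_succ, Function.iterate_zero, Function.comp, id, Rot, pexp] at this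
          convert this using 4 <;> ring_nf
        · refine dir_dvd R d _ (by simp; try omega) hLt x1 x2 0 1 (3/2) (1/2) (-1/3) (2/3) 1 0 (by norm_num) (by norm_num) (by norm_num)
            (by norm_num) (SA m) (3 * x2 / 2) (by ring) (uA _ (hA _ (by simp))) ?_
          intro s hs w
          have := (hq 0).2 s hs w
          simp only [Function.iterate_zero, id, pexp] at this
          convert this using 4 <;> ring_nf
        · refine dir_dvd R d _ (by simp; try omega) hLt x1 x2 (3/2) (1/2) (3/2) (-1/2) (1/3) (1/3) 1 (-1) (by norm_num) (by norm_num) (by norm_num)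
            (by norm_num) (SA m) (3 * (x1 + x2) / 2) (by ring) (uA _ (hA _ (by simp))) ?_
          intro s hs w
          have := (hq 1).2 s hs w
          simp only [Function.iterate_one, Rot, pexp] at this
          convert this using 4 <;> ring_nf
        · refine dir_dvd R d _ (by simp; try omega) hLt x1 x2 (3/2) (-1/2) 0 (-1) (2/3) (-1/3) 0 (-1) (by norm_num) (by norm_num) (by norm_num)
            (by norm_num) (SA m) (3 * x1 / 2) (by ring) (uA _ (hA _ (by simp))) ?_
          intro s hs w
          have := (hq 2).2 s hs w
          simp only [Function.iterate_succ, Function.iterate_zero, Function.comp, id, Rot, pexp] at this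
          convert this using 4 <;> ring_nf
    intro e he
    have h1 := hLt e he
    rcases Nat.lt_or_ge e.degree d with h | h
    · exact h
    · exfalso
      have h2 : e.degree = d := by omega
      have := congrArg (MvPolynomial.coeff e) hz
      rw [MvPolynomial.coeff_homogeneousComponent, if_pos h2] at this
      exact he (by simpa using this)
  have all : ∀ j, j ≤ 12 * m + 3 → Lt R (12 * m + 3 - j) := by
    intro j
    induction j with
    | zero => intro _; simpa using hR
    | succ j ih =>
      intro hj
      apply key _ (by omega)
      have := ih (by omega)
      rwa [show 12 * m + 3 - (j + 1) + 1 = 12 * m + 3 - j by omega]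
  have h0 := all (12 * m + 3) le_rfl
  rw [Nat.sub_self] at h0
  ext e
  by_contra hne
  have := h0 e (by simpa using hne)
  omega
end

noncomputable section
open Complex

/-! ### One-dimensional blocks -/

def D5 (u : ℂ) : ℂ := u * (u ^ 2 - 1) * (u ^ 2 - 4)
def gb (k l u : ℂ) : ℂ := (u - k) * (u + 1 - l) * (u - 1) * (u ^ 2 - 4)
def gp (n u : ℂ) : ℂ := (u - n - 2) * (u + 2 + n) * (u - n) * (u + 1) * (u - 2)
def gc (n u : ℂ) : ℂ := (u - n - 2) * (u - n) * (u + 2 - n) * (u - 1) * (u - 2)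
def gl (m u : ℂ) : ℂ := (u - m) * (u ^ 2 - 1) * (u ^ 2 - 4)

def WA (a : ℂ → ℂ) (k l : ℂ) (f : ℂ → ℂ) (t : ℂ) : ℂ :=
  a t * gb k l t * (f (t + 2) - f t) - a (-t) * gb k l (-t) * (f (t - 2) - f t)
def WC (c : ℂ → ℂ) (n : ℂ) (f0 f1 : ℂ → ℂ) (t : ℂ) : ℂ :=
  c t * gp n t * (f1 (t + 1) - f0 t) - c (-t) * gp n (-t) * (f1 (t - 1) - f0 t)
def WD (d : ℂ → ℂ) (n : ℂ) (f0 f1 : ℂ → ℂ) (t : ℂ) : ℂ :=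
  d t * gc n t * (f1 (t + 3) - f0 t) - d (-t) * gc n (-t) * (f1 (t - 3) - f0 t)
def WL (c : ℂ → ℂ) (m : ℂ) (f0 f1 : ℂ → ℂ) (t : ℂ) : ℂ :=
  c t * gl m t * (f1 (t + 1) - f0 t) - c (-t) * gl m (-t) * (f1 (t - 1) - f0 t)
def WE (e : ℂ → ℂ) (f0 f2 : ℂ → ℂ) (t : ℂ) : ℂ := e t * D5 t * (f2 t - f0 t)

/-- symmetric data -/
def Symm' (S : ℕ → Prop) (f : ℂ → ℂ) : Prop := ∀ s : ℕ, S s → f s = f (-s)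
def Van (S : ℕ → Prop) (d : ℂ → ℂ) : Prop := (∀ t, d (-t) = - d t) ∧ ∀ s : ℕ, S s → d s = 0
def odd' (f : ℂ → ℂ) (t : ℂ) : ℂ := f t - f (-t)

lemma Symm'.van {S f} (h : Symm' S f) : Van S (odd' f) := by
  refine ⟨fun t => by simp [odd'], fun s hs => ?_⟩
  simp [odd', h s hs]

lemma Van.zero {S d} (h : Van S d) : d 0 = 0 := by
  have := h.1 0
  rw [neg_zero] at this
  linear_combination this / 2

lemma Van.neg {S d} (h : Van S d) (s : ℕ) (hs : S s) : d (-s) = 0 := by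
  rw [h.1, h.2 s hs, neg_zero]

lemma Van.deriv_eq {S d} (h : Van S d) (hd : Differentiable ℂ d) (t : ℂ) : deriv d (-t) = deriv d t := by
  have h1 : HasDerivAt (fun u => d (-u)) (-deriv d (-t)) t := by
    have := (hd (-t)).hasDerivAt.comp t (hasDerivAt_neg t)
    rw [mul_neg_one] at this
    exact this
  have h2 : HasDerivAt (fun u => d (-u)) (-deriv d t) t := by
    have : (fun u => d (-u)) = fun u => - d u := funext h.1
    rw [this]; exact (hd t).hasDerivAt.neg
  have := h1.unique h2
  exact neg_injective this

lemma odd_diff {f : ℂ → ℂ} (hf : Differentiable ℂ f) : Differentiable ℂ (odd' f) := by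
  unfold odd'; fun_prop

lemma T1 (u r b : ℂ → ℂ) (s : ℂ) (hu : DifferentiableAt ℂ u s) (hr : DifferentiableAt ℂ r s)
    (hb : DifferentiableAt ℂ b s) (h : r s = 0 ∨ b s = 0) :
    HasDerivAt (fun t => u t * ((t - s) * r t) * b t) 0 s := by
  have := (hu.hasDerivAt.mul (((hasDerivAt_id s).sub_const s).mul hr.hasDerivAt)).mul hb.hasDerivAt
  refine this.congr_deriv ?_
  rcases h with h | h <;> simp [h]

lemma T2 (u b : ℂ → ℂ) (s b' : ℂ) (hu : DifferentiableAt ℂ u s) (hb : HasDerivAt b b' s) (h : b s = 0) :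
    HasDerivAt (fun t => u t * b t) (u s * b') s := by
  have := hu.hasDerivAt.mul hb
  refine this.congr_deriv ?_
  simp [h]

lemma dneg {a : ℂ → ℂ} {s : ℂ} (h : DifferentiableAt ℂ a (-s)) : DifferentiableAt ℂ (fun t => a (-t)) s :=
  DifferentiableAt.comp s h differentiableAt_id.neg

/- identities -/
lemma WA_odd (a k l f t) : WA a k l (odd' f) t = WA a k l f t + WA a k l f (-t) := by
  simp only [WA, odd', neg_neg, neg_add, neg_sub]
  rw [show -t + 2 = 2 - t by ring, show -t - 2 = -t + -2 by ring]; ring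
lemma WC_odd (a k f g t) : WC a k (odd' f) (odd' g) t = WC a k f g t + WC a k f g (-t) := by
  simp only [WC, odd', neg_neg, neg_add, neg_sub]
  rw [show -t + 1 = 1 - t by ring, show -t - 1 = -t + -1 by ring]; ring
lemma WD_odd (a k f g t) : WD a k (odd' f) (odd' g) t = WD a k f g t + WD a k f g (-t) := by
  simp only [WD, odd', neg_neg, neg_add, neg_sub]
  rw [show -t + 3 = 3 - t by ring, show -t - 3 = -t + -3 by ring]; ring
lemma WL_odd (a k f g t) : WL a k (odd' f) (odd' g) t = WL a k f g t + WL a k f g (-t) := by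
  simp only [WL, odd', neg_neg, neg_add, neg_sub]
  rw [show -t + 1 = 1 - t by ring, show -t - 1 = -t + -1 by ring]; ring
lemma WE_odd (e f g t) (he : e (-t) = e t) : WE e (odd' f) (odd' g) t = WE e f g t + WE e f g (-t) := by
  simp only [WE, odd', he, D5]; ring

/- differentiability -/
lemma WA_diff {a f : ℂ → ℂ} {s : ℂ} (ha : DifferentiableAt ℂ a s) (ha' : DifferentiableAt ℂ a (-s))
    (hf : Differentiable ℂ f) (k l : ℂ) :
    DifferentiableAt ℂ (WA a k l f) s := by
  have := dneg ha'
  unfold WA gb; fun_prop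
lemma WC_diff {a f g : ℂ → ℂ} {s : ℂ} (ha : DifferentiableAt ℂ a s) (ha' : DifferentiableAt ℂ a (-s))
    (hf : Differentiable ℂ f) (hg : Differentiable ℂ g) (k : ℂ) :
    DifferentiableAt ℂ (WC a k f g) s := by
  have := dneg ha'
  unfold WC gp; fun_prop
lemma WD_diff {a f g : ℂ → ℂ} {s : ℂ} (ha : DifferentiableAt ℂ a s) (ha' : DifferentiableAt ℂ a (-s))
    (hf : Differentiable ℂ f) (hg : Differentiable ℂ g) (k : ℂ) :
    DifferentiableAt ℂ (WD a k f g) s := by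
  have := dneg ha'
  unfold WD gc; fun_prop
lemma WL_diff {a f g : ℂ → ℂ} {s : ℂ} (ha : DifferentiableAt ℂ a s) (ha' : DifferentiableAt ℂ a (-s))
    (hf : Differentiable ℂ f) (hg : Differentiable ℂ g) (k : ℂ) :
    DifferentiableAt ℂ (WL a k f g) s := by
  have := dneg ha'
  unfold WL gl; fun_prop
lemma WE_diff {a f g : ℂ → ℂ} {s : ℂ} (ha : DifferentiableAt ℂ a s) (hf : Differentiable ℂ f)
    (hg : Differentiable ℂ g) : DifferentiableAt ℂ (WE a f g) s := by
  unfold WE D5; fun_prop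
end

noncomputable section
open Complex

/-! zeros of the blocks -/

lemma WA_zero (S : ℕ → Prop) (a : ℂ → ℂ) (k l : ℂ) (f : ℂ → ℂ) (hf : Symm' S f) (h1 : S 1)
    (h2 : S 2 ∨ l = 1) (t0 : ℂ) (ht : t0 = 0 ∨ t0 = 1 ∨ t0 = 2) : WA a k l f t0 = 0 := by
  have e1 := hf 1 h1
  push_cast at e1
  rcases ht with rfl | rfl | rfl
  · rcases h2 with h2 | h2
    · have e2 := hf 2 h2
      push_cast at e2
      simp only [WA, neg_zero, zero_add, zero_sub, e2]; ring
    · simp only [WA, neg_zero, gb, h2]; ring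
  · simp only [WA, gb]
    rw [show (1 : ℂ) - 2 = -1 by ring, e1]; ring
  · simp only [WA, gb]; ring

lemma WCD_zero (S : ℕ → Prop) (c d : ℂ → ℂ) (n : ℂ) (f0 f1 : ℂ → ℂ) (hf : Symm' S f1) (h1 : S 1) (h2 : S 2) (h3 : S 3)
    (hcd1 : c 1 = 3 * d (-1)) (hcd2 : c (-2) = 3 * d (-2))
    (t0 : ℂ) (ht : t0 = 0 ∨ t0 = 1 ∨ t0 = 2) : WC c n f0 f1 t0 + WD d n f0 f1 t0 = 0 := by
  have e1 := hf 1 h1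
  have e2 := hf 2 h2
  have e3 := hf 3 h3
  push_cast at e1 e2 e3
  rcases ht with rfl | rfl | rfl
  · simp only [WC, WD, neg_zero, zero_add, zero_sub, e1, e3]; ring
  · simp only [WC, WD, gp, gc]
    rw [show (1 : ℂ) - 3 = -2 by ring, show (1 : ℂ) + 1 = 2 by ring, e2, hcd1]; ring
  · simp only [WC, WD, gp, gc]
    rw [show (2 : ℂ) - 3 = -1 by ring, show (2 : ℂ) - 1 = 1 by ring, e1, hcd2]; ring

lemma WL_zero (S : ℕ → Prop) (c : ℂ → ℂ) (m : ℂ) (f0 f1 : ℂ → ℂ) (hf : Symm' S f1) (h1 : S 1)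
    (t0 : ℂ) (ht : t0 = 0 ∨ t0 = 1 ∨ t0 = 2) : WL c m f0 f1 t0 = 0 := by
  have e1 := hf 1 h1
  push_cast at e1
  rcases ht with rfl | rfl | rfl
  · simp only [WL, neg_zero, zero_add, zero_sub, e1]; ring
  · simp only [WL, gl]; ring
  · simp only [WL, gl]; ring

lemma WE_zero (e : ℂ → ℂ) (f0 f1 : ℂ → ℂ) (t0 : ℂ) (ht : t0 = 0 ∨ t0 = 1 ∨ t0 = 2) : WE e f0 f1 t0 = 0 := by
  rcases ht with rfl | rfl | rfl <;> simp [WE, D5] <;> norm_num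

/-! values on the odd data at `s ∈ S`, `s ≥ 3` -/

lemma Van.of_eq {S d} (h : Van S d) {t : ℂ} (s : ℕ) (hs : S s ∨ s = 0) (ht : t = s) : d t = 0 := by
  rcases hs with hs | hs
  · rw [ht, h.2 s hs]
  · rw [ht, hs]; simpa using h.zero

lemma WA_van (S : ℕ → Prop) (a : ℂ → ℂ) (k l : ℕ) (f : ℂ → ℂ) (hf : Van S f) (s : ℕ) (hs : S s) (h3 : 3 ≤ s)
    (hp : s = k ∨ s + 1 = l ∨ S (s + 2)) (hm : S (s - 2)) : WA a k l f s = 0 := by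
  have e0 := hf.2 s hs
  have em : f (s - 2) = 0 := hf.of_eq (s - 2) (Or.inl hm) (by push_cast [Nat.cast_sub (by omega : 2 ≤ s)]; ring)
  unfold WA
  rw [e0, em]
  rcases hp with hp | hp | hp
  · simp [gb, hp]
  · have : (s : ℂ) + 1 - l = 0 := by rw [← hp]; push_cast; ring
    simp [gb, this]
  · rw [hf.of_eq (s + 2) (Or.inl hp) (by push_cast; ring)]; ring

lemma WL_van (S : ℕ → Prop) (a : ℂ → ℂ) (m : ℕ) (f g : ℂ → ℂ) (hf : Van S f) (hg : Van S g)
    (s : ℕ) (hs : S s) (h3 : 3 ≤ s)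
    (hp : s = m ∨ S (s + 1)) (hm : S (s - 1)) : WL a m f g s = 0 := by
  have e0 := hf.2 s hs
  have em : g (s - 1) = 0 := hg.of_eq (s - 1) (Or.inl hm) (by push_cast [Nat.cast_sub (by omega : 1 ≤ s)]; ring)
  unfold WL
  rw [e0, em]
  rcases hp with hp | hp
  · simp [gl, hp]
  · rw [hg.of_eq (s + 1) (Or.inl hp) (by push_cast; ring)]; ring

lemma WE_van (S : ℕ → Prop) (a : ℂ → ℂ) (f g : ℂ → ℂ) (hf : Van S f) (hg : Van S g)
    (s : ℕ) (hs : S s) : WE a f g s = 0 := by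
  unfold WE
  rw [hf.2 s hs, hg.2 s hs]; ring

lemma WC_van (m : ℕ) (hm : 1 ≤ m) (a : ℂ → ℂ) (f g : ℂ → ℂ) (hf : Van (SB m) f) (hg : Van (SB m) g)
    (s : ℕ) (hs : SB m s) (h3 : 3 ≤ s) : WC a (3 * m) f g s = 0 := by
  have e0 := hf.2 s hs
  have P : gp (3 * m) s * g (s + 1) = 0 := by
    by_cases h1 : s = 3 * m
    · simp [gp, h1]
    by_cases h2 : s = 3 * m + 2
    · have : (s : ℂ) - 3 * m - 2 = 0 := by rw [h2]; push_cast; ring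
      simp [gp, this]
    rw [hg.of_eq (s + 1) (Or.inl (by unfold SB at *; omega)) (by push_cast; ring), mul_zero]
  have M : gp (3 * m) (-s) * g (s - 1) = 0 := by
    by_cases h2 : s = 3 * m + 2
    · have : -(s : ℂ) + 2 + 3 * m = 0 := by rw [h2]; push_cast; ring
      simp [gp, this]
    rw [hg.of_eq (s - 1) (Or.inl (by unfold SB at *; omega))
      (by push_cast [Nat.cast_sub (by omega : 1 ≤ s)]; ring), mul_zero]
  unfold WC
  rw [e0]
  linear_combination a s * P - a (-s) * M

lemma WD_van (m : ℕ) (hm : 1 ≤ m) (a : ℂ → ℂ) (f g : ℂ → ℂ) (hf : Van (SB m) f) (hg : Van (SB m) g)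
    (s : ℕ) (hs : SB m s) (h3 : 3 ≤ s) : WD a (3 * m) f g s = 0 := by
  have e0 := hf.2 s hs
  have P : gc (3 * m) s * g (s + 3) = 0 := by
    by_cases h1 : s = 3 * m
    · simp [gc, h1]
    by_cases h2 : s = 3 * m + 2
    · have : (s : ℂ) - 3 * m - 2 = 0 := by rw [h2]; push_cast; ring
      simp [gc, this]
    by_cases h3 : s + 2 = 3 * m
    · have : (s : ℂ) + 2 - 3 * m = 0 := by
        have := congrArg (Nat.cast (R := ℂ)) h3
        push_cast at this; linear_combination this
      simp [gc, this]
    rw [hg.of_eq (s + 3) (Or.inl (by unfold SB at *; omega)) (by push_cast; ring), mul_zero]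
  have M : g (s - 3) = 0 := 
    hg.of_eq (s - 3) (by unfold SB at *; omega)
      (by push_cast [Nat.cast_sub (by omega : 3 ≤ s)]; ring)
  unfold WD
  rw [e0, M]
  linear_combination a s * P

/-! derivatives at `s = 1, 2` -/

lemma bder {f g : ℂ → ℂ} (hf : Differentiable ℂ f) (hg : Differentiable ℂ g) (c s : ℂ) :
    HasDerivAt (fun t => g (t + c) - f t) (deriv g (s + c) - deriv f s) s := by
  exact ((hg (s + c)).hasDerivAt.comp_add_const s c).sub (hf s).hasDerivAt

lemma bder' {f g : ℂ → ℂ} (hf : Differentiable ℂ f) (hg : Differentiable ℂ g) (c s : ℂ) :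
    HasDerivAt (fun t => g (t - c) - f t) (deriv g (s - c) - deriv f s) s := by
  exact ((hg (s - c)).hasDerivAt.comp_sub_const s c).sub (hf s).hasDerivAt

lemma WA_der1 (S : ℕ → Prop) (a : ℂ → ℂ) (k l : ℂ) (f : ℂ → ℂ) (hf : Van S f) (hd : Differentiable ℂ f)
    (ha : DifferentiableAt ℂ a 1) (ha' : DifferentiableAt ℂ a (-1)) (h1 : S 1)
    (h : k = 1 ∨ l = 2 ∨ S 3) : HasDerivAt (WA a k l f) 0 1 := by
  have e1 : f 1 = 0 := by simpa using hf.2 1 h1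
  have e1' : f (-1) = 0 := by simpa using hf.neg 1 h1
  have an := dneg ha'
  have A : HasDerivAt (fun t => a t * ((t - 1) * ((t - k) * (t + 1 - l) * (t ^ 2 - 4))) * (f (t + 2) - f t)) 0 1 := by
    refine T1 a _ _ 1 ha (by fun_prop) (by fun_prop) ?_
    rcases h with h | h | h
    · left; rw [h]; ring
    · left; rw [h]; ring
    · right
      rw [e1, hf.of_eq 3 (Or.inl h) (by norm_num)]; ring
  have B := T2 (fun t => a (-t) * gb k l (-t)) (fun t => f (t - 2) - f t) 1 _ (by unfold gb; fun_prop)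
    (bder' hd hd 2 1) (by rw [show (1 : ℂ) - 2 = -1 by norm_num, e1, e1', sub_zero])
  have C := A.sub B
  rw [show (1 : ℂ) - 2 = -1 by norm_num, hf.deriv_eq hd, sub_self, mul_zero, sub_zero] at C
  refine C.congr_of_eventuallyEq (Filter.Eventually.of_forall fun t => ?_)
  simp only [WA, gb, Pi.sub_apply]; ring

lemma WA_der2 (S : ℕ → Prop) (a : ℂ → ℂ) (k l : ℂ) (f : ℂ → ℂ) (hf : Van S f) (hd : Differentiable ℂ f)
    (ha : DifferentiableAt ℂ a 2) (ha' : DifferentiableAt ℂ a (-2)) (h2 : S 2)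
    (h : k = 2 ∨ l = 3 ∨ S 4) : HasDerivAt (WA a k l f) 0 2 := by
  have e1 : f 2 = 0 := by simpa using hf.2 2 h2
  have an := dneg ha'
  have A : HasDerivAt (fun t => a t * ((t - 2) * ((t - k) * (t + 1 - l) * (t - 1) * (t + 2))) * (f (t + 2) - f t)) 0 2 := by
    refine T1 a _ _ 2 ha (by fun_prop) (by fun_prop) ?_
    rcases h with h | h | h
    · left; rw [h]; ring
    · left; rw [h]; ring
    · right
      rw [e1, hf.of_eq 4 (Or.inl h) (by norm_num)]; ring
  have B : HasDerivAt (fun t => a (-t) * ((t - 2) * ((-t - k) * (-t + 1 - l) * (-t - 1) * (t + 2))) * (f (t - 2) - f t)) 0 2 := by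
    refine T1 (fun t => a (-t)) _ _ 2 an (by fun_prop) (by fun_prop) (Or.inr ?_)
    rw [e1, sub_self, hf.zero, sub_zero]
  have C := A.sub B
  rw [sub_zero] at C
  refine C.congr_of_eventuallyEq (Filter.Eventually.of_forall fun t => ?_)
  simp only [WA, gb, Pi.sub_apply]; ring

lemma WL_der1 (S : ℕ → Prop) (a : ℂ → ℂ) (m : ℂ) (f g : ℂ → ℂ) (hf : Van S f) (hd : Differentiable ℂ f)
    (hg : Van S g) (hdg : Differentiable ℂ g)
    (ha : DifferentiableAt ℂ a 1) (ha' : DifferentiableAt ℂ a (-1)) (h1 : S 1)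
    (h : m = 1 ∨ S 2) : HasDerivAt (WL a m f g) 0 1 := by
  have e1 : f 1 = 0 := by simpa using hf.2 1 h1
  have an := dneg ha'
  have A : HasDerivAt (fun t => a t * ((t - 1) * ((t - m) * (t + 1) * (t ^ 2 - 4))) * (g (t + 1) - f t)) 0 1 := by
    refine T1 a _ _ 1 ha (by fun_prop) (by fun_prop) ?_
    rcases h with h | h
    · left; rw [h]; ring
    · right
      rw [e1, hg.of_eq 2 (Or.inl h) (by norm_num)]; ring
  have B : HasDerivAt (fun t => a (-t) * ((t - 1) * ((-t - m) * (t + 1) * (t ^ 2 - 4))) * (g (t - 1) - f t)) 0 1 := by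
    refine T1 (fun t => a (-t)) _ _ 1 an (by fun_prop) (by fun_prop) (Or.inr ?_)
    rw [e1, sub_self, hg.zero, sub_zero]
  have C := A.sub B
  rw [sub_zero] at C
  refine C.congr_of_eventuallyEq (Filter.Eventually.of_forall fun t => ?_)
  simp only [WL, gl, Pi.sub_apply]; ring

lemma WL_der2 (S : ℕ → Prop) (a : ℂ → ℂ) (m : ℂ) (f g : ℂ → ℂ) (hf : Van S f) (hd : Differentiable ℂ f)
    (hg : Van S g) (hdg : Differentiable ℂ g)
    (ha : DifferentiableAt ℂ a 2) (ha' : DifferentiableAt ℂ a (-2)) (h1 : S 1) (h2 : S 2)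
    (h : m = 2 ∨ S 3) : HasDerivAt (WL a m f g) 0 2 := by
  have e1 : f 2 = 0 := by simpa using hf.2 2 h2
  have an := dneg ha'
  have A : HasDerivAt (fun t => a t * ((t - 2) * ((t - m) * (t ^ 2 - 1) * (t + 2))) * (g (t + 1) - f t)) 0 2 := by
    refine T1 a _ _ 2 ha (by fun_prop) (by fun_prop) ?_
    rcases h with h | h
    · left; rw [h]; ring
    · right
      rw [e1, hg.of_eq 3 (Or.inl h) (by norm_num)]; ring
  have B : HasDerivAt (fun t => a (-t) * ((t - 2) * ((-t - m) * (t ^ 2 - 1) * (t + 2))) * (g (t - 1) - f t)) 0 2 := by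
    refine T1 (fun t => a (-t)) _ _ 2 an (by fun_prop) (by fun_prop) (Or.inr ?_)
    rw [e1, hg.of_eq 1 (Or.inl h1) (by norm_num)]; ring
  have C := A.sub B
  rw [sub_zero] at C
  refine C.congr_of_eventuallyEq (Filter.Eventually.of_forall fun t => ?_)
  simp only [WL, gl, Pi.sub_apply]; ring

lemma WE_der (S : ℕ → Prop) (a : ℂ → ℂ) (f g : ℂ → ℂ) (hf : Van S f) (hd : Differentiable ℂ f)
    (hg : Van S g) (hdg : Differentiable ℂ g) (s : ℕ) (hs : S s) (hs2 : s = 1 ∨ s = 2)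
    (ha : DifferentiableAt ℂ a s) : HasDerivAt (WE a f g) 0 s := by
  have e : g s - f s = 0 := by rw [hf.2 s hs, hg.2 s hs, sub_zero]
  rcases hs2 with rfl | rfl
  · refine (T1 a (fun t => t * (t + 1) * (t ^ 2 - 4)) (fun t => g t - f t) _ ha (by fun_prop) (by fun_prop)
      (Or.inr e)).congr_of_eventuallyEq (Filter.Eventually.of_forall fun t => ?_)
    simp only [WE, D5]; push_cast; ring
  · refine (T1 a (fun t => t * (t ^ 2 - 1) * (t + 2)) (fun t => g t - f t) _ ha (by fun_prop) (by fun_prop)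
      (Or.inr e)).congr_of_eventuallyEq (Filter.Eventually.of_forall fun t => ?_)
    simp only [WE, D5]; push_cast; ring

lemma WCD_der1 (S : ℕ → Prop) (c d : ℂ → ℂ) (n : ℂ) (f g : ℂ → ℂ) (hf : Van S f) (hd : Differentiable ℂ f)
    (hg : Van S g) (hdg : Differentiable ℂ g) (hc : DifferentiableAt ℂ c 1) (hc' : DifferentiableAt ℂ c (-1))
    (hdd : DifferentiableAt ℂ d 1) (hdd' : DifferentiableAt ℂ d (-1)) (h1 : S 1) (h2 : S 2)
    (h : n = 3 ∨ S 4) (hcd1 : c 1 = 3 * d (-1)) :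
    HasDerivAt (fun t => WC c n f g t + WD d n f g t) 0 1 := by
  have cn := dneg hc'
  have dn := dneg hdd'
  have e1 : f 1 = 0 := by simpa using hf.2 1 h1
  have e2 : g 2 = 0 := by simpa using hg.2 2 h2
  have e2' : g (-2) = 0 := by simpa using hg.neg 2 h2
  have A := T2 (fun t => c t * gp n t) (fun t => g (t + 1) - f t) 1 _ (by unfold gp; fun_prop)
    (bder hd hdg 1 1) (by rw [show (1 : ℂ) + 1 = 2 by norm_num, e1, e2, sub_zero])
  have B : HasDerivAt (fun t => c (-t) * ((t - 1) * (-(-t - n - 2) * (-t + 2 + n) * (-t - n) * (-t - 2))) *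
      (g (t - 1) - f t)) 0 1 := by
    refine T1 (fun t => c (-t)) _ _ 1 cn (by fun_prop) (by fun_prop) (Or.inr ?_)
    rw [e1, sub_self, hg.zero, sub_zero]
  have C : HasDerivAt (fun t => d t * ((t - 1) * ((t - n - 2) * (t - n) * (t + 2 - n) * (t - 2))) *
      (g (t + 3) - f t)) 0 1 := by
    refine T1 d _ _ 1 hdd (by fun_prop) (by fun_prop) ?_
    rcases h with h | h
    · left; rw [h]; ring
    · right; rw [e1, hg.of_eq 4 (Or.inl h) (by norm_num)]; ring
  have D := T2 (fun t => d (-t) * gc n (-t)) (fun t => g (t - 3) - f t) 1 _ (by unfold gc; fun_prop)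
    (bder' hd hdg 3 1) (by rw [show (1 : ℂ) - 3 = -2 by norm_num, e1, e2', sub_zero])
  have E := (A.sub B).add (C.sub D)
  refine (E.congr_deriv ?_).congr_of_eventuallyEq (Filter.Eventually.of_forall fun t => ?_)
  · rw [show (1 : ℂ) - 3 = -2 by norm_num, show (1 : ℂ) + 1 = 2 by norm_num, hg.deriv_eq hdg, hcd1]
    simp only [gp, gc]; ring
  · simp only [WC, WD, gp, gc, Pi.sub_apply, Pi.add_apply]; ring

lemma WCD_der2 (S : ℕ → Prop) (c d : ℂ → ℂ) (n : ℂ) (f g : ℂ → ℂ) (hf : Van S f) (hd : Differentiable ℂ f)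
    (hg : Van S g) (hdg : Differentiable ℂ g) (hc : DifferentiableAt ℂ c 2) (hc' : DifferentiableAt ℂ c (-2))
    (hdd : DifferentiableAt ℂ d 2) (hdd' : DifferentiableAt ℂ d (-2)) (h1 : S 1) (h2 : S 2)
    (h3 : S 3) (h5 : S 5) (hcd1 : c (-2) = 3 * d (-2)) :
    HasDerivAt (fun t => WC c n f g t + WD d n f g t) 0 2 := by
  have cn := dneg hc'
  have dn := dneg hdd'
  have e2 : f 2 = 0 := by simpa using hf.2 2 h2
  have e1 : g 1 = 0 := by simpa using hg.2 1 h1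
  have e1' : g (-1) = 0 := by simpa using hg.neg 1 h1
  have A : HasDerivAt (fun t => c t * ((t - 2) * ((t - n - 2) * (t + 2 + n) * (t - n) * (t + 1))) *
      (g (t + 1) - f t)) 0 2 := by
    refine T1 c _ _ 2 hc (by fun_prop) (by fun_prop) (Or.inr ?_)
    rw [e2, hg.of_eq 3 (Or.inl h3) (by norm_num)]; ring
  have B := T2 (fun t => c (-t) * gp n (-t)) (fun t => g (t - 1) - f t) 2 _ (by unfold gp; fun_prop)
    (bder' hd hdg 1 2) (by rw [show (2 : ℂ) - 1 = 1 by norm_num, e1, e2, sub_zero])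
  have C : HasDerivAt (fun t => d t * ((t - 2) * ((t - n - 2) * (t - n) * (t + 2 - n) * (t - 1))) *
      (g (t + 3) - f t)) 0 2 := by
    refine T1 d _ _ 2 hdd (by fun_prop) (by fun_prop) ?_
    right; rw [e2, hg.of_eq 5 (Or.inl h5) (by norm_num)]; ring
  have D := T2 (fun t => d (-t) * gc n (-t)) (fun t => g (t - 3) - f t) 2 _ (by unfold gc; fun_prop)
    (bder' hd hdg 3 2) (by rw [show (2 : ℂ) - 3 = -1 by norm_num, e1', e2, sub_zero])
  have E := (A.sub B).add (C.sub D)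
  refine (E.congr_deriv ?_).congr_of_eventuallyEq (Filter.Eventually.of_forall fun t => ?_)
  · rw [show (2 : ℂ) - 3 = -1 by norm_num, show (2 : ℂ) - 1 = 1 by norm_num, hg.deriv_eq hdg, hcd1]
    simp only [gp, gc]; ring
  · simp only [WC, WD, gp, gc, Pi.sub_apply, Pi.add_apply]; ring
end

noncomputable section
open Complex

/-! ### The operator in the coordinates `p, q` -/

def fp (n u : ℂ) : ℂ := (1 - (n + 2) / u) * (1 + n / (u + 2)) * (1 - (n - 1) / (u - 1))
def fc (n u : ℂ) : ℂ := (1 - (n + 2) / u) * (1 - (n + 1) / (u + 1)) * (1 - n / (u + 2))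
def fl (m u : ℂ) : ℂ := 1 - m / u
def fb (k l u : ℂ) : ℂ := (1 - k / u) * (1 - l / (u + 1))

def AS (m p q : ℂ) : ℂ := 3 * (fp (3 * m) q * fp (3 * m) (p - q)) * (fl m ((p + q) / 3) * fl m ((2 * p - q) / 3)) *
  fb (3 * m + 2) (3 * m) p
def AL (m p q : ℂ) : ℂ := (fc (3 * m) q * fc (3 * m) (q - p)) * (fl m ((q - 2 * p) / 3) * fl m ((p + q) / 3)) *
  fb m m ((2 * q - p) / 3)

def DD (m : ℂ) (F : ℂ → ℂ → ℂ) (p q : ℂ) : ℂ :=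
  AS m p q * (F (p + 2) (q + 1) - F p q) + AS m q (q - p) * (F (p + 1) (q + 2) - F p q) +
  AS m (q - p) (-p) * (F (p - 1) (q + 1) - F p q) + AS m (-p) (-q) * (F (p - 2) (q - 1) - F p q) +
  AS m (-q) (p - q) * (F (p - 1) (q - 2) - F p q) + AS m (p - q) p * (F (p + 1) (q - 1) - F p q) +
  AL m p q * (F p (q + 3) - F p q) + AL m q (q - p) * (F (p - 3) q - F p q) +
  AL m (q - p) (-p) * (F (p - 3) (q - 3) - F p q) + AL m (-p) (-q) * (F p (q - 3) - F p q) +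
  AL m (-q) (p - q) * (F (p + 3) q - F p q) + AL m (p - q) p * (F (p + 3) (q + 3) - F p q)

lemma D5_ne {u : ℂ} (h : D5 u ≠ 0) : u ≠ 0 ∧ u - 1 ≠ 0 ∧ u + 1 ≠ 0 ∧ u - 2 ≠ 0 ∧ u + 2 ≠ 0 := by
  refine ⟨?_, ?_, ?_, ?_, ?_⟩ <;> intro h' <;> apply h
  · simp [D5, h']
  · simp [D5, eq_of_sub_eq_zero h']
  · simp [D5, eq_neg_of_add_eq_zero_left h']
  · rw [eq_of_sub_eq_zero h', D5]; norm_num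
  · rw [eq_neg_of_add_eq_zero_left h', D5]; norm_num

lemma D5_neg (u : ℂ) : D5 (-u) = - D5 u := by unfold D5; ring
lemma D5_neg_ne {u : ℂ} (h : D5 u ≠ 0) : D5 (-u) ≠ 0 := by rw [D5_neg]; exact neg_ne_zero.2 h

lemma gp_eq (n : ℂ) {u : ℂ} (h : D5 u ≠ 0) : gp n u = D5 u * fp n u := by
  obtain ⟨h1, h2, h3, h4, h5⟩ := D5_ne h
  unfold gp fp D5; field_simp; ring
lemma gc_eq (n : ℂ) {u : ℂ} (h : D5 u ≠ 0) : gc n u = D5 u * fc n u := by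
  obtain ⟨h1, h2, h3, h4, h5⟩ := D5_ne h
  unfold gc fc D5; field_simp; ring
lemma gl_eq (n : ℂ) {u : ℂ} (h : D5 u ≠ 0) : gl n u = D5 u * fl n u := by
  obtain ⟨h1, h2, h3, h4, h5⟩ := D5_ne h
  unfold gl fl D5; field_simp
lemma gb_eq (k l : ℂ) {u : ℂ} (h : D5 u ≠ 0) : gb k l u = D5 u * fb k l u := by
  obtain ⟨h1, h2, h3, h4, h5⟩ := D5_ne h
  unfold gb fb D5; field_simp; ring

def LB (F : ℂ → ℂ → ℂ) (r t : ℂ) : ℂ := F t (r + t / 2)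
def LA (F : ℂ → ℂ → ℂ) (r t : ℂ) : ℂ := F r (r / 2 + 3 * t / 2)

def aB (m y t : ℂ) : ℂ := 3 * (fp (3 * m) (y + t / 2) * fp (3 * m) (t / 2 - y)) *
  (fl m ((y + 3 * t / 2) / 3) * fl m ((3 * t / 2 - y) / 3))
def cB (m y t : ℂ) : ℂ := 3 * fp (3 * m) (y - t / 2) * (fl m (2 * y / 3) * fl m ((y + 3 * t / 2) / 3)) *
  fb (3 * m + 2) (3 * m) (y + t / 2)
def dB (m y t : ℂ) : ℂ := fc (3 * m) (y + t / 2) * (fl m (2 * y / 3) * fl m ((3 * t / 2 - y) / 3)) *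
  fb m m ((y + 3 * t / 2) / 3)
def eB (m y t : ℂ) : ℂ := fc (3 * m) (y + t / 2) * fc (3 * m) (y - t / 2) *
  (fl m ((y - 3 * t / 2) / 3) * fl m ((y + 3 * t / 2) / 3)) * fb m m (2 * y / 3)

def aA (m y t : ℂ) : ℂ := fc (3 * m) ((y + 3 * t) / 2) * fc (3 * m) ((3 * t - y) / 2) *
  (fl m ((t - y) / 2) * fl m ((t + y) / 2))
def cA (m y t : ℂ) : ℂ := 3 * (fp (3 * m) ((3 * t - y) / 2) * fp (3 * m) y) * fl m ((y + t) / 2) *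
  fb (3 * m + 2) (3 * m) ((y + 3 * t) / 2)
def dA (m y t : ℂ) : ℂ := fc (3 * m) y * fc (3 * m) ((y + 3 * t) / 2) * fl m ((y - t) / 2) * fb m m ((y + t) / 2)
def eA (m y t : ℂ) : ℂ := 3 * (fp (3 * m) ((y + 3 * t) / 2) * fp (3 * m) ((y - 3 * t) / 2)) *
  (fl m ((y + t) / 2) * fl m ((y - t) / 2)) * fb (3 * m + 2) (3 * m) y

/-- the five-row combination for the `β` direction -/
def WB (m y : ℂ) (f0 f1 f1m f2 f2m : ℂ → ℂ) (t : ℂ) : ℂ :=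
  WA (aB m y) (3 * m + 2) (3 * m) f0 t + (WC (cB m y) (3 * m) f0 f1 t + WD (dB m y) (3 * m) f0 f1 t) +
  (WC (cB m (-y)) (3 * m) f0 f1m t + WD (dB m (-y)) (3 * m) f0 f1m t) +
  WE (eB m y) f0 f2 t + WE (eB m (-y)) f0 f2m t

/-- the seven-row combination for the `α` direction -/
def WAl (m y : ℂ) (f0 f1 f1m f3 f3m f2 f2m : ℂ → ℂ) (t : ℂ) : ℂ :=
  WA (aA m y) m m f0 t + WL (cA m y) m f0 f1 t + WL (cA m (-y)) m f0 f1m t +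
  WL (dA m y) m f0 f3 t + WL (dA m (-y)) m f0 f3m t +
  WE (eA m y) f0 f2 t + WE (eA m (-y)) f0 f2m t

lemma lineB (m : ℂ) (F : ℂ → ℂ → ℂ) (y t : ℂ) (h : D5 t ≠ 0) :
    D5 t * DD m F t (y + t / 2) =
      WB m y (LB F y) (LB F (y + 3 / 2)) (LB F (y - 3 / 2)) (LB F (y + 3)) (LB F (y - 3)) t := by
  have h' := D5_neg_ne h
  simp only [WB, WA, WC, WD, WE, gb_eq _ _ h, gb_eq _ _ h', gp_eq _ h, gp_eq _ h', gc_eq _ h, gc_eq _ h', D5_neg]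
  simp only [DD, LB, AS, AL, aB, cB, dB, eB]
  ring_nf

lemma lineA (m : ℂ) (F : ℂ → ℂ → ℂ) (y t : ℂ) (h : D5 t ≠ 0) :
    D5 t * DD m F y (y / 2 + 3 * t / 2) =
      WAl m y (LA F y) (LA F (y + 1)) (LA F (y - 1)) (LA F (y + 3)) (LA F (y - 3)) (LA F (y + 2)) (LA F (y - 2)) t := by
  have h' := D5_neg_ne h
  simp only [WAl, WA, WL, WE, gb_eq _ _ h, gb_eq _ _ h', gl_eq _ h, gl_eq _ h', D5_neg]
  simp only [DD, LA, AS, AL, aA, cA, dA, eA]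
  ring_nf
end

noncomputable section
open Complex

def NI (u : ℂ) : Prop := ∀ k : ℤ, u ≠ k

lemma NI.ne {u : ℂ} (h : NI u) : u ≠ 0 ∧ u - 1 ≠ 0 ∧ u + 1 ≠ 0 ∧ u - 2 ≠ 0 ∧ u + 2 ≠ 0 := by
  refine ⟨?_, ?_, ?_, ?_, ?_⟩ <;> intro h'
  · exact h 0 (by simpa using h')
  · exact h 1 (by push_cast; linear_combination h')
  · exact h (-1) (by push_cast; linear_combination h')
  · exact h 2 (by push_cast; linear_combination h')
  · exact h (-2) (by push_cast; linear_combination h')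

lemma NI.D5 {u : ℂ} (h : NI u) : D5 u ≠ 0 := by
  obtain ⟨h1, h2, h3, h4, h5⟩ := h.ne
  have : _root_.D5 u = u * ((u - 1) * (u + 1)) * ((u - 2) * (u + 2)) := by unfold _root_.D5; ring
  rw [this]
  exact mul_ne_zero (mul_ne_zero h1 (mul_ne_zero h2 h3)) (mul_ne_zero h4 h5)

lemma fp_d (n : ℂ) {g : ℂ → ℂ} {s : ℂ} (hg : DifferentiableAt ℂ g s) (h : NI (g s)) :
    DifferentiableAt ℂ (fun t => fp n (g t)) s := by
  obtain ⟨h1, h2, h3, h4, h5⟩ := h.ne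
  unfold fp; fun_prop (disch := assumption)
lemma fc_d (n : ℂ) {g : ℂ → ℂ} {s : ℂ} (hg : DifferentiableAt ℂ g s) (h : NI (g s)) :
    DifferentiableAt ℂ (fun t => fc n (g t)) s := by
  obtain ⟨h1, h2, h3, h4, h5⟩ := h.ne
  unfold fc; fun_prop (disch := assumption)
lemma fl_d (n : ℂ) {g : ℂ → ℂ} {s : ℂ} (hg : DifferentiableAt ℂ g s) (h : NI (g s)) :
    DifferentiableAt ℂ (fun t => fl n (g t)) s := by
  obtain ⟨h1, h2, h3, h4, h5⟩ := h.ne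
  unfold fl; fun_prop (disch := assumption)
lemma fb_d (k l : ℂ) {g : ℂ → ℂ} {s : ℂ} (hg : DifferentiableAt ℂ g s) (h : NI (g s)) :
    DifferentiableAt ℂ (fun t => fb k l (g t)) s := by
  obtain ⟨h1, h2, h3, h4, h5⟩ := h.ne
  unfold fb; fun_prop (disch := assumption)

lemma NI.neg2 {y : ℂ} (h : NI (2 * y)) : NI (2 * -y) := by
  intro k hk
  exact h (-k) (by push_cast; linear_combination -hk)

section
variable {y : ℂ} (hy : NI (2 * y)) (k : ℤ)
lemma ni1 (hy : NI (2 * y)) (k : ℤ) : NI (y + k / 2) := fun j h => hy (2 * j - k) (by push_cast; linear_combination 2 * h)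
lemma ni2 (hy : NI (2 * y)) (k : ℤ) : NI (y - k / 2) := fun j h => hy (2 * j + k) (by push_cast; linear_combination 2 * h)
lemma ni3 (hy : NI (2 * y)) (k : ℤ) : NI (k / 2 - y) := fun j h => hy (k - 2 * j) (by push_cast; linear_combination -2 * h)
lemma ni4 (hy : NI (2 * y)) : NI (2 * y / 3) := fun j h => hy (3 * j) (by push_cast; linear_combination 3 * h)
lemma ni5 (hy : NI (2 * y)) (k : ℤ) : NI ((y + 3 * k / 2) / 3) := fun j h => hy (6 * j - 3 * k) (by push_cast; linear_combination 6 * h)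
lemma ni6 (hy : NI (2 * y)) (k : ℤ) : NI ((3 * k / 2 - y) / 3) := fun j h => hy (3 * k - 6 * j) (by push_cast; linear_combination -6 * h)
lemma ni7 (hy : NI (2 * y)) (k : ℤ) : NI ((y - 3 * k / 2) / 3) := fun j h => hy (6 * j + 3 * k) (by push_cast; linear_combination 6 * h)
lemma ni8 (hy : NI (2 * y)) (k : ℤ) : NI ((y + 3 * k) / 2) := fun j h => hy (4 * j - 6 * k) (by push_cast; linear_combination 4 * h)
lemma ni9 (hy : NI (2 * y)) (k : ℤ) : NI ((3 * k - y) / 2) := fun j h => hy (6 * k - 4 * j) (by push_cast; linear_combination -4 * h)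
lemma ni10 (hy : NI (2 * y)) (k : ℤ) : NI ((y - 3 * k) / 2) := fun j h => hy (4 * j + 6 * k) (by push_cast; linear_combination 4 * h)
lemma ni11 (hy : NI (2 * y)) (k : ℤ) : NI ((k - y) / 2) := fun j h => hy (2 * k - 4 * j) (by push_cast; linear_combination -4 * h)
lemma ni12 (hy : NI (2 * y)) (k : ℤ) : NI ((k + y) / 2) := fun j h => hy (4 * j - 2 * k) (by push_cast; linear_combination 4 * h)
lemma ni13 (hy : NI (2 * y)) (k : ℤ) : NI ((y + k) / 2) := fun j h => hy (4 * j - 2 * k) (by push_cast; linear_combination 4 * h)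
lemma ni14 (hy : NI (2 * y)) (k : ℤ) : NI ((y - k) / 2) := fun j h => hy (4 * j + 2 * k) (by push_cast; linear_combination 4 * h)
lemma ni15 (hy : NI (2 * y)) : NI y := fun j h => hy (2 * j) (by push_cast; linear_combination 2 * h)

lemma aB_d (m : ℂ) (hy : NI (2 * y)) (k : ℤ) : DifferentiableAt ℂ (aB m y) k := by
  have h1 := fp_d (3 * m) (g := fun t => y + t / 2) (s := k) (by fun_prop) (ni1 hy k)
  have h2 := fp_d (3 * m) (g := fun t => t / 2 - y) (s := k) (by fun_prop) (ni3 hy k)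
  have h3 := fl_d m (g := fun t => (y + 3 * t / 2) / 3) (s := k) (by fun_prop) (ni5 hy k)
  have h4 := fl_d m (g := fun t => (3 * t / 2 - y) / 3) (s := k) (by fun_prop) (ni6 hy k)
  unfold aB; fun_prop
lemma cB_d (m : ℂ) (hy : NI (2 * y)) (k : ℤ) : DifferentiableAt ℂ (cB m y) k := by
  have h1 := fp_d (3 * m) (g := fun t => y - t / 2) (s := k) (by fun_prop) (ni2 hy k)
  have h3 := fl_d m (g := fun t => (y + 3 * t / 2) / 3) (s := k) (by fun_prop) (ni5 hy k)
  have h4 := fb_d (3 * m + 2) (3 * m) (g := fun t => y + t / 2) (s := k) (by fun_prop) (ni1 hy k)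
  unfold cB; fun_prop
lemma dB_d (m : ℂ) (hy : NI (2 * y)) (k : ℤ) : DifferentiableAt ℂ (dB m y) k := by
  have h1 := fc_d (3 * m) (g := fun t => y + t / 2) (s := k) (by fun_prop) (ni1 hy k)
  have h3 := fl_d m (g := fun t => (3 * t / 2 - y) / 3) (s := k) (by fun_prop) (ni6 hy k)
  have h4 := fb_d m m (g := fun t => (y + 3 * t / 2) / 3) (s := k) (by fun_prop) (ni5 hy k)
  unfold dB; fun_prop
lemma eB_d (m : ℂ) (hy : NI (2 * y)) (k : ℤ) : DifferentiableAt ℂ (eB m y) k := by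
  have h1 := fc_d (3 * m) (g := fun t => y + t / 2) (s := k) (by fun_prop) (ni1 hy k)
  have h2 := fc_d (3 * m) (g := fun t => y - t / 2) (s := k) (by fun_prop) (ni2 hy k)
  have h3 := fl_d m (g := fun t => (y - 3 * t / 2) / 3) (s := k) (by fun_prop) (ni7 hy k)
  have h4 := fl_d m (g := fun t => (y + 3 * t / 2) / 3) (s := k) (by fun_prop) (ni5 hy k)
  unfold eB; fun_prop
lemma aA_d (m : ℂ) (hy : NI (2 * y)) (k : ℤ) : DifferentiableAt ℂ (aA m y) k := by
  have h1 := fc_d (3 * m) (g := fun t => (y + 3 * t) / 2) (s := k) (by fun_prop) (ni8 hy k)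
  have h2 := fc_d (3 * m) (g := fun t => (3 * t - y) / 2) (s := k) (by fun_prop) (ni9 hy k)
  have h3 := fl_d m (g := fun t => (t - y) / 2) (s := k) (by fun_prop) (ni11 hy k)
  have h4 := fl_d m (g := fun t => (t + y) / 2) (s := k) (by fun_prop) (ni12 hy k)
  unfold aA; fun_prop
lemma cA_d (m : ℂ) (hy : NI (2 * y)) (k : ℤ) : DifferentiableAt ℂ (cA m y) k := by
  have h1 := fp_d (3 * m) (g := fun t => (3 * t - y) / 2) (s := k) (by fun_prop) (ni9 hy k)
  have h3 := fl_d m (g := fun t => (y + t) / 2) (s := k) (by fun_prop) (ni13 hy k)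
  have h4 := fb_d (3 * m + 2) (3 * m) (g := fun t => (y + 3 * t) / 2) (s := k) (by fun_prop) (ni8 hy k)
  unfold cA; fun_prop
lemma dA_d (m : ℂ) (hy : NI (2 * y)) (k : ℤ) : DifferentiableAt ℂ (dA m y) k := by
  have h1 := fc_d (3 * m) (g := fun t => (y + 3 * t) / 2) (s := k) (by fun_prop) (ni8 hy k)
  have h3 := fl_d m (g := fun t => (y - t) / 2) (s := k) (by fun_prop) (ni14 hy k)
  have h4 := fb_d m m (g := fun t => (y + t) / 2) (s := k) (by fun_prop) (ni13 hy k)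
  unfold dA; fun_prop
lemma eA_d (m : ℂ) (hy : NI (2 * y)) (k : ℤ) : DifferentiableAt ℂ (eA m y) k := by
  have h1 := fp_d (3 * m) (g := fun t => (y + 3 * t) / 2) (s := k) (by fun_prop) (ni8 hy k)
  have h2 := fp_d (3 * m) (g := fun t => (y - 3 * t) / 2) (s := k) (by fun_prop) (ni10 hy k)
  have h3 := fl_d m (g := fun t => (y + t) / 2) (s := k) (by fun_prop) (ni13 hy k)
  have h4 := fl_d m (g := fun t => (y - t) / 2) (s := k) (by fun_prop) (ni14 hy k)
  unfold eA; fun_prop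
end

lemma nz {y : ℂ} (hy : NI (2 * y)) (a b : ℤ) (ha : a = 1 ∨ a = 2 ∨ a = -2) : (a : ℂ) * y + b ≠ 0 := by
  intro h
  rcases ha with rfl | rfl | rfl
  · exact hy (-2 * b) (by push_cast at *; linear_combination 2 * h)
  · exact hy (- b) (by push_cast at *; linear_combination h)
  · exact hy (b) (by push_cast at *; linear_combination -h)

lemma cd1 (m : ℂ) {y : ℂ} (hy : NI (2 * y)) : cB m y 1 = 3 * dB m y (-1) := by
  have h := fun b : ℤ => nz hy 2 b (by simp)
  have p1 := h 1; have p2 := h (-1); have p3 := h 3; have p4 := h (-3); have p5 := h 5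
  push_cast at p1 p2 p3 p4 p5
  unfold cB dB
  have : fp (3 * m) (y - 1 / 2) * fl m ((y + 3 * 1 / 2) / 3) * fb (3 * m + 2) (3 * m) (y + 1 / 2) =
    fc (3 * m) (y + -1 / 2) * fl m ((3 * -1 / 2 - y) / 3) * fb m m ((y + 3 * -1 / 2) / 3) := by
    have q1 : fp (3 * m) (y - 1 / 2) = (2 * y - 1 - 2 * (3 * m + 2)) * (2 * y + 3 + 6 * m) * (2 * y - 3 - 2 * (3 * m - 1)) /
        ((2 * y + -1) * (2 * y + 3) * (2 * y + -3)) := by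
      unfold fp
      rw [show y - 1 / 2 = (2 * y + -1) / 2 by ring, show (2 * y + -1) / 2 + 2 = (2 * y + 3) / 2 by ring,
        show (2 * y + -1) / 2 - 1 = (2 * y + -3) / 2 by ring]
      field_simp; ring
    have q2 : fl m ((y + 3 * 1 / 2) / 3) = (2 * y + 3 - 6 * m) / (2 * y + 3) := by
      unfold fl
      rw [show (y + 3 * 1 / 2) / 3 = (2 * y + 3) / 6 by ring]; field_simp
    have q3 : fb (3 * m + 2) (3 * m) (y + 1 / 2) = (2 * y + 1 - 2 * (3 * m + 2)) * (2 * y + 3 - 6 * m) /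
        ((2 * y + 1) * (2 * y + 3)) := by
      unfold fb
      rw [show y + 1 / 2 = (2 * y + 1) / 2 by ring, show (2 * y + 1) / 2 + 1 = (2 * y + 3) / 2 by ring]
      field_simp; ring
    have q4 : fc (3 * m) (y + -1 / 2) = (2 * y - 1 - 2 * (3 * m + 2)) * (2 * y + 1 - 2 * (3 * m + 1)) * (2 * y + 3 - 6 * m) /
        ((2 * y + -1) * (2 * y + 1) * (2 * y + 3)) := by
      unfold fc
      rw [show y + -1 / 2 = (2 * y + -1) / 2 by ring, show (2 * y + -1) / 2 + 2 = (2 * y + 3) / 2 by ring,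
        show (2 * y + -1) / 2 + 1 = (2 * y + 1) / 2 by ring]
      field_simp; ring
    have q5 : fl m ((3 * -1 / 2 - y) / 3) = (2 * y + 3 + 6 * m) / (2 * y + 3) := by
      unfold fl
      rw [show (3 * -1 / 2 - y) / 3 = -(2 * y + 3) / 6 by ring]; field_simp; ring
    have q6 : fb m m ((y + 3 * -1 / 2) / 3) = (2 * y - 3 - 6 * m) * (2 * y + 3 - 6 * m) /
        ((2 * y + -3) * (2 * y + 3)) := by
      unfold fb
      rw [show (y + 3 * -1 / 2) / 3 = (2 * y + -3) / 6 by ring, show (2 * y + -3) / 6 + 1 = (2 * y + 3) / 6 by ring]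
      field_simp; ring
    rw [q1, q2, q3, q4, q5, q6]
    field_simp; ring
  linear_combination 3 * fl m (2 * y / 3) * this

lemma cd2 (m : ℂ) {y : ℂ} (hy : NI (2 * y)) : cB m y (-2) = 3 * dB m y (-2) := by
  have h := fun b : ℤ => nz hy 1 b (by simp)
  have p1 := h 1; have p2 := h (-1); have p3 := h 3; have p4 := h (-3); have p5 := h 0
  simp only [Int.cast_one, Int.cast_neg, Int.cast_ofNat, Int.cast_zero, one_mul, add_zero] at p1 p2 p3 p4 p5
  unfold cB dB
  have : fp (3 * m) (y - -2 / 2) * fl m ((y + 3 * -2 / 2) / 3) * fb (3 * m + 2) (3 * m) (y + -2 / 2) =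
    fc (3 * m) (y + -2 / 2) * fl m ((3 * -2 / 2 - y) / 3) * fb m m ((y + 3 * -2 / 2) / 3) := by
    have q1 : fp (3 * m) (y - -2 / 2) = (y + 1 - (3 * m + 2)) * (y + 3 + 3 * m) * (y - (3 * m - 1)) /
        ((y + 1) * (y + 3) * (y)) := by
      unfold fp
      rw [show y - -2 / 2 = (y + 1) by ring, show (y + 1) + 2 = (y + 3) by ring,
        show (y + 1) - 1 = y by ring]
      field_simp
    have q2 : fl m ((y + 3 * -2 / 2) / 3) = (y - 3 - 3 * m) / (y + -3) := by
      unfold fl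
      rw [show (y + 3 * -2 / 2) / 3 = (y + -3) / 3 by ring]; field_simp; ring
    have q3 : fb (3 * m + 2) (3 * m) (y + -2 / 2) = (y - 1 - (3 * m + 2)) * (y - 3 * m) /
        ((y + -1) * (y)) := by
      unfold fb
      rw [show y + -2 / 2 = (y + -1) by ring, show (y + -1) + 1 = y by ring]
      field_simp; ring
    have q4 : fc (3 * m) (y + -2 / 2) = (y - 1 - (3 * m + 2)) * (y - (3 * m + 1)) * (y + 1 - 3 * m) /
        ((y + -1) * (y) * (y + 1)) := by
      unfold fc
      rw [show y + -2 / 2 = (y + -1) by ring, show (y + -1) + 2 = (y + 1) by ring,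
        show (y + -1) + 1 = y by ring]
      field_simp; ring
    have q5 : fl m ((3 * -2 / 2 - y) / 3) = (y + 3 + 3 * m) / (y + 3) := by
      unfold fl
      rw [show (3 * -2 / 2 - y) / 3 = -(y + 3) / 3 by ring]; field_simp; ring
    have q6 : fb m m ((y + 3 * -2 / 2) / 3) = (y - 3 - 3 * m) * (y - 3 * m) /
        ((y + -3) * (y)) := by
      unfold fb
      rw [show (y + 3 * -2 / 2) / 3 = (y + -3) / 3 by ring, show (y + -3) / 3 + 1 = (y) / 3 by ring]
      field_simp; ring
    rw [q1, q2, q3, q4, q5, q6]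
    field_simp; ring
  linear_combination 3 * fl m (2 * y / 3) * this
end

noncomputable section
open Complex

open Filter Topology

def Sm (F : ℂ → ℂ → ℂ) : Prop := Differentiable ℂ (fun v : ℂ × ℂ => F v.1 v.2)

lemma Sm.LB {F} (h : Sm F) (r : ℂ) : Differentiable ℂ (_root_.LB F r) := by
  have : _root_.LB F r = (fun v : ℂ × ℂ => F v.1 v.2) ∘ (fun t => (t, r + t / 2)) := rfl
  rw [this]
  exact h.comp (by fun_prop)
lemma Sm.LA {F} (h : Sm F) (r : ℂ) : Differentiable ℂ (_root_.LA F r) := by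
  have : _root_.LA F r = (fun v : ℂ × ℂ => F v.1 v.2) ∘ (fun t => (r, r / 2 + 3 * t / 2)) := rfl
  rw [this]
  exact h.comp (by fun_prop)
lemma Sm.comp' {F} (h : Sm F) {g k : ℂ → ℂ} (hg : Continuous g) (hk : Continuous k) :
    Continuous (fun y => F (g y) (k y)) := by
  have : (fun y => F (g y) (k y)) = (fun v : ℂ × ℂ => F v.1 v.2) ∘ (fun t => (g t, k t)) := rfl
  rw [this]
  exact h.continuous.comp (hg.prodMk hk)
lemma Sm.Rot {F} (h : Sm F) : Sm (_root_.Rot F) := by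
  unfold Sm
  have : (fun v : ℂ × ℂ => _root_.Rot F v.1 v.2) = (fun v : ℂ × ℂ => F v.1 v.2) ∘ (fun v => (v.2, v.2 - v.1)) := rfl
  rw [this]
  exact h.comp (by fun_prop)

def Den (p q : ℂ) : ℂ := D5 p * D5 (p - q) * D5 (-q) * D5 ((2 * q - p) / 3) * D5 ((p + q) / 3) * D5 ((2 * p - q) / 3)

def denB (y t : ℂ) : ℂ := D5 (t / 2 - y) * D5 (-(y + t / 2)) * D5 (2 * y / 3) * D5 ((y + 3 * t / 2) / 3) *
  D5 ((3 * t / 2 - y) / 3)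
def denA (y t : ℂ) : ℂ := D5 y * D5 ((y - 3 * t) / 2) * D5 (-((y + 3 * t) / 2)) * D5 ((y + t) / 2) *
  D5 ((y - t) / 2)

lemma Den_lineB (y t : ℂ) : Den t (y + t / 2) = D5 t * denB y t := by
  unfold Den denB; ring_nf
lemma Den_lineA (y t : ℂ) : Den y (y / 2 + 3 * t / 2) = D5 t * denA y t := by
  unfold Den denA; ring_nf

lemma denB_ne {y : ℂ} (hy : NI (2 * y)) (k : ℤ) : denB y k ≠ 0 := by
  unfold denB
  exact mul_ne_zero (mul_ne_zero (mul_ne_zero (mul_ne_zero (ni3 hy k).D5 (D5_neg_ne (ni1 hy k).D5))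
    (ni4 hy).D5) (ni5 hy k).D5) (ni6 hy k).D5
lemma denA_ne {y : ℂ} (hy : NI (2 * y)) (k : ℤ) : denA y k ≠ 0 := by
  unfold denA
  exact mul_ne_zero (mul_ne_zero (mul_ne_zero (mul_ne_zero (ni15 hy).D5 (ni10 hy k).D5) (D5_neg_ne (ni8 hy k).D5))
    (ni13 hy k).D5) (ni14 hy k).D5

lemma denB_cont (y : ℂ) : Continuous (denB y) := by unfold denB D5; fun_prop
lemma denA_cont (y : ℂ) : Continuous (denA y) := by unfold denA D5; fun_prop

lemma ev_ne (s a : ℂ) : ∀ᶠ t in 𝓝[≠] s, t ≠ a := by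
  by_cases h : s = a
  · rw [h]; exact self_mem_nhdsWithin
  · exact (eventually_ne_nhds h).filter_mono nhdsWithin_le_nhds

lemma ev_D5 (s : ℂ) : ∀ᶠ t in 𝓝[≠] s, D5 t ≠ 0 := by
  filter_upwards [ev_ne s 0, ev_ne s 1, ev_ne s (-1), ev_ne s 2, ev_ne s (-2)] with t h0 h1 h2 h3 h4
  have : D5 t = t * ((t - 1) * (t + 1)) * ((t - 2) * (t + 2)) := by unfold D5; ring
  rw [this]
  refine mul_ne_zero (mul_ne_zero h0 (mul_ne_zero (sub_ne_zero.2 h1) ?_)) (mul_ne_zero (sub_ne_zero.2 h3) ?_)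
  · intro h; exact h2 (eq_neg_of_add_eq_zero_left h)
  · intro h; exact h4 (eq_neg_of_add_eq_zero_left h)

lemma D5_nat (s : ℕ) (hs : 3 ≤ s) : D5 s ≠ 0 := by
  have h : ∀ k : ℤ, k < 3 → (s : ℂ) - k ≠ 0 := by
    intro k hk h
    have h2 : (s : ℂ) = k := sub_eq_zero.1 h
    have : (s : ℤ) = k := by exact_mod_cast h2
    omega
  have e : D5 s = (s - (0 : ℤ)) * ((s - (1 : ℤ)) * (s - (-1 : ℤ))) * ((s - (2 : ℤ)) * (s - (-2 : ℤ))) := by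
    unfold D5; push_cast; ring
  rw [e]
  exact mul_ne_zero (mul_ne_zero (h _ (by norm_num)) (mul_ne_zero (h _ (by norm_num)) (h _ (by norm_num))))
    (mul_ne_zero (h _ (by norm_num)) (h _ (by norm_num)))

lemma good_dense : Dense {y : ℂ | NI (2 * y)} := by
  have : {y : ℂ | NI (2 * y)} = (Set.range (fun k : ℤ => (k : ℂ) / 2))ᶜ := by
    ext y
    simp only [NI, Set.mem_ofPred_eq, Set.mem_compl_iff, Set.mem_range, not_exists]
    constructor
    · intro h k hk; exact h k (by rw [← hk]; ring)
    · intro h k hk; exact h k (by rw [← hk]; ring)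
  rw [this]
  exact (Set.countable_range _).dense_compl ℝ

lemma K1gen (h W : ℂ → ℂ) (s : ℂ) (hs : s = 1 ∨ s = 2) (hd : DifferentiableAt ℂ h s) (hW : HasDerivAt W 0 s)
    (ev : ∀ᶠ t in 𝓝[≠] s, D5 t * h t = W t) : h s = 0 := by
  have h5 : HasDerivAt D5 (5 * s ^ 4 - 15 * s ^ 2 + 4) s := by
    have : D5 = fun u => u ^ 5 - 5 * u ^ 3 + 4 * u := by funext u; unfold D5; ring
    rw [this]
    have := (((hasDerivAt_pow 5 s).sub ((hasDerivAt_pow 3 s).const_mul 5)).add ((hasDerivAt_id s).const_mul 4))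
    refine this.congr_deriv ?_
    push_cast; ring
  have h6 := h5.mul hd.hasDerivAt
  have ev2 : (D5 * h) =ᶠ[𝓝[≠] s] W := ev
  rw [ContinuousAt.eventuallyEq_nhds_iff_eventuallyEq_nhdsNE h6.continuousAt hW.continuousAt] at ev2
  have h7 := (h6.congr_of_eventuallyEq ev2.symm).unique hW
  rcases hs with rfl | rfl
  · simp only [D5] at h7
    linear_combination -h7 / 6
  · simp only [D5] at h7
    linear_combination h7 / 24

lemma K0gen (Nl d W : ℂ → ℂ) (s : ℂ) (hN : ContinuousAt Nl s) (hd : ContinuousAt d s) (hW : ContinuousAt W s)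
    (h0 : W s = 0) (ev : ∀ᶠ t in 𝓝[≠] s, Nl t = d t * W t) : Nl s = 0 := by
  have ev2 : Nl =ᶠ[𝓝[≠] s] (d * W) := ev
  rw [ContinuousAt.eventuallyEq_nhds_iff_eventuallyEq_nhdsNE hN (hd.mul hW)] at ev2
  rw [ev2.eq_of_nhds, Pi.mul_apply, h0, mul_zero]

lemma SB_LB {m : ℕ} {F} (h : QB m F) (r : ℂ) : Symm' (SB m) (LB F r) := by
  intro s hs
  have := h s hs r
  unfold LB
  rw [this]; ring_nf
lemma SA_LA {m : ℕ} {F} (h : QA m F) (r : ℂ) : Symm' (SA m) (LA F r) := by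
  intro s hs
  have := h s hs r
  unfold LA
  rw [this]; ring_nf

lemma castInt (s : ℂ) (h : s = 0 ∨ s = 1 ∨ s = 2) : ∃ k : ℤ, s = k := by
  rcases h with rfl | rfl | rfl
  · exact ⟨0, by simp⟩
  · exact ⟨1, by simp⟩
  · exact ⟨2, by simp⟩

section B
variable (m : ℕ) (hm : 1 ≤ m)

lemma WB_diff {y : ℂ} (hy : NI (2 * y)) {f0 f1 f1m f2 f2m : ℂ → ℂ} (h0 : Differentiable ℂ f0)
    (h1 : Differentiable ℂ f1) (h1m : Differentiable ℂ f1m) (h2 : Differentiable ℂ f2) (h2m : Differentiable ℂ f2m)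
    (M : ℂ) (k : ℤ) : DifferentiableAt ℂ (WB M y f0 f1 f1m f2 f2m) k := by
  have hk : (-(k : ℂ)) = ((-k : ℤ) : ℂ) := by push_cast; ring
  have a1 := aB_d M hy k
  have a2 := aB_d M hy (-k)
  have c1 := cB_d M hy k
  have c2 := cB_d M hy (-k)
  have d1 := dB_d M hy k
  have d2 := dB_d M hy (-k)
  have e1 := eB_d M hy k
  have c1' := cB_d M hy.neg2 k
  have c2' := cB_d M hy.neg2 (-k)
  have d1' := dB_d M hy.neg2 k
  have d2' := dB_d M hy.neg2 (-k)
  have e1' := eB_d M hy.neg2 k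
  rw [← hk] at a2 c2 d2 c2' d2'
  exact ((((WA_diff a1 a2 h0 _ _).add ((WC_diff c1 c2 h0 h1 _).add (WD_diff d1 d2 h0 h1 _))).add
    ((WC_diff c1' c2' h0 h1m _).add (WD_diff d1' d2' h0 h1m _))).add (WE_diff e1 h0 h2)).add (WE_diff e1' h0 h2m)

lemma WB_zero (hm : 1 ≤ m) {y : ℂ} (hy : NI (2 * y)) {f0 f1 f1m : ℂ → ℂ} (f2 f2m : ℂ → ℂ) (h0 : Symm' (SB m) f0)
    (h1 : Symm' (SB m) f1) (h1m : Symm' (SB m) f1m) (t0 : ℂ) (ht : t0 = 0 ∨ t0 = 1 ∨ t0 = 2) :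
    WB m y f0 f1 f1m f2 f2m t0 = 0 := by
  have s1 : SB m 1 := by unfold SB; omega
  have s2 : SB m 2 := by unfold SB; omega
  have s3 : SB m 3 := by unfold SB; omega
  unfold WB
  rw [WA_zero (SB m) _ _ _ f0 h0 s1 (Or.inl s2) t0 ht,
    WCD_zero (SB m) _ _ _ _ _ h1 s1 s2 s3 (cd1 _ hy) (cd2 _ hy) t0 ht,
    WCD_zero (SB m) _ _ _ _ _ h1m s1 s2 s3 (cd1 _ hy.neg2) (cd2 _ hy.neg2) t0 ht,
    WE_zero _ _ _ t0 ht, WE_zero _ _ _ t0 ht]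
  ring

lemma eB_even (M y t : ℂ) : eB M y (-t) = eB M y t := by
  unfold eB; ring_nf
lemma eA_even (M y t : ℂ) : eA M y (-t) = eA M y t := by
  unfold eA; ring_nf

lemma WB_odd (M y : ℂ) (f0 f1 f1m f2 f2m : ℂ → ℂ) (t : ℂ) :
    WB M y (odd' f0) (odd' f1) (odd' f1m) (odd' f2) (odd' f2m) t =
      WB M y f0 f1 f1m f2 f2m t + WB M y f0 f1 f1m f2 f2m (-t) := by
  unfold WB
  rw [WA_odd, WC_odd, WC_odd, WD_odd, WD_odd, WE_odd _ _ _ _ (eB_even _ _ _), WE_odd _ _ _ _ (eB_even _ _ _)]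
  ring

lemma WB_van (hm : 1 ≤ m) {y : ℂ} {f0 f1 f1m f2 f2m : ℂ → ℂ} (h0 : Van (SB m) f0)
    (h1 : Van (SB m) f1) (h1m : Van (SB m) f1m) (h2 : Van (SB m) f2) (h2m : Van (SB m) f2m)
    (s : ℕ) (hs : SB m s) (h3 : 3 ≤ s) :
    WB m y f0 f1 f1m f2 f2m s = 0 := by
  have hA := WA_van (SB m) (aB m y) (3 * m + 2) (3 * m) f0 h0 s hs h3 (by unfold SB at *; omega)
    (by unfold SB at *; omega)
  push_cast at hA
  unfold WB
  rw [hA, WC_van m hm _ _ _ h0 h1 s hs h3, WC_van m hm _ _ _ h0 h1m s hs h3,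
    WD_van m hm _ _ _ h0 h1 s hs h3, WD_van m hm _ _ _ h0 h1m s hs h3,
    WE_van _ _ _ _ h0 h2 s hs, WE_van _ _ _ _ h0 h2m s hs]
  ring

lemma WB_der (hm : 1 ≤ m) {y : ℂ} (hy : NI (2 * y)) {f0 f1 f1m f2 f2m : ℂ → ℂ} (h0 : Van (SB m) f0)
    (h1 : Van (SB m) f1) (h1m : Van (SB m) f1m) (h2 : Van (SB m) f2) (h2m : Van (SB m) f2m)
    (g0 : Differentiable ℂ f0)
    (g1 : Differentiable ℂ f1) (g1m : Differentiable ℂ f1m) (g2 : Differentiable ℂ f2) (g2m : Differentiable ℂ f2m)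
    (s : ℕ) (hs2 : s = 1 ∨ s = 2) :
    HasDerivAt (WB m y f0 f1 f1m f2 f2m) 0 s := by
  have s1 : SB m 1 := by unfold SB; omega
  have s2 : SB m 2 := by unfold SB; omega
  have s3 : SB m 3 := by unfold SB; omega
  have s5 : SB m 5 := by unfold SB; omega
  have s4 : (3 * m : ℂ) = 3 ∨ SB m 4 := by
    by_cases h : m = 1
    · left; rw [h]; norm_num
    · right; unfold SB; omega
  have hs : SB m s := by unfold SB; omega
  have k1 : ((1 : ℤ) : ℂ) = 1 := by simp
  have k2 : ((2 : ℤ) : ℂ) = 2 := by simp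
  have k3 : ((-1 : ℤ) : ℂ) = -1 := by simp
  have k4 : ((-2 : ℤ) : ℂ) = -2 := by simp
  have E1 := WE_der (SB m) _ _ _ h0 g0 h2 g2 s hs hs2 (eB_d m hy s)
  have E2 := WE_der (SB m) _ _ _ h0 g0 h2m g2m s hs hs2 (eB_d m hy.neg2 s)
  rcases hs2 with rfl | rfl
  · rw [Nat.cast_one] at *
    have := ((((WA_der1 (SB m) (aB m y) (3 * m + 2) (3 * m) f0 h0 g0 (k1 ▸ aB_d m hy 1) (k3 ▸ aB_d m hy (-1)) s1
      (Or.inr (Or.inr s3))).add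
      (WCD_der1 (SB m) (cB m y) (dB m y) (3 * m) f0 f1 h0 g0 h1 g1 (k1 ▸ cB_d m hy 1) (k3 ▸ cB_d m hy (-1))
        (k1 ▸ dB_d m hy 1) (k3 ▸ dB_d m hy (-1)) s1 s2 s4 (cd1 _ hy))).add
      (WCD_der1 (SB m) (cB m (-y)) (dB m (-y)) (3 * m) f0 f1m h0 g0 h1m g1m (k1 ▸ cB_d m hy.neg2 1) (k3 ▸ cB_d m hy.neg2 (-1))
        (k1 ▸ dB_d m hy.neg2 1) (k3 ▸ dB_d m hy.neg2 (-1)) s1 s2 s4 (cd1 _ hy.neg2))).add E1).add E2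
    simp only [add_zero] at this
    exact this
  · rw [Nat.cast_ofNat] at *
    have hh : (3 * m + 2 : ℂ) = 2 ∨ (3 * m : ℂ) = 3 ∨ SB m 4 := Or.inr s4
    have := ((((WA_der2 (SB m) (aB m y) (3 * m + 2) (3 * m) f0 h0 g0 (k2 ▸ aB_d m hy 2) (k4 ▸ aB_d m hy (-2)) s2
      hh).add
      (WCD_der2 (SB m) (cB m y) (dB m y) (3 * m) f0 f1 h0 g0 h1 g1 (k2 ▸ cB_d m hy 2) (k4 ▸ cB_d m hy (-2))
        (k2 ▸ dB_d m hy 2) (k4 ▸ dB_d m hy (-2)) s1 s2 s3 s5 (cd2 _ hy))).add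
      (WCD_der2 (SB m) (cB m (-y)) (dB m (-y)) (3 * m) f0 f1m h0 g0 h1m g1m (k2 ▸ cB_d m hy.neg2 2) (k4 ▸ cB_d m hy.neg2 (-2))
        (k2 ▸ dB_d m hy.neg2 2) (k4 ▸ dB_d m hy.neg2 (-2)) s1 s2 s3 s5 (cd2 _ hy.neg2))).add E1).add E2
    simp only [add_zero] at this
    exact this
end B

lemma K0B (m : ℕ) (hm : 1 ≤ m) (F N : ℂ → ℂ → ℂ) (hF : Sm F) (hN : Sm N) (hQ : QB m F)
    (h : ∀ p q, Den p q ≠ 0 → N p q = Den p q * DD m F p q) (t0 : ℂ) (ht : t0 = 0 ∨ t0 = 1 ∨ t0 = 2) (q : ℂ) :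
    N t0 q = 0 := by
  obtain ⟨k, hk⟩ := castInt t0 ht
  have key : ∀ y, NI (2 * y) → LB N y t0 = 0 := by
    intro y hy
    have hd : denB y t0 ≠ 0 := by rw [hk]; exact denB_ne hy k
    refine K0gen (LB N y) (denB y) (WB m y (LB F y) (LB F (y + 3 / 2)) (LB F (y - 3 / 2)) (LB F (y + 3)) (LB F (y - 3))) t0
      (hN.LB y).continuous.continuousAt (denB_cont y).continuousAt ?_ ?_ ?_
    · rw [hk]
      exact (WB_diff hy (hF.LB _) (hF.LB _) (hF.LB _) (hF.LB _) (hF.LB _) m k).continuousAt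
    · exact WB_zero m hm hy _ _ (SB_LB hQ _) (SB_LB hQ _) (SB_LB hQ _) t0 ht
    · filter_upwards [ev_D5 t0, ((denB_cont y).continuousAt.eventually_ne hd).filter_mono nhdsWithin_le_nhds] with t h1 h2
      rw [← lineB m F y t h1, LB, h _ _ (by rw [Den_lineB]; exact mul_ne_zero h1 h2), Den_lineB]
      ring
  have hc : Continuous (fun y => LB N y t0) := hN.comp' (g := fun _ => t0) (k := fun y => y + t0 / 2) (by fun_prop) (by fun_prop)
  have := congrFun (Continuous.ext_on good_dense hc continuous_const (fun y hy => key y hy)) (q - t0 / 2)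
  simpa [LB] using this

lemma K1B (m : ℕ) (hm : 1 ≤ m) (F H : ℂ → ℂ → ℂ) (hF : Sm F) (hH : Sm H) (hQ : QB m F)
    (h : ∀ p q, Den p q ≠ 0 → H p q = DD m F p q) : QB m H := by
  intro s hs
  have key : ∀ y, NI (2 * y) → odd' (LB H y) s = 0 := by
    intro y hy
    set W := WB m y (odd' (LB F y)) (odd' (LB F (y + 3 / 2))) (odd' (LB F (y - 3 / 2))) (odd' (LB F (y + 3)))
      (odd' (LB F (y - 3))) with hW
    have rel : ∀ t, D5 t ≠ 0 → denB y t ≠ 0 → denB y (-t) ≠ 0 → D5 t * odd' (LB H y) t = W t := by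
      intro t h1 h2 h3
      have h1' := D5_neg_ne h1
      rw [hW, WB_odd, ← lineB m F y t h1, ← lineB m F y (-t) h1', odd', LB, LB,
        h _ _ (by rw [Den_lineB]; exact mul_ne_zero h1 h2),
        h _ _ (by rw [Den_lineB]; exact mul_ne_zero h1' h3), D5_neg]
      ring
    have hd1 : denB y s ≠ 0 := by exact_mod_cast denB_ne hy s
    have hd2 : denB y (-s) ≠ 0 := by exact_mod_cast denB_ne hy (-s)
    have v := fun r => (SB_LB hQ r).van
    have dd := fun r => odd_diff (hF.LB r)
    by_cases h3 : 3 ≤ s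
    · have := rel s (D5_nat s h3) hd1 hd2
      rw [hW, WB_van m hm (v _) (v _) (v _) (v _) (v _) s hs h3] at this
      exact (mul_eq_zero.1 this).resolve_left (D5_nat s h3)
    · have hs2 : s = 1 ∨ s = 2 := by unfold SB at hs; omega
      refine K1gen _ W s ?_ ((odd_diff (hH.LB y)) s)
        (WB_der m hm hy (v _) (v _) (v _) (v _) (v _) (dd _) (dd _) (dd _) (dd _) (dd _) s hs2) ?_
      · rcases hs2 with rfl | rfl <;> simp
      · filter_upwards [ev_D5 s, ((denB_cont y).continuousAt.eventually_ne hd1).filter_mono nhdsWithin_le_nhds,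
          (((denB_cont y).comp continuous_neg).continuousAt.eventually_ne hd2).filter_mono nhdsWithin_le_nhds] with t h1 h2 h3
        exact rel t h1 h2 h3
  have hc : Continuous (fun y => odd' (LB H y) s) := by
    unfold odd'
    exact (hH.comp' (g := fun _ => (s : ℂ)) (k := fun y => y + s / 2) (by fun_prop) (by fun_prop)).sub
      (hH.comp' (g := fun _ => -(s : ℂ)) (k := fun y => y + -s / 2) (by fun_prop) (by fun_prop))
  intro y
  have := congrFun (Continuous.ext_on good_dense hc continuous_const (fun y hy => key y hy)) y
  simp only [odd', LB] at this
  rw [sub_eq_zero.1 this]; ring_nf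
end

noncomputable section
open Complex
open Filter Topology

lemma WAl_diff {y : ℂ} (hy : NI (2 * y)) {f0 f1 f1m f3 f3m f2 f2m : ℂ → ℂ} (h0 : Differentiable ℂ f0)
    (h1 : Differentiable ℂ f1) (h1m : Differentiable ℂ f1m) (h3 : Differentiable ℂ f3) (h3m : Differentiable ℂ f3m)
    (h2 : Differentiable ℂ f2) (h2m : Differentiable ℂ f2m)
    (M : ℂ) (k : ℤ) : DifferentiableAt ℂ (WAl M y f0 f1 f1m f3 f3m f2 f2m) k := by
  have hk : (-(k : ℂ)) = ((-k : ℤ) : ℂ) := by push_cast; ring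
  have a1 := aA_d M hy k
  have a2 := aA_d M hy (-k)
  have c1 := cA_d M hy k
  have c2 := cA_d M hy (-k)
  have d1 := dA_d M hy k
  have d2 := dA_d M hy (-k)
  have e1 := eA_d M hy k
  have c1' := cA_d M hy.neg2 k
  have c2' := cA_d M hy.neg2 (-k)
  have d1' := dA_d M hy.neg2 k
  have d2' := dA_d M hy.neg2 (-k)
  have e1' := eA_d M hy.neg2 k
  rw [← hk] at a2 c2 d2 c2' d2'
  exact ((((((WA_diff a1 a2 h0 _ _).add (WL_diff c1 c2 h0 h1 _)).add (WL_diff c1' c2' h0 h1m _)).add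
    (WL_diff d1 d2 h0 h3 _)).add (WL_diff d1' d2' h0 h3m _)).add (WE_diff e1 h0 h2)).add (WE_diff e1' h0 h2m)

lemma WAl_zero (m : ℕ) (hm : 1 ≤ m) {y : ℂ} {f0 f1 f1m f3 f3m : ℂ → ℂ} (f2 f2m : ℂ → ℂ) (h0 : Symm' (SA m) f0)
    (h1 : Symm' (SA m) f1) (h1m : Symm' (SA m) f1m) (h3 : Symm' (SA m) f3) (h3m : Symm' (SA m) f3m)
    (t0 : ℂ) (ht : t0 = 0 ∨ t0 = 1 ∨ t0 = 2) :
    WAl m y f0 f1 f1m f3 f3m f2 f2m t0 = 0 := by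
  have s1 : SA m 1 := by unfold SA; omega
  have s2 : SA m 2 ∨ (m : ℂ) = 1 := by
    by_cases h : m = 1
    · right; rw [h]; norm_num
    · left; unfold SA; omega
  unfold WAl
  rw [WA_zero (SA m) _ _ _ f0 h0 s1 s2 t0 ht, WL_zero (SA m) _ _ _ _ h1 s1 t0 ht,
    WL_zero (SA m) _ _ _ _ h1m s1 t0 ht, WL_zero (SA m) _ _ _ _ h3 s1 t0 ht,
    WL_zero (SA m) _ _ _ _ h3m s1 t0 ht, WE_zero _ _ _ t0 ht, WE_zero _ _ _ t0 ht]
  ring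

lemma WAl_odd (M y : ℂ) (f0 f1 f1m f3 f3m f2 f2m : ℂ → ℂ) (t : ℂ) :
    WAl M y (odd' f0) (odd' f1) (odd' f1m) (odd' f3) (odd' f3m) (odd' f2) (odd' f2m) t =
      WAl M y f0 f1 f1m f3 f3m f2 f2m t + WAl M y f0 f1 f1m f3 f3m f2 f2m (-t) := by
  unfold WAl
  rw [WA_odd, WL_odd, WL_odd, WL_odd, WL_odd, WE_odd _ _ _ _ (eA_even _ _ _), WE_odd _ _ _ _ (eA_even _ _ _)]
  ring

lemma WAl_van (m : ℕ) {y : ℂ} {f0 f1 f1m f3 f3m f2 f2m : ℂ → ℂ} (h0 : Van (SA m) f0)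
    (h1 : Van (SA m) f1) (h1m : Van (SA m) f1m) (h3 : Van (SA m) f3) (h3m : Van (SA m) f3m)
    (h2 : Van (SA m) f2) (h2m : Van (SA m) f2m)
    (s : ℕ) (hs : SA m s) (h3' : 3 ≤ s) :
    WAl m y f0 f1 f1m f3 f3m f2 f2m s = 0 := by
  have p1 : s = m ∨ s + 1 = m ∨ SA m (s + 2) := by unfold SA at *; omega
  have p2 : SA m (s - 2) := by unfold SA at *; omega
  have p3 : s = m ∨ SA m (s + 1) := by unfold SA at *; omega
  have p4 : SA m (s - 1) := by unfold SA at *; omega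
  unfold WAl
  rw [WA_van (SA m) _ m m f0 h0 s hs h3' p1 p2, WL_van (SA m) _ m _ _ h0 h1 s hs h3' p3 p4,
    WL_van (SA m) _ m _ _ h0 h1m s hs h3' p3 p4, WL_van (SA m) _ m _ _ h0 h3 s hs h3' p3 p4,
    WL_van (SA m) _ m _ _ h0 h3m s hs h3' p3 p4,
    WE_van _ _ _ _ h0 h2 s hs, WE_van _ _ _ _ h0 h2m s hs]
  ring

lemma WAl_der (m : ℕ) {y : ℂ} (hy : NI (2 * y)) {f0 f1 f1m f3 f3m f2 f2m : ℂ → ℂ} (h0 : Van (SA m) f0)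
    (h1 : Van (SA m) f1) (h1m : Van (SA m) f1m) (h3 : Van (SA m) f3) (h3m : Van (SA m) f3m)
    (h2 : Van (SA m) f2) (h2m : Van (SA m) f2m)
    (g0 : Differentiable ℂ f0)
    (g1 : Differentiable ℂ f1) (g1m : Differentiable ℂ f1m) (g3 : Differentiable ℂ f3) (g3m : Differentiable ℂ f3m)
    (g2 : Differentiable ℂ f2) (g2m : Differentiable ℂ f2m)
    (s : ℕ) (hs : SA m s) (hs2 : s = 1 ∨ s = 2) :
    HasDerivAt (WAl m y f0 f1 f1m f3 f3m f2 f2m) 0 s := by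
  have cs : ∀ j : ℕ, 1 ≤ j → (∃ i < j, 1 ≤ i ∧ m = i) ∨ SA m j := by
    intro j hj
    by_cases h : m < j
    · left; refine ⟨m, h, ?_, rfl⟩; unfold SA at hs; omega
    · right; unfold SA; omega
  have s1 : SA m 1 := by unfold SA at *; omega
  have k1 : ((1 : ℤ) : ℂ) = 1 := by simp
  have k2 : ((2 : ℤ) : ℂ) = 2 := by simp
  have k3 : ((-1 : ℤ) : ℂ) = -1 := by simp
  have k4 : ((-2 : ℤ) : ℂ) = -2 := by simp
  have E1 := WE_der (SA m) _ _ _ h0 g0 h2 g2 s hs hs2 (eA_d m hy s)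
  have E2 := WE_der (SA m) _ _ _ h0 g0 h2m g2m s hs hs2 (eA_d m hy.neg2 s)
  rcases hs2 with rfl | rfl
  · rw [Nat.cast_one] at *
    have c1 : (m : ℂ) = 1 ∨ SA m 2 := by
      by_cases h : m = 1
      · left; rw [h]; norm_num
      · right; unfold SA at *; omega
    have c2 : (m : ℂ) = 1 ∨ (m : ℂ) = 2 ∨ SA m 3 := by
      by_cases h : m = 1
      · left; rw [h]; norm_num
      · by_cases h2 : m = 2
        · right; left; rw [h2]; norm_num
        · right; right; unfold SA at *; omega
    have := ((((((WA_der1 (SA m) (aA m y) m m f0 h0 g0 (k1 ▸ aA_d m hy 1) (k3 ▸ aA_d m hy (-1)) s1 c2).add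
      (WL_der1 (SA m) (cA m y) m f0 f1 h0 g0 h1 g1 (k1 ▸ cA_d m hy 1) (k3 ▸ cA_d m hy (-1)) s1 c1)).add
      (WL_der1 (SA m) (cA m (-y)) m f0 f1m h0 g0 h1m g1m (k1 ▸ cA_d m hy.neg2 1) (k3 ▸ cA_d m hy.neg2 (-1)) s1 c1)).add
      (WL_der1 (SA m) (dA m y) m f0 f3 h0 g0 h3 g3 (k1 ▸ dA_d m hy 1) (k3 ▸ dA_d m hy (-1)) s1 c1)).add
      (WL_der1 (SA m) (dA m (-y)) m f0 f3m h0 g0 h3m g3m (k1 ▸ dA_d m hy.neg2 1) (k3 ▸ dA_d m hy.neg2 (-1)) s1 c1)).add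
      E1).add E2
    simp only [add_zero] at this
    exact this
  · rw [Nat.cast_ofNat] at *
    have c1 : (m : ℂ) = 2 ∨ SA m 3 := by
      by_cases h : m = 2
      · left; rw [h]; norm_num
      · right; unfold SA at *; omega
    have c2 : (m : ℂ) = 2 ∨ (m : ℂ) = 3 ∨ SA m 4 := by
      by_cases h : m = 2
      · left; rw [h]; norm_num
      · by_cases h2 : m = 3
        · right; left; rw [h2]; norm_num
        · right; right; unfold SA at *; omega
    have := ((((((WA_der2 (SA m) (aA m y) m m f0 h0 g0 (k2 ▸ aA_d m hy 2) (k4 ▸ aA_d m hy (-2)) hs c2).add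
      (WL_der2 (SA m) (cA m y) m f0 f1 h0 g0 h1 g1 (k2 ▸ cA_d m hy 2) (k4 ▸ cA_d m hy (-2)) s1 hs c1)).add
      (WL_der2 (SA m) (cA m (-y)) m f0 f1m h0 g0 h1m g1m (k2 ▸ cA_d m hy.neg2 2) (k4 ▸ cA_d m hy.neg2 (-2)) s1 hs c1)).add
      (WL_der2 (SA m) (dA m y) m f0 f3 h0 g0 h3 g3 (k2 ▸ dA_d m hy 2) (k4 ▸ dA_d m hy (-2)) s1 hs c1)).add
      (WL_der2 (SA m) (dA m (-y)) m f0 f3m h0 g0 h3m g3m (k2 ▸ dA_d m hy.neg2 2) (k4 ▸ dA_d m hy.neg2 (-2)) s1 hs c1)).add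
      E1).add E2
    simp only [add_zero] at this
    exact this

lemma K0A (m : ℕ) (hm : 1 ≤ m) (F N : ℂ → ℂ → ℂ) (hF : Sm F) (hN : Sm N) (hQ : QA m F)
    (h : ∀ p q, Den p q ≠ 0 → N p q = Den p q * DD m F p q) (t0 : ℂ) (ht : t0 = 0 ∨ t0 = 1 ∨ t0 = 2) (y : ℂ) :
    N y (y / 2 + 3 * t0 / 2) = 0 := by
  obtain ⟨k, hk⟩ := castInt t0 ht
  have key : ∀ y, NI (2 * y) → LA N y t0 = 0 := by
    intro y hy
    have hd : denA y t0 ≠ 0 := by rw [hk]; exact denA_ne hy k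
    refine K0gen (LA N y) (denA y) (WAl m y (LA F y) (LA F (y + 1)) (LA F (y - 1)) (LA F (y + 3)) (LA F (y - 3))
      (LA F (y + 2)) (LA F (y - 2))) t0
      (hN.LA y).continuous.continuousAt (denA_cont y).continuousAt ?_ ?_ ?_
    · rw [hk]
      exact (WAl_diff hy (hF.LA _) (hF.LA _) (hF.LA _) (hF.LA _) (hF.LA _) (hF.LA _) (hF.LA _) m k).continuousAt
    · exact WAl_zero m hm _ _ (SA_LA hQ _) (SA_LA hQ _) (SA_LA hQ _) (SA_LA hQ _) (SA_LA hQ _) t0 ht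
    · filter_upwards [ev_D5 t0, ((denA_cont y).continuousAt.eventually_ne hd).filter_mono nhdsWithin_le_nhds] with t h1 h2
      rw [← lineA m F y t h1, LA, h _ _ (by rw [Den_lineA]; exact mul_ne_zero h1 h2), Den_lineA]
      ring
  have hc : Continuous (fun y => LA N y t0) := hN.comp' (g := fun y => y) (k := fun y => y / 2 + 3 * t0 / 2) (by fun_prop) (by fun_prop)
  exact congrFun (Continuous.ext_on good_dense hc continuous_const (fun y hy => key y hy)) y

lemma K1A (m : ℕ) (F H : ℂ → ℂ → ℂ) (hF : Sm F) (hH : Sm H) (hQ : QA m F)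
    (h : ∀ p q, Den p q ≠ 0 → H p q = DD m F p q) : QA m H := by
  intro s hs
  have key : ∀ y, NI (2 * y) → odd' (LA H y) s = 0 := by
    intro y hy
    set W := WAl m y (odd' (LA F y)) (odd' (LA F (y + 1))) (odd' (LA F (y - 1))) (odd' (LA F (y + 3)))
      (odd' (LA F (y - 3))) (odd' (LA F (y + 2))) (odd' (LA F (y - 2))) with hW
    have rel : ∀ t, D5 t ≠ 0 → denA y t ≠ 0 → denA y (-t) ≠ 0 → D5 t * odd' (LA H y) t = W t := by
      intro t h1 h2 h3
      have h1' := D5_neg_ne h1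
      rw [hW, WAl_odd, ← lineA m F y t h1, ← lineA m F y (-t) h1', odd', LA, LA,
        h _ _ (by rw [Den_lineA]; exact mul_ne_zero h1 h2),
        h _ _ (by rw [Den_lineA]; exact mul_ne_zero h1' h3), D5_neg]
      ring
    have hd1 : denA y s ≠ 0 := by exact_mod_cast denA_ne hy s
    have hd2 : denA y (-s) ≠ 0 := by exact_mod_cast denA_ne hy (-s)
    have v := fun r => (SA_LA hQ r).van
    have dd := fun r => odd_diff (hF.LA r)
    by_cases h3 : 3 ≤ s
    · have := rel s (D5_nat s h3) hd1 hd2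
      rw [hW, WAl_van m (v _) (v _) (v _) (v _) (v _) (v _) (v _) s hs h3] at this
      exact (mul_eq_zero.1 this).resolve_left (D5_nat s h3)
    · have hs2 : s = 1 ∨ s = 2 := by unfold SA at hs; omega
      refine K1gen _ W s ?_ ((odd_diff (hH.LA y)) s)
        (WAl_der m hy (v _) (v _) (v _) (v _) (v _) (v _) (v _) (dd _) (dd _) (dd _) (dd _) (dd _) (dd _) (dd _) s hs hs2) ?_
      · rcases hs2 with rfl | rfl <;> simp
      · filter_upwards [ev_D5 s, ((denA_cont y).continuousAt.eventually_ne hd1).filter_mono nhdsWithin_le_nhds,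
          (((denA_cont y).comp continuous_neg).continuousAt.eventually_ne hd2).filter_mono nhdsWithin_le_nhds] with t h1 h2 h3
        exact rel t h1 h2 h3
  have hc : Continuous (fun y => odd' (LA H y) s) := by
    unfold odd'
    exact (hH.comp' (g := fun y => y) (k := fun y => y / 2 + 3 * s / 2) (by fun_prop) (by fun_prop)).sub
      (hH.comp' (g := fun y => y) (k := fun y => y / 2 + 3 * -s / 2) (by fun_prop) (by fun_prop))
  intro y
  have := congrFun (Continuous.ext_on good_dense hc continuous_const (fun y hy => key y hy)) y
  simp only [odd', LA] at this
  rw [sub_eq_zero.1 this]; ring_nf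

/-! ### Equivariance -/

lemma DD_Rot (m : ℂ) (F : ℂ → ℂ → ℂ) (p q : ℂ) : DD m (Rot F) p q = DD m F q (q - p) := by
  simp only [DD, Rot]
  ring_nf

lemma Den_Rot (p q : ℂ) : Den q (q - p) = Den p q := by
  unfold Den
  rw [show q - (q - p) = p by ring, show -(q - p) = p - q by ring,
    show (2 * (q - p) - q) / 3 = -((2 * p - q) / 3) by ring, show (q + (q - p)) / 3 = (2 * q - p) / 3 by ring,
    show (2 * q - (q - p)) / 3 = (p + q) / 3 by ring, D5_neg, D5_neg]
  ring

lemma Sm.iter {F} (h : Sm F) (k : ℕ) : Sm (_root_.Rot^[k] F) := by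
  induction k with
  | zero => exact h
  | succ k ih => rw [Function.iterate_succ_apply']; exact ih.Rot

lemma rel_iter {m : ℂ} {F N : ℂ → ℂ → ℂ} (h : ∀ p q, Den p q ≠ 0 → N p q = Den p q * DD m F p q) (k : ℕ) :
    ∀ p q, Den p q ≠ 0 → (Rot^[k] N) p q = Den p q * DD m (Rot^[k] F) p q := by
  induction k with
  | zero => exact h
  | succ k ih =>
    intro p q hd
    rw [Function.iterate_succ_apply', Function.iterate_succ_apply', DD_Rot, Rot,
      ih _ _ (by rw [Den_Rot]; exact hd), Den_Rot]

lemma rel_iter' {m : ℂ} {F H : ℂ → ℂ → ℂ} (h : ∀ p q, Den p q ≠ 0 → H p q = DD m F p q) (k : ℕ) :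
    ∀ p q, Den p q ≠ 0 → (Rot^[k] H) p q = DD m (Rot^[k] F) p q := by
  induction k with
  | zero => exact h
  | succ k ih =>
    intro p q hd
    rw [Function.iterate_succ_apply', Function.iterate_succ_apply', DD_Rot, Rot,
      ih _ _ (by rw [Den_Rot]; exact hd)]

lemma K1all (m : ℕ) (hm : 1 ≤ m) (F H : ℂ → ℂ → ℂ) (hF : Sm F) (hH : Sm H) (hQ : QQ m F)
    (h : ∀ p q, Den p q ≠ 0 → H p q = DD m F p q) : QQ m H := fun k =>
  ⟨K1B m hm _ _ (hF.iter k) (hH.iter k) (hQ k).1 (rel_iter' h k),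
    K1A m _ _ (hF.iter k) (hH.iter k) (hQ k).2 (rel_iter' h k)⟩

lemma K0all (m : ℕ) (hm : 1 ≤ m) (F N : ℂ → ℂ → ℂ) (hF : Sm F) (hN : Sm N) (hQ : QQ m F)
    (h : ∀ p q, Den p q ≠ 0 → N p q = Den p q * DD m F p q) (i : Fin 6) (c : ℤ) (hc : c ∈ Finset.Icc (-2 : ℤ) 2)
    (p q : ℂ) (hpq : la i * p + lb i * q = c) : N p q = 0 := by
  have kb := fun k t0 ht q => K0B m hm _ _ (hF.iter k) (hN.iter k) (hQ k).1 (rel_iter h k) t0 ht q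
  have ka := fun k t0 ht q => K0A m hm _ _ (hF.iter k) (hN.iter k) (hQ k).2 (rel_iter h k) t0 ht q
  have hc' : ((c : ℂ) = 0 ∨ (c : ℂ) = 1 ∨ (c : ℂ) = 2) ∨ (-(c : ℂ) = 0 ∨ -(c : ℂ) = 1 ∨ -(c : ℂ) = 2) := by
    rw [Finset.mem_Icc] at hc
    have : c = 0 ∨ c = 1 ∨ c = 2 ∨ c = -1 ∨ c = -2 := by omega
    rcases this with rfl | rfl | rfl | rfl | rfl <;> simp
  have b0 := fun t0 ht q => kb 0 t0 ht q
  have b1 := fun t0 ht q => kb 1 t0 ht q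
  have b2 := fun t0 ht q => kb 2 t0 ht q
  have b3 := fun t0 ht q => kb 3 t0 ht q
  have b4 := fun t0 ht q => kb 4 t0 ht q
  have b5 := fun t0 ht q => kb 5 t0 ht q
  have a0 := fun t0 ht q => ka 0 t0 ht q
  have a1 := fun t0 ht q => ka 1 t0 ht q
  have a2 := fun t0 ht q => ka 2 t0 ht q
  have a3 := fun t0 ht q => ka 3 t0 ht q
  have a4 := fun t0 ht q => ka 4 t0 ht q
  have a5 := fun t0 ht q => ka 5 t0 ht q
  clear ka kb
  simp only [Function.iterate_succ, Function.iterate_zero, Function.comp, id, Rot] at b0 b1 b2 b3 b4 b5 a0 a1 a2 a3 a4 a5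
  generalize (c : ℂ) = d at hpq hc'
  fin_cases i <;> simp [la, lb] at hpq <;> subst hpq <;> rcases hc' with hc' | hc'
  · convert b0 _ hc' q using 2 <;> ring
  · convert b3 _ hc' (-q) using 2 <;> ring
  · convert b1 _ hc' p using 2 <;> ring
  · convert b4 _ hc' (-p) using 2 <;> ring
  · convert b2 _ hc' (p + -q) using 2 <;> ring
  · convert b5 _ hc' (-p + q) using 2 <;> ring
  · convert a0 _ hc' p using 2 <;> ring
  · convert a3 _ hc' (-p) using 2 <;> ring
  · convert a1 _ hc' (p - q) using 2 <;> ring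
  · convert a4 _ hc' (q - p) using 2 <;> ring
  · convert a2 _ hc' (-q) using 2 <;> ring
  · convert a5 _ hc' q using 2 <;> ring
end

noncomputable section
open Complex
open Filter Topology

/-! ### The polynomial argument -/

/-- product of five linear factors -/
def V (c1 c2 c3 c4 c5 : ℂ) (u : MP) : MP :=
  (u + MvPolynomial.C (-c1)) * (u + MvPolynomial.C (-c2)) * (u + MvPolynomial.C (-c3)) * (u + MvPolynomial.C (-c4)) *
    (u + MvPolynomial.C (-c5))

lemma eval_V (c1 c2 c3 c4 c5 : ℂ) (u : MP) (v : Fin 2 → ℂ) : MvPolynomial.eval v (V c1 c2 c3 c4 c5 u) =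
    (MvPolynomial.eval v u - c1) * (MvPolynomial.eval v u - c2) * (MvPolynomial.eval v u - c3) *
    (MvPolynomial.eval v u - c4) * (MvPolynomial.eval v u - c5) := by
  simp only [V, map_mul, map_add, MvPolynomial.eval_C]; ring

lemma V_top (c1 c2 c3 c4 c5 a b : ℂ) : Eq' (V c1 c2 c3 c4 c5 (lin a b))
    (lin a b * lin a b * lin a b * lin a b * lin a b) 5 :=
  ((((Eq'.linC a b _).mul (Eq'.linC a b _)).mul (Eq'.linC a b _)).mul (Eq'.linC a b _)).mul (Eq'.linC a b _)

lemma V_V (c1 c2 c3 c4 c5 d1 d2 d3 d4 d5 a b : ℂ) :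
    Eq' (V c1 c2 c3 c4 c5 (lin a b)) (V d1 d2 d3 d4 d5 (lin a b)) 5 :=
  (V_top _ _ _ _ _ a b).trans_symm (V_top _ _ _ _ _ a b)

lemma Eq'.Cmul {f g : MP} {k : ℕ} (c : ℂ) (h : Eq' f g k) : Eq' (MvPolynomial.C c * f) (MvPolynomial.C c * g) k :=
  ⟨h.1.Cmul c, h.2.1.Cmul c, by rw [← mul_sub]; exact h.2.2.Cmul c⟩

def V0 (a b : ℂ) : MP := V 0 1 (-1) 2 (-2) (lin a b)

lemma eval_V0 (a b : ℂ) (v : Fin 2 → ℂ) : MvPolynomial.eval v (V0 a b) = D5 (a * v 0 + b * v 1) := by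
  rw [V0, eval_V, eval_lin, D5]; ring

def DenP (a b c d : ℂ) : MP := V0 a b * V0 (a - c) (b - d) * V0 (-c) (-d) * V0 ((2 * c - a) / 3) ((2 * d - b) / 3) *
  V0 ((a + c) / 3) ((b + d) / 3) * V0 ((2 * a - c) / 3) ((2 * b - d) / 3)

lemma eval_DenP (a b c d : ℂ) (v : Fin 2 → ℂ) :
    MvPolynomial.eval v (DenP a b c d) = Den (a * v 0 + b * v 1) (c * v 0 + d * v 1) := by
  simp only [DenP, map_mul, eval_V0, Den]
  congr 1
  · congr 1
    · congr 1
      · congr 1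
        · congr 1
          ring_nf
        · ring_nf
      · ring_nf
    · ring_nf
  · ring_nf

def nS (m a b c d : ℂ) : MP := MvPolynomial.C 3 * (V (3 * m + 2) (3 * m - 1) 1 2 (-2) (lin a b) *
  V (3 * m + 2) (-2 - 3 * m) (3 * m) (-1) 2 (lin (a - c) (b - d)) *
  V (-(3 * m + 2)) (2 + 3 * m) (-(3 * m)) 1 (-2) (lin (-c) (-d)) *
  V0 ((2 * c - a) / 3) ((2 * d - b) / 3) *
  V m 1 (-1) 2 (-2) (lin ((a + c) / 3) ((b + d) / 3)) * V m 1 (-1) 2 (-2) (lin ((2 * a - c) / 3) ((2 * b - d) / 3)))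

def nL (m a b c d : ℂ) : MP := MvPolynomial.C 1 * (V0 a b *
  V (-(3 * m + 2)) (-(3 * m)) (2 - 3 * m) (-1) (-2) (lin (a - c) (b - d)) *
  V (-(3 * m + 2)) (-(3 * m)) (2 - 3 * m) (-1) (-2) (lin (-c) (-d)) *
  V m (m - 1) 1 2 (-2) (lin ((2 * c - a) / 3) ((2 * d - b) / 3)) *
  V m 1 (-1) 2 (-2) (lin ((a + c) / 3) ((b + d) / 3)) *
  V (-m) 1 (-1) 2 (-2) (lin ((2 * a - c) / 3) ((2 * b - d) / 3)))

lemma nS_top (m a b c d : ℂ) : Eq' (nS m a b c d) (MvPolynomial.C 3 * DenP a b c d) 30 :=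
  Eq'.Cmul 3 ((((((V_V _ _ _ _ _ _ _ _ _ _ _ _).mul (V_V _ _ _ _ _ _ _ _ _ _ _ _)).mul (V_V _ _ _ _ _ _ _ _ _ _ _ _)).mul
    (V_V _ _ _ _ _ _ _ _ _ _ _ _)).mul (V_V _ _ _ _ _ _ _ _ _ _ _ _)).mul (V_V _ _ _ _ _ _ _ _ _ _ _ _))

lemma nL_top (m a b c d : ℂ) : Eq' (nL m a b c d) (MvPolynomial.C 1 * DenP a b c d) 30 :=
  Eq'.Cmul 1 ((((((V_V _ _ _ _ _ _ _ _ _ _ _ _).mul (V_V _ _ _ _ _ _ _ _ _ _ _ _)).mul (V_V _ _ _ _ _ _ _ _ _ _ _ _)).mul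
    (V_V _ _ _ _ _ _ _ _ _ _ _ _)).mul (V_V _ _ _ _ _ _ _ _ _ _ _ _)).mul (V_V _ _ _ _ _ _ _ _ _ _ _ _))

lemma Den_ne {p q : ℂ} (h : Den p q ≠ 0) : D5 p ≠ 0 ∧ D5 (p - q) ≠ 0 ∧ D5 (-q) ≠ 0 ∧ D5 ((2 * q - p) / 3) ≠ 0 ∧
    D5 ((p + q) / 3) ≠ 0 ∧ D5 ((2 * p - q) / 3) ≠ 0 := by
  unfold Den at h
  simp only [mul_ne_zero_iff] at h
  tauto

lemma eval_nS (m a b c d : ℂ) (v : Fin 2 → ℂ) (p q : ℂ) (hp : p = a * v 0 + b * v 1) (hq : q = c * v 0 + d * v 1)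
    (h : Den p q ≠ 0) :
    MvPolynomial.eval v (nS m a b c d) = Den p q * AS m p q := by
  obtain ⟨h1, h2, h3, h4, h5, h6⟩ := Den_ne h
  have h3' : D5 q ≠ 0 := by have := D5_neg_ne h3; rwa [neg_neg] at this
  have e : Den p q * AS m p q = 3 * ((D5 p * fb (3 * m + 2) (3 * m) p) * (D5 (p - q) * fp (3 * m) (p - q)) *
      (-(D5 q * fp (3 * m) q)) * D5 ((2 * q - p) / 3) * (D5 ((p + q) / 3) * fl m ((p + q) / 3)) *
      (D5 ((2 * p - q) / 3) * fl m ((2 * p - q) / 3))) := by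
    rw [Den, AS, D5_neg]; ring
  rw [e, ← gb_eq _ _ h1, ← gp_eq _ h2, ← gp_eq _ h3', ← gl_eq _ h5, ← gl_eq _ h6]
  simp only [nS, map_mul, eval_V, eval_V0, eval_lin, MvPolynomial.eval_C]
  rw [show (a - c) * v 0 + (b - d) * v 1 = p - q by rw [hp, hq]; ring,
    show -c * v 0 + -d * v 1 = - q by rw [hq]; ring,
    show (2 * c - a) / 3 * v 0 + (2 * d - b) / 3 * v 1 = (2 * q - p) / 3 by rw [hp, hq]; ring,
    show (a + c) / 3 * v 0 + (b + d) / 3 * v 1 = (p + q) / 3 by rw [hp, hq]; ring,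
    show (2 * a - c) / 3 * v 0 + (2 * b - d) / 3 * v 1 = (2 * p - q) / 3 by rw [hp, hq]; ring, ← hp]
  generalize p - q = r1
  generalize (2 * q - p) / 3 = r2
  generalize (p + q) / 3 = r3
  generalize (2 * p - q) / 3 = r4
  congr 1
  congr 1
  · congr 1
    · congr 1
      congr 1
      · congr 1
        · unfold gb; ring
        · unfold gp; ring
      · unfold gp; ring
    · unfold gl; ring
  · unfold gl; ring

lemma eval_nL (m a b c d : ℂ) (v : Fin 2 → ℂ) (p q : ℂ) (hp : p = a * v 0 + b * v 1) (hq : q = c * v 0 + d * v 1)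
    (h : Den p q ≠ 0) :
    MvPolynomial.eval v (nL m a b c d) = Den p q * AL m p q := by
  obtain ⟨h1, h2, h3, h4, h5, h6⟩ := Den_ne h
  have h3' : D5 q ≠ 0 := by have := D5_neg_ne h3; rwa [neg_neg] at this
  have h2' : D5 (q - p) ≠ 0 := by have := D5_neg_ne h2; rwa [neg_sub] at this
  have h6' : D5 ((q - 2 * p) / 3) ≠ 0 := by
    have := D5_neg_ne h6; rwa [show -((2 * p - q) / 3) = (q - 2 * p) / 3 by ring] at this
  have e : Den p q * AL m p q = 1 * (D5 p * (-(D5 (q - p) * fc (3 * m) (q - p))) *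
      (-(D5 q * fc (3 * m) q)) * (D5 ((2 * q - p) / 3) * fb m m ((2 * q - p) / 3)) *
      (D5 ((p + q) / 3) * fl m ((p + q) / 3)) *
      (-(D5 ((q - 2 * p) / 3) * fl m ((q - 2 * p) / 3)))) := by
    rw [Den, AL, D5_neg, show p - q = -(q - p) by ring, D5_neg,
      show (2 * p - q) / 3 = -((q - 2 * p) / 3) by ring, D5_neg]; ring
  rw [e, ← gc_eq _ h2', ← gc_eq _ h3', ← gb_eq _ _ h4, ← gl_eq _ h5, ← gl_eq _ h6']
  simp only [nL, map_mul, eval_V, eval_V0, eval_lin, MvPolynomial.eval_C]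
  rw [show (a - c) * v 0 + (b - d) * v 1 = -(q - p) by rw [hp, hq]; ring,
    show -c * v 0 + -d * v 1 = - q by rw [hq]; ring,
    show (2 * c - a) / 3 * v 0 + (2 * d - b) / 3 * v 1 = (2 * q - p) / 3 by rw [hp, hq]; ring,
    show (a + c) / 3 * v 0 + (b + d) / 3 * v 1 = (p + q) / 3 by rw [hp, hq]; ring,
    show (2 * a - c) / 3 * v 0 + (2 * b - d) / 3 * v 1 = -((q - 2 * p) / 3) by rw [hp, hq]; ring, ← hp]
  generalize q - p = r1
  generalize (2 * q - p) / 3 = r2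
  generalize (p + q) / 3 = r3
  generalize (q - 2 * p) / 3 = r4
  congr 1
  congr 1
  · congr 1
    · congr 1
      · congr 1
        · congr 1
          unfold gc; ring
        · unfold gc; ring
      · unfold gb; ring
    · unfold gl; ring
  · unfold gl; ring

/-! rotation data -/
def ra : Fin 6 → ℂ := ![1, 0, -1, -1, 0, 1]
def rb : Fin 6 → ℂ := ![0, 1, 1, 0, -1, -1]
def rc : Fin 6 → ℂ := ![0, -1, -1, 0, 1, 1]
def rd : Fin 6 → ℂ := ![1, 1, 0, -1, -1, 0]
def sa : Fin 6 → ℂ := ![2, 1, -1, -2, -1, 1]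
def sb : Fin 6 → ℂ := ![1, 2, 1, -1, -2, -1]
def ta : Fin 6 → ℂ := ![0, -3, -3, 0, 3, 3]
def tb : Fin 6 → ℂ := ![3, 0, -3, -3, 0, 3]

lemma DD_eq (m : ℂ) (F : ℂ → ℂ → ℂ) (p q : ℂ) : DD m F p q = ∑ i : Fin 6,
    (AS m (ra i * p + rb i * q) (rc i * p + rd i * q) * (F (p + sa i) (q + sb i) - F p q) +
     AL m (ra i * p + rb i * q) (rc i * p + rd i * q) * (F (p + ta i) (q + tb i) - F p q)) := by
  rw [Fin.sum_univ_six]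
  simp [DD, ra, rb, rc, rd, sa, sb, ta, tb]
  ring_nf

lemma Den_six (p q : ℂ) (i : Fin 6) : Den (ra i * p + rb i * q) (rc i * p + rd i * q) = Den p q := by
  have e1 := Den_Rot p q
  have e2 := Den_Rot q (q - p)
  have e3 := Den_Rot (q - p) (q - p - q)
  have e4 := Den_Rot (q - p - q) (q - p - q - (q - p))
  have e5 := Den_Rot (q - p - q - (q - p)) (q - p - q - (q - p) - (q - p - q))
  rw [e1] at e2
  rw [e2] at e3
  rw [e3] at e4
  rw [e4] at e5
  fin_cases i
  · simp [ra, rb, rc, rd]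
  · rw [← e1]; simp [ra, rb, rc, rd]; ring_nf
  · rw [← e2]; simp [ra, rb, rc, rd]; ring_nf
  · rw [← e3]; simp [ra, rb, rc, rd]; ring_nf
  · rw [← e4]; simp [ra, rb, rc, rd]; ring_nf
  · rw [← e5]; simp [ra, rb, rc, rd]; ring_nf

lemma DenP_six (i : Fin 6) : DenP (ra i) (rb i) (rc i) (rd i) = DenP 1 0 0 1 := by
  apply MvPolynomial.funext
  intro v
  rw [eval_DenP, eval_DenP, Den_six]
  simp

/-! factorization of `DenP 1 0 0 1` -/
def II : Finset (Fin 6 × ℤ) := Finset.univ ×ˢ Finset.Icc (-2 : ℤ) 2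
def fac (j : Fin 6 × ℤ) : MP := lin (la j.1) (lb j.1) - MvPolynomial.C (j.2 : ℂ)

lemma DenP_prod : DenP 1 0 0 1 = ∏ j ∈ II, fac j := by
  apply MvPolynomial.funext
  intro v
  rw [eval_DenP, II, Finset.prod_product, map_prod]
  have : ∀ i : Fin 6, MvPolynomial.eval v (∏ c ∈ Finset.Icc (-2 : ℤ) 2, fac (i, c)) = D5 (la i * v 0 + lb i * v 1) := by
    intro i
    rw [map_prod, show Finset.Icc (-2 : ℤ) 2 = {-2, -1, 0, 1, 2} from by decide]
    rw [Finset.prod_insert (by decide), Finset.prod_insert (by decide), Finset.prod_insert (by decide),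
      Finset.prod_insert (by decide), Finset.prod_singleton]
    simp only [fac, map_sub, eval_lin, MvPolynomial.eval_C]
    unfold D5; push_cast; ring
  rw [Finset.prod_congr rfl (fun i _ => this i), Fin.prod_univ_six, Den]
  simp [la, lb]
  ring_nf

lemma fac_prime (j : Fin 6 × ℤ) : Prime (fac j) := line_prime _ _ _ (la_ne _)

lemma fac_deg (j : Fin 6 × ℤ) : (fac j).totalDegree = 1 := by
  have hp := fac_prime j
  have h1 : Lt (fac j) 2 := (Lt.lin _ _).sub ((Lt.C _).mono (by norm_num))
  rw [Lt.iff hp.ne_zero] at h1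
  have h2 : (fac j).totalDegree ≠ 0 := by
    intro h
    rw [MvPolynomial.totalDegree_eq_zero_iff_eq_C] at h
    apply hp.not_isUnit
    have h0 : MvPolynomial.coeff 0 (fac j) ≠ 0 := by
      intro h'
      rw [h', map_zero] at h
      exact hp.ne_zero h
    rw [h]
    exact (IsUnit.mk0 _ h0).map MvPolynomial.C
  omega

lemma Lt.of_prod {s : Finset (Fin 6 × ℤ)} {g : MP} {l : ℕ} (h : Lt ((∏ j ∈ s, fac j) * g) (s.card + l)) : Lt g l := by
  induction s using Finset.induction_on with
  | empty => simpa using h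
  | insert a s ha ih =>
    apply ih
    rw [Finset.prod_insert ha, Finset.card_insert_of_notMem ha, mul_assoc, add_comm _ 1, add_assoc] at h
    exact Lt.of_mul (fac_prime a).ne_zero (fac_deg a) h

lemma Den_dvd (N : MP) (h : ∀ (i : Fin 6) (c : ℤ), c ∈ Finset.Icc (-2 : ℤ) 2 → ∀ p q : ℂ, la i * p + lb i * q = c →
    MvPolynomial.eval ![p, q] N = 0) : DenP 1 0 0 1 ∣ N := by
  rw [DenP_prod]
  apply Finset.prod_dvd_of_isRelPrime
  · intro i _ j _ hij
    show IsRelPrime (fac i) (fac j)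
    rw [(fac_prime i).irreducible.isRelPrime_iff_not_dvd]
    by_cases h1 : i.1 = j.1
    · have h2 : (i.2 : ℂ) ≠ j.2 := by
        intro h2
        exact hij (Prod.ext h1 (by exact_mod_cast h2))
      unfold fac
      rw [← h1]
      exact line_not_dvd' _ _ _ _ (la_ne _) h2
    · exact line_not_dvd _ _ _ _ _ _ (la_det _ _ h1)
  · intro j hj
    exact line_dvd _ _ _ (la_ne _) N (h j.1 j.2 (Finset.mem_product.1 hj).2)
end

noncomputable section
open Complex
open Filter Topology

lemma poly_diff (R : MP) : Differentiable ℂ (fun v : ℂ × ℂ => MvPolynomial.eval ![v.1, v.2] R) := by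
  induction R using MvPolynomial.induction_on with
  | C a => simp
  | add f g hf hg => simp only [map_add]; exact hf.add hg
  | mul_X f i hf =>
    simp only [map_mul, MvPolynomial.eval_X]
    refine hf.mul ?_
    fin_cases i
    · exact differentiable_fst
    · exact differentiable_snd

lemma pexp_Sm (R : MP) (x1 x2 : ℂ) : Sm (pexp R x1 x2) := by
  unfold Sm pexp
  exact (poly_diff R).mul (by fun_prop)

lemma iter_lin (Φ Ψ : ℂ → ℂ → ℂ) (c : ℂ) (k : ℕ) :
    Rot^[k] (fun p q => Φ p q - c * Ψ p q) = fun p q => (Rot^[k] Φ) p q - c * (Rot^[k] Ψ) p q := by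
  induction k with
  | zero => rfl
  | succ k ih => rw [Function.iterate_succ_apply', ih, Function.iterate_succ_apply', Function.iterate_succ_apply']; rfl

lemma QQ.sub {m : ℕ} {Φ Ψ : ℂ → ℂ → ℂ} (h1 : QQ m Φ) (h2 : QQ m Ψ) (c : ℂ) :
    QQ m (fun p q => Φ p q - c * Ψ p q) := by
  intro k
  rw [iter_lin]
  refine ⟨fun s hs y => ?_, fun s hs y => ?_⟩
  · show _ - _ = _ - _
    rw [(h1 k).1 s hs y, (h2 k).1 s hs y]
  · show _ - _ = _ - _
    rw [(h1 k).2 s hs y, (h2 k).2 s hs y]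

lemma term_lt {n D P : MP} {d : ℕ} (κ e a b : ℂ) (hn : Eq' n (MvPolynomial.C κ * D) 30) (hP : Lt P (d + 1)) :
    Lt (n * (MvPolynomial.C e * shf a b P - P) - D * (MvPolynomial.C (κ * (e - 1)) * P)) (30 + d) := by
  have h1 := (hn.mul (Eq'.shf hP a b)).2.2
  have h2 := (hn.2.2).mul' hP
  have : n * (MvPolynomial.C e * shf a b P - P) - D * (MvPolynomial.C (κ * (e - 1)) * P) =
      MvPolynomial.C e * (n * shf a b P - MvPolynomial.C κ * D * P) - (n - MvPolynomial.C κ * D) * P := by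
    simp only [map_mul, map_sub, map_one]; ring
  rw [this]
  exact (h1.Cmul e).sub h2

def eS (x1 x2 : ℂ) (i : Fin 6) : ℂ := exp (x1 * sa i + x2 * sb i)
def eL (x1 x2 : ℂ) (i : Fin 6) : ℂ := exp (x1 * ta i + x2 * tb i)

def muC (x1 x2 : ℂ) : ℂ := ∑ i : Fin 6, (3 * (eS x1 x2 i - 1) + 1 * (eL x1 x2 i - 1))

def NN (m : ℂ) (x1 x2 : ℂ) (P : MP) : MP := ∑ i : Fin 6,
  (nS m (ra i) (rb i) (rc i) (rd i) * (MvPolynomial.C (eS x1 x2 i) * shf (sa i) (sb i) P - P) +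
   nL m (ra i) (rb i) (rc i) (rd i) * (MvPolynomial.C (eL x1 x2 i) * shf (ta i) (tb i) P - P))

lemma Lt.sum {f : Fin 6 → MP} {k : ℕ} (h : ∀ i, Lt (f i) k) : Lt (∑ i, f i) k := by
  rw [Fin.sum_univ_six]
  exact (((((h 0).add (h 1)).add (h 2)).add (h 3)).add (h 4)).add (h 5)

lemma NN_lt (m : ℂ) (x1 x2 : ℂ) {P : MP} {d : ℕ} (hP : Lt P (d + 1)) :
    Lt (NN m x1 x2 P - DenP 1 0 0 1 * (MvPolynomial.C (muC x1 x2) * P)) (30 + d) := by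
  have : NN m x1 x2 P - DenP 1 0 0 1 * (MvPolynomial.C (muC x1 x2) * P) = ∑ i : Fin 6,
      ((nS m (ra i) (rb i) (rc i) (rd i) * (MvPolynomial.C (eS x1 x2 i) * shf (sa i) (sb i) P - P) -
        DenP 1 0 0 1 * (MvPolynomial.C (3 * (eS x1 x2 i - 1)) * P)) +
       (nL m (ra i) (rb i) (rc i) (rd i) * (MvPolynomial.C (eL x1 x2 i) * shf (ta i) (tb i) P - P) -
        DenP 1 0 0 1 * (MvPolynomial.C (1 * (eL x1 x2 i - 1)) * P))) := by
    rw [NN, muC, map_sum, Finset.sum_mul, Finset.mul_sum, ← Finset.sum_sub_distrib]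
    refine Finset.sum_congr rfl fun i _ => ?_
    rw [map_add]; ring
  rw [this]
  refine Lt.sum fun i => ?_
  refine (term_lt _ _ _ _ ?_ hP).add (term_lt _ _ _ _ ?_ hP)
  · have := nS_top m (ra i) (rb i) (rc i) (rd i)
    rwa [DenP_six] at this
  · have := nL_top m (ra i) (rb i) (rc i) (rd i)
    rwa [DenP_six] at this

lemma pexp_shift (P : MP) (x1 x2 a b p q : ℂ) : pexp P x1 x2 (p + a) (q + b) =
    exp (x1 * a + x2 * b) * MvPolynomial.eval ![p, q] (shf a b P) * exp (x1 * p + x2 * q) := by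
  rw [pexp, eval_shf, show x1 * (p + a) + x2 * (q + b) = (x1 * a + x2 * b) + (x1 * p + x2 * q) by ring, exp_add]
  ring

lemma NN_rel (m x1 x2 : ℂ) (P : MP) (p q : ℂ) (h : Den p q ≠ 0) :
    pexp (NN m x1 x2 P) x1 x2 p q = Den p q * DD m (pexp P x1 x2) p q := by
  rw [DD_eq, pexp, NN, map_sum, Finset.sum_mul, Finset.mul_sum]
  refine Finset.sum_congr rfl fun i _ => ?_
  have hd : Den (ra i * p + rb i * q) (rc i * p + rd i * q) ≠ 0 := by rwa [Den_six]
  have e1 := eval_nS m (ra i) (rb i) (rc i) (rd i) ![p, q] (ra i * p + rb i * q) (rc i * p + rd i * q)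
    (by simp) (by simp) hd
  have e2 := eval_nL m (ra i) (rb i) (rc i) (rd i) ![p, q] (ra i * p + rb i * q) (rc i * p + rd i * q)
    (by simp) (by simp) hd
  rw [Den_six] at e1 e2
  rw [pexp_shift, pexp_shift, pexp]
  simp only [map_add, map_mul, map_sub, MvPolynomial.eval_C, e1, e2, eS, eL]
  ring

lemma core (m : ℕ) (hm : 1 ≤ m) (x1 x2 : ℂ)
    (hB : ∀ c ∈ [x1 + x2 / 2, (x1 - x2) / 2, -x1 / 2 - x2], sinh (2 * c) ≠ 0)
    (hA : ∀ c ∈ [3 * x2 / 2, 3 * (x1 + x2) / 2, 3 * x1 / 2], sinh c ≠ 0)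
    (P : MP) (hP : Lt P (12 * m + 3 + 1)) (hq : QQ m (pexp P x1 x2)) (p q : ℂ) (h : Den p q ≠ 0) :
    DD m (pexp P x1 x2) p q = muC x1 x2 * pexp P x1 x2 p q := by
  have hdvd : DenP 1 0 0 1 ∣ NN m x1 x2 P := by
    apply Den_dvd
    intro i c hc p q hpq
    have := K0all m hm (pexp P x1 x2) (pexp (NN m x1 x2 P) x1 x2) (pexp_Sm _ _ _) (pexp_Sm _ _ _) hq
      (NN_rel m x1 x2 P) i c hc p q hpq
    exact (mul_eq_zero.1 this).resolve_right (exp_ne_zero _)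
  obtain ⟨Q, hQ⟩ := hdvd
  have relQ : ∀ p q, Den p q ≠ 0 → pexp Q x1 x2 p q = DD m (pexp P x1 x2) p q := by
    intro p q hd
    have h1 := NN_rel m x1 x2 P p q hd
    have h2 : MvPolynomial.eval ![p, q] (DenP 1 0 0 1) = Den p q := by rw [eval_DenP]; simp
    rw [hQ, pexp, map_mul, h2, mul_assoc] at h1
    exact mul_left_cancel₀ hd h1
  have hQQ := K1all m hm _ _ (pexp_Sm P x1 x2) (pexp_Sm Q x1 x2) hq relQ
  have hR := hQQ.sub hq (muC x1 x2)
  have eR : (fun p q => pexp Q x1 x2 p q - muC x1 x2 * pexp P x1 x2 p q) =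
      pexp (Q - MvPolynomial.C (muC x1 x2) * P) x1 x2 := by
    funext p q
    simp only [pexp, map_sub, map_mul, MvPolynomial.eval_C]; ring
  rw [eR] at hR
  have hlt : Lt (Q - MvPolynomial.C (muC x1 x2) * P) (12 * m + 3) := by
    have h1 := NN_lt (m : ℂ) x1 x2 hP
    rw [hQ, ← mul_sub, DenP_prod] at h1
    exact Lt.of_prod (s := II) h1
  have h0 := uniq2D m hm x1 x2 hB hA _ hlt hR
  rw [← relQ p q h]
  have := congrFun (congrFun eR p) q
  rw [h0] at this
  simp only [pexp, map_zero, zero_mul] at this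
  exact sub_eq_zero.1 this
end

noncomputable section
open Complex

/-! ### Translation between the frozen statement and the coordinates `p, q` -/

lemma rt3_sq : rt3 * rt3 = 3 := by
  unfold rt3
  rw [← Complex.ofReal_mul, Real.mul_self_sqrt (by norm_num)]; norm_num
lemma rt3_ne : rt3 ≠ 0 := by
  intro h; have := rt3_sq; rw [h] at this; norm_num at this

/-- lattice vector `a β₁ + b β₂` -/
def W (a b : ℂ) : Fin 2 → ℂ := ![a + b / 2, rt3 / 2 * b]
/-- the vector with `⟨β₁,z⟩ = p`, `⟨β₂,z⟩ = q` -/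
def Zc (p q : ℂ) : Fin 2 → ℂ := ![p, (2 * q - p) / rt3]

lemma bil_WW (a b c d : ℂ) : bil (W a b) (W c d) = a * c + b * d + (a * d + b * c) / 2 := by
  simp only [bil, W, Matrix.cons_val_zero, Matrix.cons_val_one]
  linear_combination (b * d / 4) * rt3_sq
lemma bil_WZ (a b p q : ℂ) : bil (W a b) (Zc p q) = a * p + b * q := by
  have := rt3_ne
  simp only [bil, W, Zc, Matrix.cons_val_zero, Matrix.cons_val_one]
  field_simp; ring
lemma W_Z (a b : ℂ) : W a b = Zc (a + b / 2) (a / 2 + b) := by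
  have := rt3_ne
  ext i; fin_cases i
  · simp [W, Zc]
  · simp only [W, Zc, Fin.mk_one, Matrix.cons_val_one, Matrix.cons_val_fin_one]
    field_simp; linear_combination b * rt3_sq
lemma W_inj (a b c d : ℂ) : W a b = W c d ↔ a = c ∧ b = d := by
  constructor
  · intro h
    have h1 := congrFun h 1
    have h0 := congrFun h 0
    simp only [W, Matrix.cons_val_zero, Matrix.cons_val_one, Matrix.cons_val_fin_one] at h0 h1
    have h2 : b = d := by
      have := mul_left_cancel₀ (div_ne_zero rt3_ne two_ne_zero) h1
      exact this
    exact ⟨by rw [h2] at h0; exact add_right_cancel h0, h2⟩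
  · rintro ⟨rfl, rfl⟩; rfl
lemma Z_add (p q a b : ℂ) : Zc p q + Zc a b = Zc (p + a) (q + b) := by
  ext i; fin_cases i
  · simp [Zc]
  · simp [Zc]; ring
lemma Z_sub (p q a b : ℂ) : Zc p q - Zc a b = Zc (p - a) (q - b) := by
  ext i; fin_cases i
  · simp [Zc]
  · simp [Zc]; ring
lemma Z_smul (s a b : ℂ) : s • Zc a b = Zc (s * a) (s * b) := by
  ext i; fin_cases i
  · simp [Zc]
  · simp [Zc]; ring
lemma W_smul (s a b : ℂ) : s • W a b = W (s * a) (s * b) := by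
  ext i; fin_cases i
  · simp [W]; ring
  · simp [W]; ring
lemma W_neg (a b : ℂ) : - W a b = W (-a) (-b) := by
  ext i; fin_cases i
  · simp [W]; ring
  · simp [W]
lemma Z_surj (z : Fin 2 → ℂ) : z = Zc (z 0) (z 0 / 2 + rt3 / 2 * z 1) := by
  have := rt3_ne
  ext i; fin_cases i
  · simp [Zc]
  · simp only [Zc, Fin.mk_one, Matrix.cons_val_one, Matrix.cons_val_fin_one]
    field_simp; ring

lemma b1W : vβ₁ = W 1 0 := by ext i; fin_cases i <;> simp [vβ₁, W]
lemma b2W : vβ₂ = W 0 1 := by ext i; fin_cases i <;> simp [vβ₂, W]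
lemma b3W : vβ₃ = W (-1) 1 := by ext i; fin_cases i <;> simp [vβ₃, W]; norm_num
lemma a1W : vα₁ = W (-1) 2 := by ext i; fin_cases i <;> simp [vα₁, W]
lemma a2W : vα₂ = W (-2) 1 := by ext i; fin_cases i <;> simp [vα₂, W]; norm_num
lemma a3W : vα₃ = W 1 1 := by ext i; fin_cases i <;> simp [vα₃, W]; norm_num

lemma shortW : shortRoots = [W 1 0, W 0 1, W (-1) 1, W (-1) 0, W 0 (-1), W 1 (-1)] := by
  simp only [shortRoots, b1W, b2W, b3W, W_neg, neg_neg, neg_zero]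
lemma longW : longRoots = [W (-1) 2, W (-2) 1, W 1 1, W 1 (-2), W 2 (-1), W (-1) (-1)] := by
  simp only [longRoots, a1W, a2W, a3W, W_neg, neg_neg]
lemma twoShortW : twoShort = [W 2 0, W 0 2, W (-2) 2, W (-2) 0, W 0 (-2), W 2 (-2)] := by
  simp only [twoShort, shortW, List.map_cons, List.map_nil, W_smul]
  norm_num
lemma twoG2W : twoG2 = [W (-2) 4, W (-4) 2, W 2 2, W 2 (-4), W 4 (-2), W (-2) (-2),
    W 2 0, W 0 2, W (-2) 2, W (-2) 0, W 0 (-2), W 2 (-2)] := by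
  simp only [twoG2, G2all, longW, shortW, List.map_cons, List.map_nil, W_smul, List.cons_append,
    List.nil_append]
  norm_num

lemma QQ_of {m : ℕ} {ψ : (Fin 2 → ℂ) → ℂ} (h : QuasiInvAG2 m ψ) :
    QQ m (fun p q => ψ (Zc p q)) := by
  obtain ⟨hA, hB⟩ := h
  set Φ : ℂ → ℂ → ℂ := fun p q => ψ (Zc p q) with hΦ
  have B1 : ∀ s : ℕ, SB m s → ∀ y, Φ s (y + s / 2) = Φ (-s) (y - s / 2) := by
    intro s hs y
    have := hB vβ₁ (by simp) s hs (Zc 0 y) (by rw [b1W, bil_WZ]; ring)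
    rw [b1W, W_Z, Z_smul, Z_add, Z_sub] at this
    simp only [hΦ]
    convert this using 3 <;> ring
  have B2 : ∀ s : ℕ, SB m s → ∀ y, Φ (y + s / 2) s = Φ (y - s / 2) (-s) := by
    intro s hs y
    have := hB vβ₂ (by simp) s hs (Zc y 0) (by rw [b2W, bil_WZ]; ring)
    rw [b2W, W_Z, Z_smul, Z_add, Z_sub] at this
    simp only [hΦ]
    convert this using 3 <;> ring
  have B3 : ∀ s : ℕ, SB m s → ∀ y, Φ (y - s / 2) (y + s / 2) = Φ (y + s / 2) (y - s / 2) := by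
    intro s hs y
    have := hB vβ₃ (by simp) s hs (Zc y y) (by rw [b3W, bil_WZ]; ring)
    rw [b3W, W_Z, Z_smul, Z_add, Z_sub] at this
    simp only [hΦ]
    convert this using 3 <;> ring
  have A1 : ∀ s : ℕ, SA m s → ∀ y, Φ y (y / 2 + 3 * s / 2) = Φ y (y / 2 - 3 * s / 2) := by
    intro s hs y
    have := hA vα₁ (by simp) s hs.1 hs.2 (Zc y (y / 2)) (by rw [a1W, bil_WZ]; ring)
    rw [a1W, W_Z, Z_smul, Z_add, Z_sub] at this
    simp only [hΦ]
    convert this using 3 <;> ring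
  have A2 : ∀ s : ℕ, SA m s → ∀ y, Φ (y / 2 - 3 * s / 2) y = Φ (y / 2 + 3 * s / 2) y := by
    intro s hs y
    have := hA vα₂ (by simp) s hs.1 hs.2 (Zc (y / 2) y) (by rw [a2W, bil_WZ]; ring)
    rw [a2W, W_Z, Z_smul, Z_add, Z_sub] at this
    simp only [hΦ]
    convert this using 3 <;> ring
  have A3 : ∀ s : ℕ, SA m s → ∀ y,
      Φ (y + 3 * s / 2) (-y + 3 * s / 2) = Φ (y - 3 * s / 2) (-y - 3 * s / 2) := by
    intro s hs y
    have := hA vα₃ (by simp) s hs.1 hs.2 (Zc y (-y)) (by rw [a3W, bil_WZ]; ring)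
    rw [a3W, W_Z, Z_smul, Z_add, Z_sub] at this
    simp only [hΦ]
    convert this using 3 <;> ring
  clear_value Φ
  have R6 : Rot^[6] Φ = Φ := by
    funext p q
    simp only [Function.iterate_succ, Function.iterate_zero, Function.comp, id, Rot]
    congr 1 <;> ring
  intro k
  have hk : Rot^[k] Φ = Rot^[k % 6] Φ := by
    conv_lhs => rw [← Nat.mod_add_div k 6, Function.iterate_add_apply, Function.iterate_mul]
    congr 1
    exact Function.iterate_fixed R6 _
  rw [hk]
  have hlt : k % 6 < 6 := Nat.mod_lt _ (by norm_num)
  generalize k % 6 = j at hlt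
  unfold QB QA
  interval_cases j <;>
    simp only [Function.iterate_succ, Function.iterate_zero, Function.comp, id, Rot]
  · exact ⟨B1, A1⟩
  · refine ⟨fun s hs y => ?_, fun s hs y => ?_⟩
    · convert (B3 s hs y).symm using 2 <;> ring
    · convert A3 s hs (y / 2) using 2 <;> ring
  · refine ⟨fun s hs y => ?_, fun s hs y => ?_⟩
    · convert (B2 s hs y).symm using 2 <;> ring
    · convert (A2 s hs (-y)).symm using 2 <;> ring
  · refine ⟨fun s hs y => ?_, fun s hs y => ?_⟩
    · convert (B1 s hs (-y)).symm using 2 <;> ring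
    · convert (A1 s hs (-y)).symm using 2 <;> ring
  · refine ⟨fun s hs y => ?_, fun s hs y => ?_⟩
    · convert B3 s hs (-y) using 2 <;> ring
    · convert (A3 s hs (-y / 2)).symm using 2 <;> ring
  · refine ⟨fun s hs y => ?_, fun s hs y => ?_⟩
    · convert B2 s hs (-y) using 2 <;> ring
    · convert A2 s hs y using 2 <;> ring

lemma div3 (m a : ℂ) : m * 3 / a = m / (a / 3) := by
  rw [div_div_eq_mul_div]
lemma div3' (m a : ℂ) : m * 3 / (a + 3) = m / (a / 3 + 1) := by
  rw [show a / 3 + 1 = (a + 3) / 3 by ring, div_div_eq_mul_div]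

lemma sP (m a b p q : ℂ) (h : a * a + b * b + (a * b + b * a) / 2 = 1) :
    (1 - (3 * m + 2) * bil (W a b) (W a b) / bil (W a b) (Zc p q)) *
    (1 + 3 * m * bil (W a b) (W a b) / (bil (W a b) (Zc p q) + 2 * bil (W a b) (W a b))) *
    (1 - (3 * m - 1) * bil (W a b) (W a b) / (bil (W a b) (Zc p q) - bil (W a b) (W a b))) =
    fp (3 * m) (a * p + b * q) := by
  rw [bil_WW, bil_WZ, h]; simp only [fp, mul_one]
lemma sC (m a b p q : ℂ) (h : a * a + b * b + (a * b + b * a) / 2 = 1) :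
    (1 - (3 * m + 2) * bil (W a b) (W a b) / bil (W a b) (Zc p q)) *
    (1 - (3 * m + 1) * bil (W a b) (W a b) / (bil (W a b) (Zc p q) + bil (W a b) (W a b))) *
    (1 - 3 * m * bil (W a b) (W a b) / (bil (W a b) (Zc p q) + 2 * bil (W a b) (W a b))) =
    fc (3 * m) (a * p + b * q) := by
  rw [bil_WW, bil_WZ, h]; simp only [fc, mul_one]
lemma sL (m a b p q : ℂ) (h : a * a + b * b + (a * b + b * a) / 2 = 3) :
    1 - m * bil (W a b) (W a b) / bil (W a b) (Zc p q) = fl m ((a * p + b * q) / 3) := by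
  rw [bil_WW, bil_WZ, h, div3]; rfl
lemma sHS (m a b p q : ℂ) (h : a * a + b * b + (a * b + b * a) / 2 = 1) :
    (1 - (3 * m + 2) * bil (W a b) (W a b) / bil (W a b) (Zc p q)) *
    (1 - 3 * m * bil (W a b) (W a b) / (bil (W a b) (Zc p q) + bil (W a b) (W a b))) =
    fb (3 * m + 2) (3 * m) (a * p + b * q) := by
  rw [bil_WW, bil_WZ, h]; simp only [fb, mul_one]
lemma sHL (m a b p q : ℂ) (h : a * a + b * b + (a * b + b * a) / 2 = 3) :
    (1 - m * bil (W a b) (W a b) / bil (W a b) (Zc p q)) *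
    (1 - m * bil (W a b) (W a b) / (bil (W a b) (Zc p q) + bil (W a b) (W a b))) =
    fb m m ((a * p + b * q) / 3) := by
  rw [bil_WW, bil_WZ, h, div3, div3']; rfl

open scoped Classical in
/-- `a_τ` for `τ = ±2βⱼ`, with the index sets still to be computed -/
lemma aS_gen (m : ℕ) (a b p q : ℂ) (g₁ g₂ l₁ l₂ : Fin 2 → ℂ) (hm : W (2 * a) (2 * b) ∈ twoShort)
    (h1 : shortRoots.filter (fun γ => bil (W (2 * a) (2 * b)) γ = bil γ γ) = [g₁, g₂])
    (h2 : longRoots.filter (fun γ => bil (W (2 * a) (2 * b)) γ = bil γ γ) = [l₁, l₂])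
    (h : a * a + b * b + (a * b + b * a) / 2 = 1)
    (c₁ d₁ c₂ d₂ e₁ f₁ e₂ f₂ : ℂ)
    (hg₁ : g₁ = W c₁ d₁ ∧ c₁ * c₁ + d₁ * d₁ + (c₁ * d₁ + d₁ * c₁) / 2 = 1)
    (hg₂ : g₂ = W c₂ d₂ ∧ c₂ * c₂ + d₂ * d₂ + (c₂ * d₂ + d₂ * c₂) / 2 = 1)
    (hl₁ : l₁ = W e₁ f₁ ∧ e₁ * e₁ + f₁ * f₁ + (e₁ * f₁ + f₁ * e₁) / 2 = 3)
    (hl₂ : l₂ = W e₂ f₂ ∧ e₂ * e₂ + f₂ * f₂ + (e₂ * f₂ + f₂ * e₂) / 2 = 3) :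
    aD1 m (W (2 * a) (2 * b)) (Zc p q) =
      3 * (fp (3 * m) (c₁ * p + d₁ * q) * fp (3 * m) (c₂ * p + d₂ * q)) *
      (fl m ((e₁ * p + f₁ * q) / 3) * fl m ((e₂ * p + f₂ * q) / 3)) *
      fb (3 * m + 2) (3 * m) (a * p + b * q) := by
  have hh : (2⁻¹ : ℂ) • W (2 * a) (2 * b) = W a b := by rw [W_smul]; congr 1 <;> ring
  unfold aD1
  simp only [if_pos hm, h1, h2, hh, List.map_cons, List.map_nil, List.prod_cons, List.prod_nil,
    mul_one]
  rw [hg₁.1, hg₂.1, hl₁.1, hl₂.1, sP _ _ _ _ _ hg₁.2, sP _ _ _ _ _ hg₂.2, sL _ _ _ _ _ hl₁.2,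
    sL _ _ _ _ _ hl₂.2, sHS _ _ _ _ _ h]

open scoped Classical in
/-- `a_τ` for `τ = ±2αⱼ`, with the index sets still to be computed -/
lemma aL_gen (m : ℕ) (a b p q : ℂ) (g₁ g₂ l₁ l₂ : Fin 2 → ℂ) (hm : W (2 * a) (2 * b) ∉ twoShort)
    (h1 : shortRoots.filter (fun γ => bil (W (2 * a) (2 * b)) γ = 3 * bil γ γ) = [g₁, g₂])
    (h2 : longRoots.filter (fun γ => bil (W (2 * a) (2 * b)) γ = bil γ γ) = [l₁, l₂])
    (h : a * a + b * b + (a * b + b * a) / 2 = 3)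
    (c₁ d₁ c₂ d₂ e₁ f₁ e₂ f₂ : ℂ)
    (hg₁ : g₁ = W c₁ d₁ ∧ c₁ * c₁ + d₁ * d₁ + (c₁ * d₁ + d₁ * c₁) / 2 = 1)
    (hg₂ : g₂ = W c₂ d₂ ∧ c₂ * c₂ + d₂ * d₂ + (c₂ * d₂ + d₂ * c₂) / 2 = 1)
    (hl₁ : l₁ = W e₁ f₁ ∧ e₁ * e₁ + f₁ * f₁ + (e₁ * f₁ + f₁ * e₁) / 2 = 3)
    (hl₂ : l₂ = W e₂ f₂ ∧ e₂ * e₂ + f₂ * f₂ + (e₂ * f₂ + f₂ * e₂) / 2 = 3) :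
    aD1 m (W (2 * a) (2 * b)) (Zc p q) =
      (fc (3 * m) (c₁ * p + d₁ * q) * fc (3 * m) (c₂ * p + d₂ * q)) *
      (fl m ((e₁ * p + f₁ * q) / 3) * fl m ((e₂ * p + f₂ * q) / 3)) *
      fb m m ((a * p + b * q) / 3) := by
  have hh : (2⁻¹ : ℂ) • W (2 * a) (2 * b) = W a b := by rw [W_smul]; congr 1 <;> ring
  unfold aD1
  simp only [if_neg hm, h1, h2, hh, List.map_cons, List.map_nil, List.prod_cons, List.prod_nil,
    mul_one]
  rw [hg₁.1, hg₂.1, hl₁.1, hl₂.1, sC _ _ _ _ _ hg₁.2, sC _ _ _ _ _ hg₂.2, sL _ _ _ _ _ hl₁.2,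
    sL _ _ _ _ _ hl₂.2, sHL _ _ _ _ _ h]

lemma aS1 (m : ℕ) (p q : ℂ) : aD1 m (W 2 0) (Zc p q) = AS m p q := by
  have := aS_gen m 1 0 p q _ _ _ _ (by rw [twoShortW]; simp only [List.mem_cons, W_inj]; norm_num)
    (by rw [shortW]; simp only [List.filter_cons, List.filter_nil, bil_WW]; norm_num)
    (by rw [longW]; simp only [List.filter_cons, List.filter_nil, bil_WW]; norm_num)
    (by norm_num) 0 1 1 (-1) 1 1 2 (-1) ⟨rfl, by norm_num⟩ ⟨rfl, by norm_num⟩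
    ⟨rfl, by norm_num⟩ ⟨rfl, by norm_num⟩
  rw [show W 2 0 = W (2 * 1) (2 * 0) by norm_num, this]
  unfold AS
  ring_nf
lemma aS2 (m : ℕ) (p q : ℂ) : aD1 m (W 0 2) (Zc p q) = AS m q (q - p) := by
  have := aS_gen m 0 1 p q _ _ _ _ (by rw [twoShortW]; simp only [List.mem_cons, W_inj]; norm_num)
    (by rw [shortW]; simp only [List.filter_cons, List.filter_nil, bil_WW]; norm_num)
    (by rw [longW]; simp only [List.filter_cons, List.filter_nil, bil_WW]; norm_num)
    (by norm_num) 1 0 (-1) 1 (-1) 2 1 1 ⟨rfl, by norm_num⟩ ⟨rfl, by norm_num⟩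
    ⟨rfl, by norm_num⟩ ⟨rfl, by norm_num⟩
  rw [show W 0 2 = W (2 * 0) (2 * 1) by norm_num, this]
  unfold AS
  ring_nf
lemma aS3 (m : ℕ) (p q : ℂ) : aD1 m (W (-2) 2) (Zc p q) = AS m (q - p) (-p) := by
  have := aS_gen m (-1) 1 p q _ _ _ _ (by rw [twoShortW]; simp only [List.mem_cons, W_inj]; norm_num)
    (by rw [shortW]; simp only [List.filter_cons, List.filter_nil, bil_WW]; norm_num)
    (by rw [longW]; simp only [List.filter_cons, List.filter_nil, bil_WW]; norm_num)
    (by norm_num) 0 1 (-1) 0 (-1) 2 (-2) 1 ⟨rfl, by norm_num⟩ ⟨rfl, by norm_num⟩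
    ⟨rfl, by norm_num⟩ ⟨rfl, by norm_num⟩
  rw [show W (-2) 2 = W (2 * (-1)) (2 * 1) by norm_num, this]
  unfold AS
  ring_nf
lemma aS4 (m : ℕ) (p q : ℂ) : aD1 m (W (-2) 0) (Zc p q) = AS m (-p) (-q) := by
  have := aS_gen m (-1) 0 p q _ _ _ _ (by rw [twoShortW]; simp only [List.mem_cons, W_inj]; norm_num)
    (by rw [shortW]; simp only [List.filter_cons, List.filter_nil, bil_WW]; norm_num)
    (by rw [longW]; simp only [List.filter_cons, List.filter_nil, bil_WW]; norm_num)
    (by norm_num) (-1) 1 0 (-1) (-2) 1 (-1) (-1) ⟨rfl, by norm_num⟩ ⟨rfl, by norm_num⟩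
    ⟨rfl, by norm_num⟩ ⟨rfl, by norm_num⟩
  rw [show W (-2) 0 = W (2 * (-1)) (2 * 0) by norm_num, this]
  unfold AS
  ring_nf
lemma aS5 (m : ℕ) (p q : ℂ) : aD1 m (W 0 (-2)) (Zc p q) = AS m (-q) (p - q) := by
  have := aS_gen m 0 (-1) p q _ _ _ _ (by rw [twoShortW]; simp only [List.mem_cons, W_inj]; norm_num)
    (by rw [shortW]; simp only [List.filter_cons, List.filter_nil, bil_WW]; norm_num)
    (by rw [longW]; simp only [List.filter_cons, List.filter_nil, bil_WW]; norm_num)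
    (by norm_num) (-1) 0 1 (-1) 1 (-2) (-1) (-1) ⟨rfl, by norm_num⟩ ⟨rfl, by norm_num⟩
    ⟨rfl, by norm_num⟩ ⟨rfl, by norm_num⟩
  rw [show W 0 (-2) = W (2 * 0) (2 * (-1)) by norm_num, this]
  unfold AS
  ring_nf
lemma aS6 (m : ℕ) (p q : ℂ) : aD1 m (W 2 (-2)) (Zc p q) = AS m (p - q) p := by
  have := aS_gen m 1 (-1) p q _ _ _ _ (by rw [twoShortW]; simp only [List.mem_cons, W_inj]; norm_num)
    (by rw [shortW]; simp only [List.filter_cons, List.filter_nil, bil_WW]; norm_num)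
    (by rw [longW]; simp only [List.filter_cons, List.filter_nil, bil_WW]; norm_num)
    (by norm_num) 1 0 0 (-1) 1 (-2) 2 (-1) ⟨rfl, by norm_num⟩ ⟨rfl, by norm_num⟩
    ⟨rfl, by norm_num⟩ ⟨rfl, by norm_num⟩
  rw [show W 2 (-2) = W (2 * 1) (2 * (-1)) by norm_num, this]
  unfold AS
  ring_nf
lemma aL1 (m : ℕ) (p q : ℂ) : aD1 m (W (-2) 4) (Zc p q) = AL m p q := by
  have := aL_gen m (-1) 2 p q _ _ _ _ (by rw [twoShortW]; simp only [List.mem_cons, W_inj]; norm_num)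
    (by rw [shortW]; simp only [List.filter_cons, List.filter_nil, bil_WW]; norm_num)
    (by rw [longW]; simp only [List.filter_cons, List.filter_nil, bil_WW]; norm_num)
    (by norm_num) 0 1 (-1) 1 (-2) 1 1 1 ⟨rfl, by norm_num⟩ ⟨rfl, by norm_num⟩
    ⟨rfl, by norm_num⟩ ⟨rfl, by norm_num⟩
  rw [show W (-2) 4 = W (2 * (-1)) (2 * 2) by norm_num, this]
  unfold AL
  ring_nf
lemma aL2 (m : ℕ) (p q : ℂ) : aD1 m (W (-4) 2) (Zc p q) = AL m q (q - p) := by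
  have := aL_gen m (-2) 1 p q _ _ _ _ (by rw [twoShortW]; simp only [List.mem_cons, W_inj]; norm_num)
    (by rw [shortW]; simp only [List.filter_cons, List.filter_nil, bil_WW]; norm_num)
    (by rw [longW]; simp only [List.filter_cons, List.filter_nil, bil_WW]; norm_num)
    (by norm_num) (-1) 1 (-1) 0 (-1) 2 (-1) (-1) ⟨rfl, by norm_num⟩ ⟨rfl, by norm_num⟩
    ⟨rfl, by norm_num⟩ ⟨rfl, by norm_num⟩
  rw [show W (-4) 2 = W (2 * (-2)) (2 * 1) by norm_num, this]
  unfold AL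
  ring_nf
lemma aL3 (m : ℕ) (p q : ℂ) : aD1 m (W (-2) (-2)) (Zc p q) = AL m (q - p) (-p) := by
  have := aL_gen m (-1) (-1) p q _ _ _ _ (by rw [twoShortW]; simp only [List.mem_cons, W_inj]; norm_num)
    (by rw [shortW]; simp only [List.filter_cons, List.filter_nil, bil_WW]; norm_num)
    (by rw [longW]; simp only [List.filter_cons, List.filter_nil, bil_WW]; norm_num)
    (by norm_num) (-1) 0 0 (-1) (-2) 1 1 (-2) ⟨rfl, by norm_num⟩ ⟨rfl, by norm_num⟩
    ⟨rfl, by norm_num⟩ ⟨rfl, by norm_num⟩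
  rw [show W (-2) (-2) = W (2 * (-1)) (2 * (-1)) by norm_num, this]
  unfold AL
  ring_nf
lemma aL4 (m : ℕ) (p q : ℂ) : aD1 m (W 2 (-4)) (Zc p q) = AL m (-p) (-q) := by
  have := aL_gen m 1 (-2) p q _ _ _ _ (by rw [twoShortW]; simp only [List.mem_cons, W_inj]; norm_num)
    (by rw [shortW]; simp only [List.filter_cons, List.filter_nil, bil_WW]; norm_num)
    (by rw [longW]; simp only [List.filter_cons, List.filter_nil, bil_WW]; norm_num)
    (by norm_num) 0 (-1) 1 (-1) 2 (-1) (-1) (-1) ⟨rfl, by norm_num⟩ ⟨rfl, by norm_num⟩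
    ⟨rfl, by norm_num⟩ ⟨rfl, by norm_num⟩
  rw [show W 2 (-4) = W (2 * 1) (2 * (-2)) by norm_num, this]
  unfold AL
  ring_nf
lemma aL5 (m : ℕ) (p q : ℂ) : aD1 m (W 4 (-2)) (Zc p q) = AL m (-q) (p - q) := by
  have := aL_gen m 2 (-1) p q _ _ _ _ (by rw [twoShortW]; simp only [List.mem_cons, W_inj]; norm_num)
    (by rw [shortW]; simp only [List.filter_cons, List.filter_nil, bil_WW]; norm_num)
    (by rw [longW]; simp only [List.filter_cons, List.filter_nil, bil_WW]; norm_num)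
    (by norm_num) 1 0 1 (-1) 1 1 1 (-2) ⟨rfl, by norm_num⟩ ⟨rfl, by norm_num⟩
    ⟨rfl, by norm_num⟩ ⟨rfl, by norm_num⟩
  rw [show W 4 (-2) = W (2 * 2) (2 * (-1)) by norm_num, this]
  unfold AL
  ring_nf
lemma aL6 (m : ℕ) (p q : ℂ) : aD1 m (W 2 2) (Zc p q) = AL m (p - q) p := by
  have := aL_gen m 1 1 p q _ _ _ _ (by rw [twoShortW]; simp only [List.mem_cons, W_inj]; norm_num)
    (by rw [shortW]; simp only [List.filter_cons, List.filter_nil, bil_WW]; norm_num)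
    (by rw [longW]; simp only [List.filter_cons, List.filter_nil, bil_WW]; norm_num)
    (by norm_num) 1 0 0 1 (-1) 2 2 (-1) ⟨rfl, by norm_num⟩ ⟨rfl, by norm_num⟩
    ⟨rfl, by norm_num⟩ ⟨rfl, by norm_num⟩
  rw [show W 2 2 = W (2 * 1) (2 * 1) by norm_num, this]
  unfold AL
  ring_nf
end

noncomputable section
open Complex

lemma D5_ne_of {u c k : ℂ} (h : u ≠ 0 ∧ u ≠ c ∧ u ≠ -c ∧ u ≠ 2 * c ∧ u ≠ -(2 * c)) (hc : c ≠ 0)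
    (hk : k = u / c ∨ k = -(u / c)) : D5 k ≠ 0 := by
  obtain ⟨h0, h1, h2, h3, h4⟩ := h
  have key : D5 (u / c) ≠ 0 := by
    have e : D5 (u / c) = u * ((u - c) * (u - -c)) * ((u - 2 * c) * (u - -(2 * c))) / c ^ 5 := by
      unfold D5; field_simp; ring
    rw [e]
    exact div_ne_zero (mul_ne_zero (mul_ne_zero h0 (mul_ne_zero (sub_ne_zero.2 h1)
      (sub_ne_zero.2 h2))) (mul_ne_zero (sub_ne_zero.2 h3) (sub_ne_zero.2 h4))) (pow_ne_zero _ hc)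
  rcases hk with rfl | rfl
  · exact key
  · exact D5_neg_ne key

lemma Den_of {p q : ℂ} (h : D1Reg (Zc p q)) : Den p q ≠ 0 := by
  have key : ∀ a b n : ℂ, W a b ∈ G2plus → a * a + b * b + (a * b + b * a) / 2 = n → n ≠ 0 →
      ∀ k, (k = (a * p + b * q) / n ∨ k = -((a * p + b * q) / n)) → D5 k ≠ 0 := by
    intro a b n hm hn hn0 k hk
    have := h _ hm
    rw [bil_WW, bil_WZ, hn] at this
    exact D5_ne_of this hn0 hk
  have hG : G2plus = [W (-1) 2, W (-2) 1, W 1 1, W 1 0, W 0 1, W (-1) 1] := by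
    simp only [G2plus, b1W, b2W, b3W, a1W, a2W, a3W]
  unfold Den
  have t1 := key 1 0 1 (by simp [hG]) (by norm_num) (by norm_num) p (by left; ring)
  have t2 := key (-1) 1 1 (by simp [hG]) (by norm_num) (by norm_num) (p - q) (by right; ring)
  have t3 := key 0 1 1 (by simp [hG]) (by norm_num) (by norm_num) (-q) (by right; ring)
  have t4 := key (-1) 2 3 (by simp [hG]) (by norm_num) (by norm_num) ((2 * q - p) / 3) (by left; ring)
  have t5 := key 1 1 3 (by simp [hG]) (by norm_num) (by norm_num) ((p + q) / 3) (by left; ring)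
  have t6 := key (-2) 1 3 (by simp [hG]) (by norm_num) (by norm_num) ((2 * p - q) / 3) (by right; ring)
  exact mul_ne_zero (mul_ne_zero (mul_ne_zero (mul_ne_zero (mul_ne_zero t1 t2) t3) t4) t5) t6

lemma kapS {a b : ℂ} (h : W a b ∈ twoShort) : kap (W a b) = 3 := by
  unfold kap; rw [if_pos h]
lemma kapL {a b : ℂ} (h : W a b ∉ twoShort) : kap (W a b) = 1 := by
  unfold kap; rw [if_neg h]

lemma mu_eq (x1 x2 : ℂ) : muD1 (W x1 x2) = muC x1 x2 := by
  unfold muD1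
  rw [twoG2W]
  simp only [List.map_cons, List.map_nil, List.sum_cons, List.sum_nil]
  rw [kapL (a := -2) (b := 4) (by rw [twoShortW]; simp only [List.mem_cons, W_inj]; norm_num),
    kapL (a := -4) (b := 2) (by rw [twoShortW]; simp only [List.mem_cons, W_inj]; norm_num),
    kapL (a := 2) (b := 2) (by rw [twoShortW]; simp only [List.mem_cons, W_inj]; norm_num),
    kapL (a := 2) (b := -4) (by rw [twoShortW]; simp only [List.mem_cons, W_inj]; norm_num),
    kapL (a := 4) (b := -2) (by rw [twoShortW]; simp only [List.mem_cons, W_inj]; norm_num),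
    kapL (a := -2) (b := -2) (by rw [twoShortW]; simp only [List.mem_cons, W_inj]; norm_num),
    kapS (a := 2) (b := 0) (by rw [twoShortW]; simp only [List.mem_cons, W_inj]; norm_num),
    kapS (a := 0) (b := 2) (by rw [twoShortW]; simp only [List.mem_cons, W_inj]; norm_num),
    kapS (a := -2) (b := 2) (by rw [twoShortW]; simp only [List.mem_cons, W_inj]; norm_num),
    kapS (a := -2) (b := 0) (by rw [twoShortW]; simp only [List.mem_cons, W_inj]; norm_num),
    kapS (a := 0) (b := -2) (by rw [twoShortW]; simp only [List.mem_cons, W_inj]; norm_num),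
    kapS (a := 2) (b := -2) (by rw [twoShortW]; simp only [List.mem_cons, W_inj]; norm_num)]
  simp only [muC, eS, eL, sa, sb, ta, tb, Fin.sum_univ_six, bil_WW]
  simp only [Matrix.cons_val]
  ring_nf

lemma D_eq (m : ℕ) (ψ : (Fin 2 → ℂ) → ℂ) (p q : ℂ) :
    (twoG2.map (fun τ => aD1 m τ (Zc p q) * (ψ (Zc p q + τ) - ψ (Zc p q)))).sum =
      DD m (fun p q => ψ (Zc p q)) p q := by
  rw [twoG2W]
  simp only [List.map_cons, List.map_nil, List.sum_cons, List.sum_nil, aS1, aS2, aS3, aS4, aS5, aS6,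
    aL1, aL2, aL3, aL4, aL5, aL6]
  simp only [W_Z, Z_add]
  unfold DD
  ring_nf

theorem final (m : ℕ) (hm : 1 ≤ m) (x : Fin 2 → ℂ)
    (hx : ∀ γ ∈ AG2plus, Complex.sinh (bil γ x) ≠ 0)
    (ψ : (Fin 2 → ℂ) → ℂ) (hψ : IsBAFunction m x ψ) :
    ∀ z : Fin 2 → ℂ, D1Reg z →
      (twoG2.map (fun τ => aD1 m τ z * (ψ (z + τ) - ψ z))).sum = muD1 x * ψ z := by
  intro z hz
  obtain ⟨p, q, rfl⟩ : ∃ p q, z = Zc p q := ⟨_, _, Z_surj z⟩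
  have r0 := rt3_ne
  obtain ⟨x1, x2, rfl⟩ : ∃ x1 x2, x = W x1 x2 := by
    refine ⟨x 0 - x 1 / rt3, 2 * x 1 / rt3, ?_⟩
    ext i; fin_cases i
    · simp only [W, Fin.zero_eta, Matrix.cons_val_zero]; ring
    · simp only [W, Fin.mk_one, Matrix.cons_val_one, Matrix.cons_val_fin_one]; field_simp
  obtain ⟨P, hdeg, -, hval, hq⟩ := hψ
  have hAG : AG2plus = [W (-1) 2, W (-2) 1, W 1 1, W 1 0, W 0 1, W (-1) 1,
      W 2 0, W 0 2, W (-2) 2] := by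
    simp only [AG2plus, G2plus, b1W, b2W, b3W, a1W, a2W, a3W, W_smul, List.cons_append,
      List.nil_append]
    norm_num
  have hs : ∀ a b c : ℂ, W a b ∈ AG2plus →
      (c = a * x1 + b * x2 + (a * x2 + b * x1) / 2 ∨ c = -(a * x1 + b * x2 + (a * x2 + b * x1) / 2)) →
      Complex.sinh c ≠ 0 := by
    intro a b c h hc
    have := hx _ h
    rw [bil_WW] at this
    rcases hc with rfl | rfl
    · exact this
    · rw [Complex.sinh_neg]; exact neg_ne_zero.2 this
  have hB : ∀ c ∈ [x1 + x2 / 2, (x1 - x2) / 2, -x1 / 2 - x2], sinh (2 * c) ≠ 0 := by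
    intro c hc
    simp only [List.mem_cons, List.not_mem_nil, or_false] at hc
    rcases hc with rfl | rfl | rfl
    · exact hs 2 0 _ (by simp [hAG]) (by left; ring)
    · exact hs (-2) 2 _ (by simp [hAG]) (by right; ring)
    · exact hs 0 2 _ (by simp [hAG]) (by right; ring)
  have hA : ∀ c ∈ [3 * x2 / 2, 3 * (x1 + x2) / 2, 3 * x1 / 2], sinh c ≠ 0 := by
    intro c hc
    simp only [List.mem_cons, List.not_mem_nil, or_false] at hc
    rcases hc with rfl | rfl | rfl
    · exact hs (-1) 2 _ (by simp [hAG]) (by left; ring)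
    · exact hs 1 1 _ (by simp [hAG]) (by left; ring)
    · exact hs (-2) 1 _ (by simp [hAG]) (by right; ring)
  set P' : MP := MvPolynomial.bind₁ ![lin 1 0, lin (-1 / rt3) (2 / rt3)] P with hP'
  have hΦ : (fun p q => ψ (Zc p q)) = pexp P' x1 x2 := by
    funext p q
    rw [hval, pexp, hP', eval_bind_lin]
    congr 2
    · congr 1
      simp only [Zc, Matrix.cons_val_zero, Matrix.cons_val_one, Matrix.cons_val_fin_one]
      congr 1
      · ring
      · congr 1; ring
    · have : bil (Zc p q) (W x1 x2) = bil (W x1 x2) (Zc p q) := by unfold bil; ring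
      rw [this, bil_WZ]
  have hPL : Lt P' (12 * m + 3 + 1) := by
    apply Lt.bind
    · have hP0 : P ≠ 0 := by rintro rfl; simp at hdeg
      rw [Lt.iff hP0, hdeg]; omega
    · intro i; fin_cases i
      · exact lin_hom _ _
      · exact lin_hom _ _
  have hQ := QQ_of hq
  rw [D_eq, mu_eq]
  have e : ψ (Zc p q) = pexp P' x1 x2 p q := by rw [← hΦ]
  rw [e, hΦ]
  rw [hΦ] at hQ
  exact core m hm x1 x2 hB hA P' hPL hQ p q (Den_of hz)
end

/-- The Baker–Akhiezer function for `AG₂` is an eigenfunction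
of the dual difference operator `D₁` with eigenvalue `μ(x)`; this is the
bispectral duality for the `AG₂` generalised CMS system. -/
theorem stmt_13 (m : ℕ) (hm : 1 ≤ m) (x : Fin 2 → ℂ)
    (hx : ∀ γ ∈ AG2plus, Complex.sinh (bil γ x) ≠ 0)
    (ψ : (Fin 2 → ℂ) → ℂ) (hψ : IsBAFunction m x ψ) :
    ∀ z : Fin 2 → ℂ, D1Reg z →
      (twoG2.map (fun τ => aD1 m τ z * (ψ (z + τ) - ψ z))).sum = muD1 x * ψ z := by
  exact final m hm x hx ψ hψ

end
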